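/- Let V : ℝ → ℝ be six times continuously differentiable in a neighbourhood of 0 with V'(0) = 0 and V''(0) = 1, let m, d, a, k > 0, and set Ω² = a²d/k, ω_max = √((a²d + 4k)/m), h = V⁗(0) − (5/3)(V'''(0))², H = V⁗(0) − 2(V'''(0))². Assume h > 0 and Ω² > −16H/(3h). Then there exist δ > 0 and C ≥ 1 such that for every ω ∈ (ω_max, ω_max + δ) there exist two not-identically-zero families x¹ = (x¹_n)_{n∈ℤ} and x² = (x²_n)_{n∈ℤ} of twice continuously differentiable functions x^i_n : ℝ → ℝ satisfying, for all n ∈ ℤ and t ∈ ℝ, m·(x^i_n)''(t) + d·a·V'(a·x^i_n(t)) = k·(x^i_{n+1}(t) − 2x^i_n(t) + x^i_{n−1}(t)), with each x^i_n periodic of period 2π/ω and even in t, with the symmetries x¹_{−n+1}(t) = x¹_n(t + π/ω) and x²_{−n} = x²_n for all n and t, and such that there exists σ > 1 with sup_t |x^i_n(t)| ≤ C (ω − ω_max)^{1/2} σ^{−|n|} for all n and C^{−1}(ω − ω_max)^{1/2} ≤ σ − 1 ≤ C(ω − ω_max)^{1/2}. -/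

import Mathlib

section

open Filter Topology

/-- The Banach fixed point theorem in a weighted sup-norm ball of real families. -/
theorem exists_fixedPoint_of_weighted_contraction {ι : Type*} (Φ : (ι → ℝ) → ι → ℝ)
    (wt : ι → ℝ) (hwt : ∀ i, 0 ≤ wt i) (q : ℝ) (hq0 : 0 ≤ q) (hq1 : q < 1)
    (hLip : ∀ u v : ι → ℝ, ∀ M : ℝ, 0 ≤ M → (∀ i, |u i| ≤ wt i) → (∀ i, |v i| ≤ wt i) →
      (∀ i, |u i - v i| ≤ M * wt i) → ∀ i, |Φ u i - Φ v i| ≤ q * M * wt i)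
    (hzero : ∀ i, |Φ 0 i| ≤ (1 - q) * wt i) :
    ∃ u : ι → ℝ, (∀ i, |u i| ≤ wt i) ∧ Φ u = u := by
  have hball : ∀ u : ι → ℝ, (∀ i, |u i| ≤ wt i) → ∀ i, |Φ u i| ≤ wt i := by
    intro u hu i
    have h1 := hLip u 0 1 zero_le_one hu (fun i => by simpa using hwt i)
      (fun i => by simpa using hu i) i
    have h2 := hzero i
    have h3 := abs_sub_abs_le_abs_sub (Φ u i) (Φ 0 i)
    linarith
  let U : ℕ → ι → ℝ := fun k => Φ^[k] 0
  have hU : ∀ k, U (k + 1) = Φ (U k) := fun k => Function.iterate_succ_apply' Φ k 0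
  have hUb : ∀ k i, |U k i| ≤ wt i := by
    intro k
    induction k with
    | zero => intro i; simpa [U] using hwt i
    | succ k ih => rw [hU]; exact hball _ ih
  have hstep : ∀ k i, |U (k + 1) i - U k i| ≤ q ^ k * wt i := by
    intro k
    induction k with
    | zero => intro i; simpa [U] using hball 0 (fun i => by simpa using hwt i) i
    | succ k ih =>
      intro i
      have h := hLip (U (k + 1)) (U k) (q ^ k) (pow_nonneg hq0 k) (hUb _) (hUb _) ih i
      rw [hU (k + 1)]
      nth_rewrite 2 [hU k]
      rw [pow_succ']
      exact h
  have hgeo : ∀ i k, dist (U k i) (U (k + 1) i) ≤ wt i * q ^ k := by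
    intro i k
    rw [dist_comm, Real.dist_eq, mul_comm]
    exact hstep k i
  choose u hu using fun i => cauchySeq_tendsto_of_complete
    (cauchySeq_of_le_geometric q (wt i) hq1 (hgeo i))
  have hub : ∀ i, |u i| ≤ wt i := fun i =>
    le_of_tendsto (hu i).abs (Eventually.of_forall fun k => hUb k i)
  have hrate : ∀ k i, |u i - U k i| ≤ (q ^ k / (1 - q)) * wt i := by
    intro k i
    have h := dist_le_of_le_geometric_of_tendsto q (wt i) hq1 (hgeo i) (hu i) k
    rw [dist_comm, Real.dist_eq] at h
    calc _ ≤ _ := h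
      _ = _ := by ring
  refine ⟨u, hub, funext fun i => ?_⟩
  have h1 : Tendsto (fun k => U (k + 1) i) atTop (𝓝 (u i)) := (tendsto_add_atTop_iff_nat 1).2 (hu i)
  refine tendsto_nhds_unique ?_ h1
  have h2 : Tendsto (fun k : ℕ => q * (q ^ k / (1 - q)) * wt i) atTop (𝓝 0) := by
    have := ((tendsto_pow_atTop_nhds_zero_of_lt_one hq0 hq1).div_const (1 - q)).const_mul q
    simpa using this.mul_const (wt i)
  rw [tendsto_iff_dist_tendsto_zero]
  refine squeeze_zero (fun _ => dist_nonneg) (fun k => ?_) h2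
  rw [hU, dist_comm, Real.dist_eq]
  exact hLip u (U k) _ (div_nonneg (pow_nonneg hq0 k) (by linarith)) hub (hUb k) (hrate k) i

end

section

open Filter Topology Set

/-- If `g' - p'` is `O(|y|^k)` near zero and `g 0 = p 0`, then `g - p` is `O(|y|^(k+1))`. -/
theorem abs_le_mul_pow_succ_of_deriv_bound {g g' : ℝ → ℝ} {r C : ℝ} {k : ℕ}
    (hg : ∀ y, |y| ≤ r → HasDerivAt g (g' y) y) (h0 : g 0 = 0)
    (hb : ∀ y, |y| ≤ r → |g' y| ≤ C * |y| ^ k) :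
    ∀ y, |y| ≤ r → |g y| ≤ C * |y| ^ (k + 1) := by
  intro y hy
  have hsub : ∀ x ∈ Icc (-|y|) |y|, |x| ≤ |y| := fun x hx => abs_le.2 hx
  have hC : ∀ x ∈ Icc (-|y|) |y|, ‖g' x‖ ≤ C * |y| ^ k := by
    intro x hx
    have hx' := hsub x hx
    have h1 := hb x (hx'.trans hy)
    have h2 := hb y hy
    rcases eq_or_lt_of_le (abs_nonneg y) with h | h
    · have : x = y := by
        have : y = 0 := abs_eq_zero.1 h.symm
        have h3 : x = 0 := abs_eq_zero.1 (le_antisymm (by simpa [this] using hx') (abs_nonneg x))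
        rw [h3, this]
      rw [this]; exact h2
    · have hC0 : 0 ≤ C := by
        have := (abs_nonneg _).trans h2
        exact nonneg_of_mul_nonneg_left this (pow_pos h k)
      exact h1.trans (by gcongr)
  have := Convex.norm_image_sub_le_of_norm_hasDerivWithin_le
    (f := g) (f' := g') (s := Icc (-|y|) |y|) (C := C * |y| ^ k) (x := 0) (y := y)
    (fun x hx => (hg x ((hsub x hx).trans hy)).hasDerivWithinAt) hC (convex_Icc _ _)
    ⟨by simp, abs_nonneg y⟩ ⟨neg_abs_le y, le_abs_self y⟩
  simpa [h0, pow_succ, mul_assoc] using this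

/-- Cubic Taylor expansion of `V'` at a critical point, with a remainder whose Lipschitz constant
is cubic. -/
theorem exists_lipschitz_taylor_deriv (V : ℝ → ℝ)
    (hV : ∃ r > (0 : ℝ), ContDiffOn ℝ 6 V (Metric.ball 0 r))
    (hV2 : iteratedDeriv 2 V 0 = 1) :
    ∃ r > (0 : ℝ), ∃ C > (0 : ℝ), ContinuousOn (deriv V) (Icc (-r) r) ∧
      ∀ e ≤ r, ∀ y y' : ℝ, |y| ≤ e → |y'| ≤ e →
      |(deriv V y - y - iteratedDeriv 3 V 0 / 2 * y ^ 2 - iteratedDeriv 4 V 0 / 6 * y ^ 3) -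
        (deriv V y' - y' - iteratedDeriv 3 V 0 / 2 * y' ^ 2 - iteratedDeriv 4 V 0 / 6 * y' ^ 3)|
        ≤ C * e ^ 3 * |y - y'| := by
  obtain ⟨R, hR, hVR⟩ := hV
  have hopen : IsOpen (Metric.ball (0 : ℝ) R) := Metric.isOpen_ball
  have hder : ∀ n : ℕ, n < 6 → ∀ y ∈ Metric.ball (0 : ℝ) R,
      HasDerivAt (iteratedDeriv n V) (iteratedDeriv (n + 1) V y) y := by
    intro n hn y hy
    have hd : DifferentiableAt ℝ (iteratedDeriv n V) y := by
      have h := (hVR.differentiableOn_iteratedDerivWithin (m := n) (by exact_mod_cast hn)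
        hopen.uniqueDiffOn).differentiableAt (hopen.mem_nhds hy)
      refine h.congr_of_eventuallyEq ?_
      filter_upwards [hopen.mem_nhds hy] with x hx
      exact (iteratedDerivWithin_of_isOpen hopen hx).symm
    rw [iteratedDeriv_succ]
    exact hd.hasDerivAt
  set r := min (R / 2) 1 with hr
  have hr0 : 0 < r := by positivity
  have hrR : ∀ y, |y| ≤ r → y ∈ Metric.ball (0 : ℝ) R := by
    intro y hy
    rw [Metric.mem_ball, dist_zero_right, Real.norm_eq_abs]
    have := min_le_left (R / 2) 1
    linarith
  have hc5 : ContinuousOn (iteratedDeriv 5 V) (Icc (-r) r) := fun y hy =>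
    ((hder 5 (by norm_num) y (hrR y (abs_le.2 hy))).continuousAt).continuousWithinAt
  obtain ⟨C₀, hC₀⟩ := isCompact_Icc.exists_bound_of_continuousOn hc5
  have hb5 : ∀ y, |y| ≤ r → |iteratedDeriv 5 V y| ≤ C₀ * |y| ^ 0 := by
    intro y hy; simpa using hC₀ y (abs_le.1 hy)
  have hb4 := abs_le_mul_pow_succ_of_deriv_bound (r := r) (k := 0) (C := C₀)
    (g := fun y => iteratedDeriv 4 V y - iteratedDeriv 4 V 0) (g' := iteratedDeriv 5 V)
    (fun y hy => (hder 4 (by norm_num) y (hrR y hy)).sub_const _) (by simp) hb5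
  have hb3 := abs_le_mul_pow_succ_of_deriv_bound (r := r) (k := 1) (C := C₀)
    (g := fun y => iteratedDeriv 3 V y - iteratedDeriv 3 V 0 - iteratedDeriv 4 V 0 * y)
    (g' := fun y => iteratedDeriv 4 V y - iteratedDeriv 4 V 0)
    (fun y hy => (((hder 3 (by norm_num) y (hrR y hy)).sub_const (iteratedDeriv 3 V 0)).sub
      ((hasDerivAt_id y).const_mul (iteratedDeriv 4 V 0))).congr_deriv (by ring))
    (by simp) hb4
  have hb2 := abs_le_mul_pow_succ_of_deriv_bound (r := r) (k := 2) (C := C₀)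
    (g := fun y => iteratedDeriv 2 V y - 1 - iteratedDeriv 3 V 0 * y
      - iteratedDeriv 4 V 0 / 2 * y ^ 2)
    (g' := fun y => iteratedDeriv 3 V y - iteratedDeriv 3 V 0 - iteratedDeriv 4 V 0 * y)
    (fun y hy => ((((hder 2 (by norm_num) y (hrR y hy)).sub_const 1).sub
      ((hasDerivAt_id y).const_mul (iteratedDeriv 3 V 0))).sub
      ((hasDerivAt_pow 2 y).const_mul (iteratedDeriv 4 V 0 / 2))).congr_deriv
        (by push_cast; ring)) (by simp [hV2]) hb3
  have hC0 : 0 ≤ C₀ := by simpa using (abs_nonneg _).trans (hb5 0 (by simpa using hr0.le))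
  refine ⟨r, hr0, C₀ + 1, by linarith, ?_, ?_⟩
  · intro y hy
    have := (hder 1 (by norm_num) y (hrR y (abs_le.2 hy))).continuousAt.continuousWithinAt
      (s := Icc (-r) r)
    simpa [iteratedDeriv_one] using this
  · intro e he y y' hy hy'
    have he0 : 0 ≤ e := (abs_nonneg y).trans hy
    have := Convex.norm_image_sub_le_of_norm_hasDerivWithin_le
      (f := fun y => deriv V y - y - iteratedDeriv 3 V 0 / 2 * y ^ 2
        - iteratedDeriv 4 V 0 / 6 * y ^ 3)
      (f' := fun y => iteratedDeriv 2 V y - 1 - iteratedDeriv 3 V 0 * y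
        - iteratedDeriv 4 V 0 / 2 * y ^ 2)
      (s := Icc (-e) e) (C := (C₀ + 1) * e ^ 3) (x := y') (y := y)
      (fun x hx => by
        have hx' : |x| ≤ r := (abs_le.2 hx).trans he
        have h1 := hder 1 (by norm_num) x (hrR x hx')
        rw [iteratedDeriv_one] at h1
        exact ((((h1.sub (hasDerivAt_id x)).sub
          ((hasDerivAt_pow 2 x).const_mul (iteratedDeriv 3 V 0 / 2))).sub
          ((hasDerivAt_pow 3 x).const_mul (iteratedDeriv 4 V 0 / 6))).congr_deriv
          (by push_cast; ring)).hasDerivWithinAt) (fun x hx => by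
        have hx' : |x| ≤ e := abs_le.2 hx
        refine (hb2 x (hx'.trans he)).trans ?_
        have : |x| ^ 3 ≤ e ^ 3 := by gcongr
        have h0 : 0 ≤ |x| ^ 3 := by positivity
        norm_num
        nlinarith) (convex_Icc _ _) (abs_le.1 hy') (abs_le.1 hy)
    simpa using this

end

theorem abs_mul_sub_mul_le_of_le {a b a' b' X Y dx dy : ℝ} (ha : |a| ≤ X) (hb : |b'| ≤ Y)
    (hx : |a - a'| ≤ dx) (hy : |b - b'| ≤ dy) : |a * b - a' * b'| ≤ X * dy + Y * dx := by
  have h : a * b - a' * b' = a * (b - b') + b' * (a - a') := by ring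
  rw [h]
  refine (abs_add_le _ _).trans ?_
  rw [abs_mul, abs_mul]
  have := (abs_nonneg a).trans ha
  have := (abs_nonneg b').trans hb
  gcongr

/-- The displacement built from the first harmonic amplitude `A`, its quadratic response and a
correction `s`, at a phase of cosine `c`. -/
def breatherAnsatz (p₀ p₂ A s c : ℝ) : ℝ := A * c + A ^ 2 * (p₀ + p₂ * (2 * c ^ 2 - 1)) + s

/-- The nonlinear part of the force along the ansatz, without its leading quadratic term. -/
noncomputable def forceRemainder (W : ℝ → ℝ) (α p₀ p₂ A s c : ℝ) : ℝ :=
  W (breatherAnsatz p₀ p₂ A s c) - breatherAnsatz p₀ p₂ A s c - α / 2 * A ^ 2 * c ^ 2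

/-- The nonlinear part of the force along the ansatz, without its quadratic and cubic terms. -/
noncomputable def forceRemainderCubic (W : ℝ → ℝ) (α β p₀ p₂ A s c : ℝ) : ℝ :=
  forceRemainder W α p₀ p₂ A s c -
    A ^ 3 * (α * c * (p₀ + p₂ * (2 * c ^ 2 - 1)) + β / 6 * c ^ 3)

set_option maxHeartbeats 800000 in
theorem exists_lipschitz_forceRemainderCubic (W : ℝ → ℝ) (α β p₀ p₂ : ℝ) {r C : ℝ} (hr : 0 < r)
    (hC : 0 < C)
    (hW : ∀ e ≤ r, ∀ y y' : ℝ, |y| ≤ e → |y'| ≤ e →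
      |(W y - y - α / 2 * y ^ 2 - β / 6 * y ^ 3) - (W y' - y' - α / 2 * y' ^ 2 - β / 6 * y' ^ 3)|
        ≤ C * e ^ 3 * |y - y'|) :
    ∃ K > (0 : ℝ), ∃ e₀ > (0 : ℝ), ∀ e ς c A A' s s' : ℝ, e ≤ e₀ → ς ≤ e ^ 2 → |c| ≤ 1 →
      |A| ≤ e → |A'| ≤ e → |s| ≤ ς → |s'| ≤ ς →
      |forceRemainderCubic W α β p₀ p₂ A s c - forceRemainderCubic W α β p₀ p₂ A' s' c| ≤
          K * ((e ^ 3 + ς) * |A - A'| + e * |s - s'|) ∧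
      |forceRemainder W α p₀ p₂ A s c - forceRemainder W α p₀ p₂ A' s' c| ≤
          K * (e ^ 2 * |A - A'| + e * |s - s'|) ∧
      |breatherAnsatz p₀ p₂ A s c| ≤ r := by
  set P := |p₀| + |p₂| with hP
  have hP0 : 0 ≤ P := by positivity
  set L := P + 2 with hL
  have hL0 : 2 ≤ L := by linarith
  obtain ⟨K₁, hK₁⟩ : ∃ x, x = |α| + 2 * |α| * L ^ 2 + |β| * (2 * L + 3 * L ^ 2 + L ^ 3) +
    C * L ^ 3 * (1 + 2 * L) := ⟨_, rfl⟩
  have hK₁0 : 0 < K₁ := by rw [hK₁]; positivity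
  refine ⟨2 * K₁ + 3 * (|α| * P + |β|), by positivity, min 1 (r / L), by positivity, ?_⟩
  intro e ς c A A' s s' he hς hc hA hA' hs hs'
  have he1 : e ≤ 1 := he.trans (min_le_left _ _)
  have heL : L * e ≤ r := by
    have := he.trans (min_le_right _ _)
    rw [le_div_iff₀ (by positivity)] at this
    linarith
  have he0 : 0 ≤ e := (abs_nonneg A).trans hA
  have hς0 : 0 ≤ ς := (abs_nonneg s).trans hs
  set dA := |A - A'| with hdA
  set ds := |s - s'| with hds
  have hdA0 : 0 ≤ dA := abs_nonneg _
  have hds0 : 0 ≤ ds := abs_nonneg _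
  set p := p₀ + p₂ * (2 * c ^ 2 - 1) with hp
  have hc2 : c ^ 2 ≤ 1 := by rw [← sq_abs]; exact pow_le_one₀ (abs_nonneg c) hc
  have hc2' : |2 * c ^ 2 - 1| ≤ 1 := by rw [abs_le]; constructor <;> linarith only [sq_nonneg c, hc2]
  have hpP : |p| ≤ P := by
    refine (abs_add_le _ _).trans ?_
    rw [abs_mul]
    have := mul_le_mul_of_nonneg_left hc2' (abs_nonneg p₂)
    linarith
  obtain ⟨v, hv⟩ : ∃ x, x = A ^ 2 * p + s := ⟨_, rfl⟩
  obtain ⟨v', hv'⟩ : ∃ x, x = A' ^ 2 * p + s' := ⟨_, rfl⟩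
  obtain ⟨y, hy⟩ : ∃ x, x = A * c + v := ⟨_, rfl⟩
  obtain ⟨y', hy'⟩ : ∃ x, x = A' * c + v' := ⟨_, rfl⟩
  have hay : breatherAnsatz p₀ p₂ A s c = y := by rw [breatherAnsatz, hy, hv]; ring
  have hay' : breatherAnsatz p₀ p₂ A' s' c = y' := by rw [breatherAnsatz, hy', hv']; ring
  have hvb : ∀ A s : ℝ, |A| ≤ e → |s| ≤ ς → |A ^ 2 * p + s| ≤ L * e ^ 2 := by
    intro A s hA hs
    refine (abs_add_le _ _).trans ?_
    rw [abs_mul, abs_pow]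
    have : |A| ^ 2 * |p| ≤ e ^ 2 * P := by gcongr
    have := sq_nonneg e
    rw [hL]; linarith
  have hvL : |v| ≤ L * e ^ 2 := hv ▸ hvb A s hA hs
  have hvL' : |v'| ≤ L * e ^ 2 := hv' ▸ hvb A' s' hA' hs'
  have hee : e ^ 2 ≤ e := by rw [sq]; exact mul_le_of_le_one_left he0 he1
  have hyb : ∀ A v : ℝ, |A| ≤ e → |v| ≤ (L - 1) * e → |A * c + v| ≤ L * e := by
    intro A v hA hv
    refine (abs_add_le _ _).trans ?_
    rw [abs_mul]
    have : |A| * |c| ≤ e * 1 := by gcongr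
    linarith
  have hvb' : ∀ A s : ℝ, |A| ≤ e → |s| ≤ ς → |A ^ 2 * p + s| ≤ (L - 1) * e := by
    intro A s hA hs
    refine (abs_add_le _ _).trans ?_
    rw [abs_mul, abs_pow]
    have : |A| ^ 2 * |p| ≤ e * P := by
      calc |A| ^ 2 * |p| ≤ e ^ 2 * P := by gcongr
        _ ≤ e * P := by gcongr
    rw [hL]; linarith
  have hyL : |y| ≤ L * e := hy ▸ hyb A v hA (hv ▸ hvb' A s hA hs)
  have hyL' : |y'| ≤ L * e := hy' ▸ hyb A' v' hA' (hv' ▸ hvb' A' s' hA' hs')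
  have hA2 : |A ^ 2 - A' ^ 2| ≤ 2 * e * dA := by
    have := abs_mul_sub_mul_le_of_le hA hA' (le_refl |A - A'|) (le_refl |A - A'|)
    rw [sq, sq]; linarith
  have hA3 : |A ^ 3 - A' ^ 3| ≤ 3 * e ^ 2 * dA := by
    have h1 : |A'| ≤ e := hA'
    have h2 : |A ^ 2| ≤ e ^ 2 := by rw [abs_pow]; gcongr
    have := abs_mul_sub_mul_le_of_le h2 h1 hA2 (le_refl |A - A'|)
    calc |A ^ 3 - A' ^ 3| = |A ^ 2 * A - A' ^ 2 * A'| := by ring_nf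
      _ ≤ _ := this
      _ = _ := by ring
  obtain ⟨dv, hdv⟩ : ∃ x, x = 2 * L * (e * dA + ds) := ⟨_, rfl⟩
  have hdv0 : 0 ≤ dv := by rw [hdv]; positivity
  have hvv : |v - v'| ≤ dv := by
    have : v - v' = (A ^ 2 - A' ^ 2) * p + (s - s') := by rw [hv, hv']; ring
    rw [this]
    refine (abs_add_le _ _).trans ?_
    rw [abs_mul]
    have h1 : |A ^ 2 - A' ^ 2| * |p| ≤ 2 * e * dA * P := by gcongr
    have h2 : 0 ≤ e * dA := by positivity
    have h3 : 0 ≤ P * ds := by positivity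
    rw [hdv, hL]; linarith
  obtain ⟨Z, hZ⟩ : ∃ x, x = e ^ 3 * dA + e ^ 2 * ds := ⟨_, rfl⟩
  have hZ0 : 0 ≤ Z := by rw [hZ]; positivity
  have hdvZ : e ^ 2 * dv = 2 * L * Z := by rw [hdv, hZ]; ring
  have he32 : e ^ 3 ≤ e ^ 2 := pow_le_pow_of_le_one he0 he1 (by norm_num)
  have he43 : e ^ 4 ≤ e ^ 3 := pow_le_pow_of_le_one he0 he1 (by norm_num)
  have he42 : e ^ 4 ≤ e ^ 2 := pow_le_pow_of_le_one he0 he1 (by norm_num)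
  have hdv3 : e ^ 3 * dv ≤ 2 * L * Z := by rw [← hdvZ]; gcongr
  have hdv4 : e ^ 4 * dv ≤ 2 * L * Z := by rw [← hdvZ]; gcongr
  have hAZ : e ^ 3 * dA ≤ Z := by rw [hZ]; have : 0 ≤ e ^ 2 * ds := by positivity
                                  linarith
  have hAZ4 : e ^ 4 * dA ≤ Z := le_trans (by gcongr) hAZ
  have hT1 : |A * s - A' * s'| ≤ e * ds + ς * dA :=
    abs_mul_sub_mul_le_of_le hA hs' le_rfl le_rfl
  have hv2 : |v * v - v' * v'| ≤ 2 * (L * e ^ 2 * dv) := by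
    have := abs_mul_sub_mul_le_of_le hvL hvL' hvv hvv
    linarith
  have hvv2 : |v * v| ≤ L ^ 2 * e ^ 4 := by
    rw [abs_mul]
    calc |v| * |v| ≤ (L * e ^ 2) * (L * e ^ 2) := by gcongr
      _ = _ := by ring
  have hvv2' : |v' * v'| ≤ L ^ 2 * e ^ 4 := by
    rw [abs_mul]
    calc |v'| * |v'| ≤ (L * e ^ 2) * (L * e ^ 2) := by gcongr
      _ = _ := by ring
  have hS1 : |A ^ 2 * v - A' ^ 2 * v'| ≤ e ^ 2 * dv + L * e ^ 2 * (2 * e * dA) :=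
    abs_mul_sub_mul_le_of_le (by rw [abs_pow]; gcongr) hvL' hA2 hvv
  have hS2 : |A * (v * v) - A' * (v' * v')| ≤ e * (2 * (L * e ^ 2 * dv)) + L ^ 2 * e ^ 4 * dA :=
    abs_mul_sub_mul_le_of_le hA hvv2' le_rfl hv2
  have hS3 : |v * v * v - v' * v' * v'| ≤ L ^ 2 * e ^ 4 * dv + L * e ^ 2 * (2 * (L * e ^ 2 * dv)) :=
    abs_mul_sub_mul_le_of_le hvv2 hvL' hv2 hvv
  have hT3 : |(3 * c ^ 2 * (A ^ 2 * v - A' ^ 2 * v') + 3 * c * (A * (v * v) - A' * (v' * v')) +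
      (v * v * v - v' * v' * v'))| ≤ 6 * (2 * L + 3 * L ^ 2 + L ^ 3) * Z := by
    refine (abs_add_le _ _).trans ((add_le_add_left (abs_add_le _ _) _).trans ?_)
    have h1 : |3 * c ^ 2 * (A ^ 2 * v - A' ^ 2 * v')| ≤
        3 * (e ^ 2 * dv + L * e ^ 2 * (2 * e * dA)) := by
      rw [abs_mul, abs_of_nonneg (by positivity : 0 ≤ 3 * c ^ 2)]
      calc _ ≤ 3 * 1 * (e ^ 2 * dv + L * e ^ 2 * (2 * e * dA)) := by gcongr
        _ = _ := by ring
    have h2 : |3 * c * (A * (v * v) - A' * (v' * v'))| ≤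
        3 * (e * (2 * (L * e ^ 2 * dv)) + L ^ 2 * e ^ 4 * dA) := by
      rw [abs_mul, abs_mul, abs_of_nonneg (by norm_num : (0:ℝ) ≤ 3)]
      calc _ ≤ 3 * 1 * (e * (2 * (L * e ^ 2 * dv)) + L ^ 2 * e ^ 4 * dA) := by gcongr
        _ = _ := by ring
    have g1 : 3 * (e ^ 2 * dv + L * e ^ 2 * (2 * e * dA)) ≤ 12 * L * Z := by
      have : L * (e ^ 3 * dA) ≤ L * Z := by gcongr
      linarith
    have g2 : 3 * (e * (2 * (L * e ^ 2 * dv)) + L ^ 2 * e ^ 4 * dA) ≤ 12 * L ^ 2 * Z + 3 * L ^ 2 * Z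
        := by
      have t1 : L ^ 2 * (e ^ 4 * dA) ≤ L ^ 2 * Z := by gcongr
      have t2 : L * (e ^ 3 * dv) ≤ L * (2 * L * Z) := by gcongr
      linarith
    have g3 : L ^ 2 * e ^ 4 * dv + L * e ^ 2 * (2 * (L * e ^ 2 * dv)) ≤ 6 * L ^ 3 * Z := by
      have t2 : L ^ 2 * (e ^ 4 * dv) ≤ L ^ 2 * (2 * L * Z) := by gcongr
      linarith
    have g4 : 0 ≤ L ^ 2 * Z := by positivity
    linarith
  have hyy : |y - y'| ≤ dA + dv := by
    have : y - y' = (A - A') * c + (v - v') := by rw [hy, hy']; ring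
    rw [this]
    refine (abs_add_le _ _).trans (add_le_add ?_ hvv)
    rw [abs_mul]
    exact mul_le_of_le_one_right (abs_nonneg _) hc
  have hT4 := hW (L * e) heL y y' hyL hyL'
  have hT4' : C * (L * e) ^ 3 * |y - y'| ≤ C * L ^ 3 * (1 + 2 * L) * Z := by
    calc C * (L * e) ^ 3 * |y - y'| ≤ C * (L * e) ^ 3 * (dA + dv) := by gcongr
      _ = C * L ^ 3 * (e ^ 3 * dA + e ^ 3 * dv) := by ring
      _ ≤ C * L ^ 3 * (Z + 2 * L * Z) := by gcongr
      _ = _ := by ring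
  have hR : forceRemainderCubic W α β p₀ p₂ A s c - forceRemainderCubic W α β p₀ p₂ A' s' c =
      α * c * (A * s - A' * s') + α / 2 * (v * v - v' * v') +
      β / 6 * (3 * c ^ 2 * (A ^ 2 * v - A' ^ 2 * v') + 3 * c * (A * (v * v) - A' * (v' * v')) +
      (v * v * v - v' * v' * v')) +
      ((W y - y - α / 2 * y ^ 2 - β / 6 * y ^ 3) -
        (W y' - y' - α / 2 * y' ^ 2 - β / 6 * y' ^ 3)) := by
    simp only [forceRemainderCubic, forceRemainder, hay, hay', ← hp]
    have e1 : s = v - A ^ 2 * p := by rw [hv]; ring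
    have e2 : s' = v' - A' ^ 2 * p := by rw [hv']; ring
    rw [e1, e2, hy, hy']
    ring
  have hZle : Z ≤ (e ^ 3 + ς) * dA + e * ds := by
    have : e ^ 2 * ds ≤ e * ds := by gcongr
    have : 0 ≤ ς * dA := by positivity
    rw [hZ]; linarith
  have hmain : |forceRemainderCubic W α β p₀ p₂ A s c - forceRemainderCubic W α β p₀ p₂ A' s' c| ≤
      K₁ * ((e ^ 3 + ς) * dA + e * ds) := by
    rw [hR]
    refine (abs_add_le _ _).trans (le_trans (add_le_add
      ((abs_add_le _ _).trans (add_le_add (abs_add_le _ _) le_rfl)) hT4) ?_)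
    have h1 : |α * c * (A * s - A' * s')| ≤ |α| * ((e ^ 3 + ς) * dA + e * ds) := by
      rw [abs_mul, abs_mul]
      have : 0 ≤ e ^ 3 * dA := by positivity
      calc |α| * |c| * |A * s - A' * s'| ≤ |α| * 1 * (e * ds + ς * dA) := by gcongr
        _ ≤ |α| * ((e ^ 3 + ς) * dA + e * ds) := by
          rw [mul_one]
          exact mul_le_mul_of_nonneg_left (by linarith only [this]) (abs_nonneg α)
    have h2 : |α / 2 * (v * v - v' * v')| ≤ 2 * |α| * L ^ 2 * Z := by
      rw [abs_mul, abs_div, abs_of_nonneg (by norm_num : (0:ℝ) ≤ 2)]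
      calc |α| / 2 * |v * v - v' * v'| ≤ |α| / 2 * (2 * (L * e ^ 2 * dv)) := by gcongr
        _ = |α| * L * (e ^ 2 * dv) := by ring
        _ = _ := by rw [hdvZ]; ring
    have h3 : |β / 6 * (3 * c ^ 2 * (A ^ 2 * v - A' ^ 2 * v') +
        3 * c * (A * (v * v) - A' * (v' * v')) + (v * v * v - v' * v' * v'))| ≤
        |β| * (2 * L + 3 * L ^ 2 + L ^ 3) * Z := by
      rw [abs_mul, abs_div, abs_of_nonneg (by norm_num : (0:ℝ) ≤ 6)]
      calc _ ≤ |β| / 6 * (6 * (2 * L + 3 * L ^ 2 + L ^ 3) * Z) := by gcongr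
        _ = _ := by ring
    have h4 : (2 * |α| * L ^ 2 + |β| * (2 * L + 3 * L ^ 2 + L ^ 3) + C * L ^ 3 * (1 + 2 * L)) * Z ≤
        (2 * |α| * L ^ 2 + |β| * (2 * L + 3 * L ^ 2 + L ^ 3) + C * L ^ 3 * (1 + 2 * L)) *
        ((e ^ 3 + ς) * dA + e * ds) := by gcongr
    rw [hK₁]
    linarith only [h1, h2, h3, h4, hT4']
  have hYnn : 0 ≤ (e ^ 3 + ς) * dA + e * ds := by positivity
  refine ⟨hmain.trans ?_, ?_, by rw [hay]; exact hyL.trans heL⟩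
  · exact mul_le_mul_of_nonneg_right
      (by linarith only [hK₁0, mul_nonneg (abs_nonneg α) hP0, abs_nonneg β]) hYnn
  · have hF : forceRemainder W α p₀ p₂ A s c - forceRemainder W α p₀ p₂ A' s' c =
        (forceRemainderCubic W α β p₀ p₂ A s c - forceRemainderCubic W α β p₀ p₂ A' s' c) +
        (A ^ 3 - A' ^ 3) * (α * c * p + β / 6 * c ^ 3) := by
      simp only [forceRemainderCubic]; ring
    rw [hF]
    refine (abs_add_le _ _).trans ?_
    have h5 : |α * c * p + β / 6 * c ^ 3| ≤ |α| * P + |β| := by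
      refine (abs_add_le _ _).trans ?_
      rw [abs_mul, abs_mul, abs_mul, abs_pow, abs_div, abs_of_nonneg (by norm_num : (0:ℝ) ≤ 6)]
      have t1 : |α| * |c| * |p| ≤ |α| * 1 * P := by gcongr
      have t2 : |β| / 6 * |c| ^ 3 ≤ |β| / 6 * 1 := by
        gcongr; exact pow_le_one₀ (abs_nonneg c) hc
      have := abs_nonneg β
      linarith
    have h6 : |(A ^ 3 - A' ^ 3) * (α * c * p + β / 6 * c ^ 3)| ≤
        3 * (|α| * P + |β|) * (e ^ 2 * dA) := by
      rw [abs_mul]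
      calc _ ≤ 3 * e ^ 2 * dA * (|α| * P + |β|) := by gcongr
        _ = _ := by ring
    have h7 : K₁ * ((e ^ 3 + ς) * dA + e * ds) ≤ 2 * K₁ * (e ^ 2 * dA + e * ds) := by
      have : (e ^ 3 + ς) * dA + e * ds ≤ 2 * (e ^ 2 * dA + e * ds) := by
        have : (e ^ 3 + ς) * dA ≤ (2 * e ^ 2) * dA := by gcongr; linarith
        have : 0 ≤ e * ds := by positivity
        linarith
      calc _ ≤ K₁ * (2 * (e ^ 2 * dA + e * ds)) := by gcongr
        _ = _ := by ring
    have h8 : 0 ≤ 3 * (|α| * P + |β|) * (e * ds) := by positivity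
    linarith only [hmain, h6, h7, h8]

@[simp] theorem forceRemainder_zero {W : ℝ → ℝ} (hW : W 0 = 0) (α p₀ p₂ c : ℝ) :
    forceRemainder W α p₀ p₂ 0 0 c = 0 := by simp [forceRemainder, breatherAnsatz, hW]

@[simp] theorem forceRemainderCubic_zero {W : ℝ → ℝ} (hW : W 0 = 0) (α β p₀ p₂ c : ℝ) :
    forceRemainderCubic W α β p₀ p₂ 0 0 c = 0 := by
  simp [forceRemainderCubic, forceRemainder_zero hW]

section

open Filter Topology Set MeasureTheory Real

/-- The `j`-th cosine Fourier coefficient of a `2 * π`-periodic function. -/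
noncomputable def cosCoeff (j : ℕ) (f : ℝ → ℝ) : ℝ :=
  (if j = 0 then 1 else 2) * (2 * π)⁻¹ * ∫ τ in (0)..(2 * π), f τ * cos (j * τ)

theorem cosCoeff_add {f g : ℝ → ℝ} (hf : Continuous f) (hg : Continuous g) (j : ℕ) :
    cosCoeff j (fun τ => f τ + g τ) = cosCoeff j f + cosCoeff j g := by
  have h1 : Continuous fun τ : ℝ => f τ * cos (j * τ) := by fun_prop
  have h2 : Continuous fun τ : ℝ => g τ * cos (j * τ) := by fun_prop
  simp only [cosCoeff, add_mul]
  rw [intervalIntegral.integral_add (h1.intervalIntegrable _ _) (h2.intervalIntegrable _ _)]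
  ring

theorem cosCoeff_const_mul (c : ℝ) (f : ℝ → ℝ) (j : ℕ) :
    cosCoeff j (fun τ => c * f τ) = c * cosCoeff j f := by
  simp only [cosCoeff, mul_assoc, intervalIntegral.integral_const_mul]
  ring

theorem cosCoeff_sub {f g : ℝ → ℝ} (hf : Continuous f) (hg : Continuous g) (j : ℕ) :
    cosCoeff j (fun τ => f τ - g τ) = cosCoeff j f - cosCoeff j g := by
  have hg' : Continuous fun τ => (-1) * g τ := continuous_const.mul hg
  have h := cosCoeff_add hf hg' j
  rw [cosCoeff_const_mul] at h
  simp only [neg_mul, one_mul, ← sub_eq_add_neg] at h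
  exact h

theorem abs_cosCoeff_le {f : ℝ → ℝ} {M : ℝ} (hM : ∀ τ, |f τ| ≤ M) (j : ℕ) :
    |cosCoeff j f| ≤ 2 * M := by
  have hM0 : 0 ≤ M := (abs_nonneg _).trans (hM 0)
  have h : |∫ τ in (0)..(2 * π), f τ * cos (j * τ)| ≤ M * |2 * π - 0| := by
    rw [← Real.norm_eq_abs]
    refine intervalIntegral.norm_integral_le_of_norm_le_const fun τ _ => ?_
    rw [norm_mul, Real.norm_eq_abs, Real.norm_eq_abs]
    exact (mul_le_of_le_one_right (abs_nonneg _) (abs_cos_le_one _)).trans (hM τ)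
  rw [sub_zero, abs_of_pos two_pi_pos] at h
  have h2 : |(if j = 0 then (1 : ℝ) else 2)| ≤ 2 := by split_ifs <;> norm_num
  rw [cosCoeff, abs_mul, abs_mul, abs_of_pos (inv_pos.2 two_pi_pos)]
  calc _ ≤ 2 * (2 * π)⁻¹ * (M * (2 * π)) := by gcongr
    _ = _ := by field_simp

theorem integral_cos_int_mul {n : ℤ} (hn : n ≠ 0) :
    ∫ τ in (0)..(2 * π), cos (n * τ) = 0 := by
  have hn' : (n : ℝ) ≠ 0 := by exact_mod_cast hn
  rw [intervalIntegral.integral_comp_mul_left (fun x => cos x) hn', integral_cos]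
  have : sin (n * (2 * π)) = 0 := by
    have := Real.sin_int_mul_pi (2 * n); push_cast at this; rw [← this]; ring_nf
  simp [this]

theorem cosCoeff_cos (j i : ℕ) : cosCoeff j (fun τ => cos (i * τ)) = if i = j then 1 else 0 := by
  have h1 : ∀ τ : ℝ, cos (i * τ) * cos (j * τ) =
      2⁻¹ * cos (((i - j : ℤ) : ℝ) * τ) + 2⁻¹ * cos (((i + j : ℤ) : ℝ) * τ) := by
    intro τ
    push_cast
    rw [sub_mul, add_mul, cos_sub, cos_add]; ring
  have hi : ∀ n : ℤ, IntervalIntegrable (fun τ : ℝ => 2⁻¹ * cos ((n : ℝ) * τ)) volume 0 (2 * π) :=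
    fun n => Continuous.intervalIntegrable (by fun_prop) _ _
  simp only [cosCoeff, h1]
  rw [intervalIntegral.integral_add (hi _) (hi _), intervalIntegral.integral_const_mul,
    intervalIntegral.integral_const_mul]
  have hpi := pi_ne_zero
  split_ifs with hj hij hij
  · subst hj; subst hij; simp; field_simp; norm_num
  · have a1 : ((i : ℤ) - j) ≠ 0 := by omega
    have a2 : ((i : ℤ) + j) ≠ 0 := by omega
    rw [integral_cos_int_mul a1, integral_cos_int_mul a2]; simp
  · subst hij
    have a2 : ((i : ℤ) + i) ≠ 0 := by omega
    rw [integral_cos_int_mul a2]; simp; field_simp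
  · have a1 : ((i : ℤ) - j) ≠ 0 := by omega
    have a2 : ((i : ℤ) + j) ≠ 0 := by omega
    rw [integral_cos_int_mul a1, integral_cos_int_mul a2]; simp

/-- The cosine series with coefficients `c`. -/
noncomputable def cosSeries (c : ℕ → ℝ) (τ : ℝ) : ℝ := ∑' j, c j * cos (j * τ)

theorem summable_mul_cos {c : ℕ → ℝ} (hc : Summable fun j => |c j|) (τ : ℝ) :
    Summable fun j : ℕ => c j * cos (j * τ) := by
  refine Summable.of_norm_bounded hc fun j => ?_
  rw [norm_mul, Real.norm_eq_abs, Real.norm_eq_abs]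
  exact mul_le_of_le_one_right (abs_nonneg _) (abs_cos_le_one _)

theorem continuous_cosSeries {c : ℕ → ℝ} (hc : Summable fun j => |c j|) :
    Continuous (cosSeries c) := by
  refine continuous_tsum (fun j => by fun_prop) hc fun j τ => ?_
  rw [norm_mul, Real.norm_eq_abs, Real.norm_eq_abs]
  exact mul_le_of_le_one_right (abs_nonneg _) (abs_cos_le_one _)

theorem cosSeries_neg (c : ℕ → ℝ) (τ : ℝ) : cosSeries c (-τ) = cosSeries c τ := by
  simp [cosSeries]

theorem cosSeries_add_two_pi (c : ℕ → ℝ) (τ : ℝ) :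
    cosSeries c (τ + 2 * π) = cosSeries c τ := by
  simp only [cosSeries, mul_add, Real.cos_add_nat_mul_two_pi]

theorem cosSeries_add_pi (c : ℕ → ℝ) (τ : ℝ) :
    cosSeries c (τ + π) = cosSeries (fun j => (-1) ^ j * c j) τ := by
  simp only [cosSeries, mul_add, Real.cos_add_nat_mul_pi]
  congr 1; ext j; ring

theorem cosSeries_sub {c d : ℕ → ℝ} (hc : Summable fun j => |c j|) (hd : Summable fun j => |d j|)
    (τ : ℝ) : cosSeries c τ - cosSeries d τ = cosSeries (fun j => c j - d j) τ := by
  simp only [cosSeries, sub_mul]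
  exact ((summable_mul_cos hc τ).tsum_sub (summable_mul_cos hd τ)).symm

theorem cosSeries_add {c d : ℕ → ℝ} (hc : Summable fun j => |c j|) (hd : Summable fun j => |d j|)
    (τ : ℝ) : cosSeries c τ + cosSeries d τ = cosSeries (fun j => c j + d j) τ := by
  simp only [cosSeries, add_mul]
  exact ((summable_mul_cos hc τ).tsum_add (summable_mul_cos hd τ)).symm

theorem abs_cosSeries_le {c : ℕ → ℝ} (hc : Summable fun j => |c j|) (τ : ℝ) :
    |cosSeries c τ| ≤ ∑' j, |c j| := by
  rw [← Real.norm_eq_abs, cosSeries]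
  refine tsum_of_norm_bounded hc.hasSum fun j => ?_
  rw [norm_mul, Real.norm_eq_abs, Real.norm_eq_abs]
  exact mul_le_of_le_one_right (abs_nonneg _) (abs_cos_le_one _)

theorem cosCoeff_cosSeries {c : ℕ → ℝ} (hc : Summable fun j => |c j|) (j : ℕ) :
    cosCoeff j (cosSeries c) = c j := by
  have key : HasSum (fun i : ℕ => ∫ τ in (0)..(2 * π), c i * cos (i * τ) * cos (j * τ))
      (∫ τ in (0)..(2 * π), cosSeries c τ * cos (j * τ)) := by
    refine intervalIntegral.hasSum_integral_of_dominated_convergence (fun i _ => |c i|)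
      (fun i => Continuous.aestronglyMeasurable (by fun_prop)) (fun i => ?_) ?_ ?_ ?_
    · refine Eventually.of_forall fun τ _ => ?_
      rw [norm_mul, norm_mul, Real.norm_eq_abs, Real.norm_eq_abs, Real.norm_eq_abs]
      exact (mul_le_of_le_one_right (by positivity) (abs_cos_le_one _)).trans
        (mul_le_of_le_one_right (abs_nonneg _) (abs_cos_le_one _))
    · exact Eventually.of_forall fun τ _ => hc
    · exact _root_.intervalIntegrable_const
    · exact Eventually.of_forall fun τ _ => (summable_mul_cos hc τ).hasSum.mul_right _
  have h2 := key.mul_left ((if j = 0 then 1 else 2) * (2 * π)⁻¹)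
  have h3 : (fun i : ℕ => (if j = 0 then 1 else 2) * (2 * π)⁻¹ *
      ∫ τ in (0)..(2 * π), c i * cos (i * τ) * cos (j * τ)) = fun i => if i = j then c j else 0 := by
    ext i
    have h := cosCoeff_const_mul (c i) (fun τ => cos (i * τ)) j
    rw [cosCoeff_cos] at h
    rw [cosCoeff] at h
    rw [h]
    split_ifs with hij <;> simp [hij]
  rw [h3] at h2
  exact h2.unique (hasSum_ite_eq j (c j))

theorem intervalIntegral_eq_zero_of_odd_of_periodic {f : ℝ → ℝ}
    (hodd : ∀ τ, f (-τ) = -f τ) (hper : Function.Periodic f (2 * π)) :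
    ∫ τ in (0)..(2 * π), f τ = 0 := by
  have h1 := hper.intervalIntegral_add_eq 0 (-π)
  rw [zero_add, show -π + 2 * π = π by ring] at h1
  have h2 : ∫ τ in (-π)..π, f τ = -∫ τ in (-π)..π, f τ := by
    conv_lhs => rw [← neg_neg π, ← intervalIntegral.integral_comp_neg]
    simp only [hodd, neg_neg, intervalIntegral.integral_neg]
  rw [h1]; linarith

/-- A continuous even periodic function is determined by its cosine coefficients. -/
theorem eq_zero_of_cosCoeff_eq_zero {f : ℝ → ℝ} (hf : Continuous f) (heven : ∀ τ, f (-τ) = f τ)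
    (hper : Function.Periodic f (2 * π)) (h0 : ∀ j, cosCoeff j f = 0) : ∀ τ, f τ = 0 := by
  have : Fact (0 < 2 * π) := ⟨two_pi_pos⟩
  have hcos₀ : ∀ j : ℕ, ∫ τ in (0)..(2 * π), f τ * cos (j * τ) = 0 := by
    intro j
    have := h0 j
    rw [cosCoeff, mul_eq_zero] at this
    refine this.resolve_left ?_
    have := pi_ne_zero
    split_ifs <;> positivity
  have hcos : ∀ n : ℤ, ∫ τ in (0)..(2 * π), f τ * cos (n * τ) = 0 := by
    intro n
    have he : ∀ τ : ℝ, cos (n * τ) = cos (n.natAbs * τ) := by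
      intro τ
      rcases Int.natAbs_eq n with h | h <;>
      · conv_lhs => rw [h]
        simp
    simp only [he]
    exact hcos₀ _
  have hsin : ∀ n : ℤ, ∫ τ in (0)..(2 * π), f τ * sin (n * τ) = 0 := by
    intro n
    refine intervalIntegral_eq_zero_of_odd_of_periodic (fun τ => by simp [heven]) fun τ => ?_
    rw [hper, mul_add, Real.sin_add_int_mul_two_pi]
  have hperC : Function.Periodic (fun τ => (f τ : ℂ)) (2 * π) := fun τ => by
    change (f (τ + 2 * π) : ℂ) = f τ
    rw [hper]
  have hcont : Continuous (hperC.lift : AddCircle (2 * π) → ℂ) := by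
    refine continuous_quot_lift _ (Complex.continuous_ofReal.comp hf)
  let F : C(AddCircle (2 * π), ℂ) := ⟨hperC.lift, hcont⟩
  have hF : ∀ τ : ℝ, F (τ : AddCircle (2 * π)) = f τ := fun τ => rfl
  have hcoef : ∀ n : ℤ, fourierCoeff F n = 0 := by
    intro n
    rw [fourierCoeff_eq_intervalIntegral F n 0, zero_add]
    have hpt : ∀ τ : ℝ, (fourier (-n) (τ : AddCircle (2 * π)) • F (τ : AddCircle (2 * π)) : ℂ) =
        ((f τ * cos (n * τ) : ℝ) : ℂ) - Complex.I * ((f τ * sin (n * τ) : ℝ) : ℂ) := by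
      intro τ
      rw [hF, fourier_coe_apply, smul_eq_mul]
      have : 2 * (π : ℂ) * Complex.I * ((-n : ℤ) : ℂ) * (τ : ℂ) / ((2 * π : ℝ) : ℂ) =
          ((-(n * τ) : ℝ) : ℂ) * Complex.I := by
        have : (π : ℂ) ≠ 0 := by exact_mod_cast pi_ne_zero
        push_cast
        field_simp
      rw [this, Complex.exp_mul_I, ← Complex.ofReal_cos, ← Complex.ofReal_sin, Real.cos_neg,
        Real.sin_neg]
      push_cast
      ring
    simp only [hpt]
    have i1 : Continuous fun τ : ℝ => ((f τ * cos (n * τ) : ℝ) : ℂ) := by fun_prop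
    have i2 : Continuous fun τ : ℝ => Complex.I * ((f τ * sin (n * τ) : ℝ) : ℂ) := by fun_prop
    rw [intervalIntegral.integral_sub (i1.intervalIntegrable _ _) (i2.intervalIntegrable _ _),
      intervalIntegral.integral_const_mul, intervalIntegral.integral_ofReal,
      intervalIntegral.integral_ofReal, hcos, hsin]
    simp
  intro τ
  have hs : Summable (fourierCoeff F) := by
    rw [show fourierCoeff F = fun _ => 0 from funext hcoef]; exact summable_zero
  have h1 := has_pointwise_sum_fourier_series_of_summable hs (τ : AddCircle (2 * π))
  simp only [hcoef, zero_smul] at h1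
  have h2 := h1.unique hasSum_zero
  rw [hF] at h2
  exact_mod_cast h2

theorem sq_mul_cosCoeff_of_hasDerivAt {g g' g'' : ℝ → ℝ} (h1 : ∀ τ, HasDerivAt g (g' τ) τ)
    (h2 : ∀ τ, HasDerivAt g' (g'' τ) τ) (hc : Continuous g'') (hper : g (2 * π) = g 0)
    (hper' : g' (2 * π) = g' 0) (j : ℕ) : (j : ℝ) ^ 2 * cosCoeff j g = -cosCoeff j g'' := by
  have hg : Continuous g := continuous_iff_continuousAt.2 fun τ => (h1 τ).continuousAt
  have hd : ∀ τ : ℝ, HasDerivAt (fun τ => g τ * (j * sin (j * τ)) + g' τ * cos (j * τ))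
      ((j : ℝ) ^ 2 * g τ * cos (j * τ) + g'' τ * cos (j * τ)) τ := by
    intro τ
    have hl : HasDerivAt (fun τ : ℝ => (j : ℝ) * τ) j τ := by
      simpa using (hasDerivAt_id τ).const_mul (j : ℝ)
    have e1 := (h1 τ).mul (hl.sin.const_mul (j : ℝ))
    have e2 := (h2 τ).mul hl.cos
    refine (e1.add e2).congr_deriv ?_
    ring
  have hi := intervalIntegral.integral_eq_sub_of_hasDerivAt (a := 0) (b := 2 * π)
    (fun τ _ => hd τ) (Continuous.intervalIntegrable (by fun_prop) _ _)
  have hs : sin (j * (2 * π)) = 0 := by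
    have := Real.sin_add_nat_mul_two_pi 0 j; simpa using this
  have hcs : cos (j * (2 * π)) = 1 := by
    simp
  rw [hper, hper', hs, hcs] at hi
  simp only [mul_zero, sin_zero, cos_zero, sub_self] at hi
  have h3 : cosCoeff j (fun τ => (j : ℝ) ^ 2 * g τ + g'' τ) = 0 := by
    simp only [cosCoeff, add_mul, hi, mul_zero]
  have h4 : Continuous fun τ => (j : ℝ) ^ 2 * g τ := continuous_const.mul hg
  rw [cosCoeff_add h4 hc, cosCoeff_const_mul] at h3
  linarith

/-- A cosine series solving the Fourier form of `u'' = h` is a classical solution. -/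
theorem contDiff_cosSeries_of_cosCoeff_eq {c : ℕ → ℝ} (hc : Summable fun j => |c j|) {h : ℝ → ℝ}
    (hh : Continuous h) (heven : ∀ τ, h (-τ) = h τ) (hper : Function.Periodic h (2 * π))
    (hcoef : ∀ j : ℕ, -((j : ℝ) ^ 2 * c j) = cosCoeff j h) :
    ContDiff ℝ 2 (cosSeries c) ∧ ∀ τ, deriv (deriv (cosSeries c)) τ = h τ := by
  have hmean : ∫ τ in (0)..(2 * π), h τ = 0 := by
    have h0 := hcoef 0
    rw [cosCoeff] at h0
    have := pi_ne_zero
    simpa [this] using h0.symm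
  let G : ℝ → ℝ := fun τ => ∫ s in (0)..τ, h s
  have hGd : ∀ τ, HasDerivAt G (h τ) τ := fun τ =>
    intervalIntegral.integral_hasDerivAt_right (hh.intervalIntegrable _ _)
      (hh.stronglyMeasurableAtFilter _ _) hh.continuousAt
  have hGc : Continuous G := continuous_iff_continuousAt.2 fun τ => (hGd τ).continuousAt
  have hGper : Function.Periodic G (2 * π) := by
    intro τ
    have e1 := intervalIntegral.integral_add_adjacent_intervals
      (hh.intervalIntegrable 0 τ) (hh.intervalIntegrable (μ := volume) τ (τ + 2 * π))
    have e2 := hper.intervalIntegral_add_eq τ 0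
    rw [zero_add, hmean] at e2
    change (∫ s in (0)..(τ + 2 * π), h s) = ∫ s in (0)..τ, h s
    rw [← e1, e2, add_zero]
  have hGodd : ∀ τ, G (-τ) = -G τ := by
    intro τ
    change (∫ s in (0)..(-τ), h s) = -∫ s in (0)..τ, h s
    have : ∫ s in (0)..τ, h (-s) = ∫ s in (0)..τ, h s := by simp only [heven]
    rw [← this, intervalIntegral.integral_comp_neg, neg_zero, intervalIntegral.integral_symm]
  let g : ℝ → ℝ := fun τ => ∫ s in (0)..τ, G s
  have hgd : ∀ τ, HasDerivAt g (G τ) τ := fun τ =>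
    intervalIntegral.integral_hasDerivAt_right (hGc.intervalIntegrable _ _)
      (hGc.stronglyMeasurableAtFilter _ _) hGc.continuousAt
  have hgc : Continuous g := continuous_iff_continuousAt.2 fun τ => (hgd τ).continuousAt
  have hGmean := intervalIntegral_eq_zero_of_odd_of_periodic hGodd hGper
  have hgper : Function.Periodic g (2 * π) := by
    intro τ
    have e1 := intervalIntegral.integral_add_adjacent_intervals
      (hGc.intervalIntegrable 0 τ) (hGc.intervalIntegrable (μ := volume) τ (τ + 2 * π))
    have e2 := hGper.intervalIntegral_add_eq τ 0
    rw [zero_add, hGmean] at e2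
    change (∫ s in (0)..(τ + 2 * π), G s) = ∫ s in (0)..τ, G s
    rw [← e1, e2, add_zero]
  have hgeven : ∀ τ, g (-τ) = g τ := by
    intro τ
    change (∫ s in (0)..(-τ), G s) = ∫ s in (0)..τ, G s
    have : ∫ s in (0)..τ, G (-s) = -∫ s in (0)..τ, G s := by
      simp only [hGodd, intervalIntegral.integral_neg]
    rw [intervalIntegral.integral_comp_neg, neg_zero, intervalIntegral.integral_symm] at this
    linarith
  have hgcoef : ∀ j : ℕ, j ≠ 0 → cosCoeff j g = c j := by
    intro j hj
    have e := sq_mul_cosCoeff_of_hasDerivAt hgd hGd hh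
      (by simpa using hgper 0) (by simpa using hGper 0) j
    rw [← hcoef j, neg_neg] at e
    exact mul_left_cancel₀ (by positivity) e
  have hu := continuous_cosSeries hc
  obtain ⟨κ, hκ⟩ : ∃ κ, κ = c 0 - cosCoeff 0 g := ⟨_, rfl⟩
  have hconst : ∀ j, cosCoeff j (fun _ => κ) = if j = 0 then κ else 0 := by
    intro j
    have e := cosCoeff_const_mul κ (fun τ => cos ((0 : ℕ) * τ)) j
    rw [cosCoeff_cos] at e
    simp only [Nat.cast_zero, zero_mul, cos_zero, mul_one] at e
    rw [e]
    rcases Nat.eq_zero_or_pos j with hj | hj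
    · simp [hj]
    · simp [hj.ne, hj.ne']
  have hgκ : Continuous fun τ => g τ + κ := hgc.add continuous_const
  have heq : ∀ τ, cosSeries c τ - (g τ + κ) = 0 := by
    refine eq_zero_of_cosCoeff_eq_zero (hu.sub hgκ) (fun τ => ?_) (fun τ => ?_) fun j => ?_
    · rw [cosSeries_neg, hgeven]
    · simp only [cosSeries_add_two_pi, hgper τ]
    · rw [cosCoeff_sub hu hgκ, cosCoeff_add hgc continuous_const, hconst, cosCoeff_cosSeries hc]
      rcases Nat.eq_zero_or_pos j with hj | hj
      · subst hj; rw [if_pos rfl, hκ]; ring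
      · rw [if_neg hj.ne', hgcoef j hj.ne']; ring
  have hfun : cosSeries c = fun τ => g τ + κ := funext fun τ => sub_eq_zero.1 (heq τ)
  have hd1 : deriv (cosSeries c) = G := by
    ext τ; rw [hfun]; exact ((hgd τ).add_const κ).deriv
  have hd2 : deriv G = h := funext fun τ => (hGd τ).deriv
  refine ⟨?_, fun τ => by rw [hd1, hd2]⟩
  rw [show (2 : WithTop ℕ∞) = 1 + 1 by norm_num, contDiff_succ_iff_deriv]
  refine ⟨?_, by simp, ?_⟩
  · rw [hfun]; exact fun τ => ((hgd τ).add_const κ).differentiableAt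
  · rw [hd1, contDiff_one_iff_deriv]
    exact ⟨fun τ => (hGd τ).differentiableAt, by rw [hd2]; exact hh⟩

end

section

open Real

/-- The Ablowitz–Ladik soliton profile. -/
noncomputable def solitonProfile (κ ν : ℝ) : ℝ := sinh κ / cosh (κ * ν)

/-- The odd solution of the linearisation at the soliton. -/
noncomputable def solitonOdd (κ ν : ℝ) : ℝ := sinh (κ * ν) / cosh (κ * ν) ^ 2

/-- The even solution of the linearisation at the soliton. -/
noncomputable def solitonEven (κ ν : ℝ) : ℝ :=
  cosh (κ * ν) / 2 - (1 / 2 + cosh κ ^ 2) / cosh (κ * ν) +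
    3 / 2 * sinh κ * cosh κ * ν * solitonOdd κ ν

/-- The potential of the linearisation at the soliton. -/
noncomputable def solitonPotential (κ ν : ℝ) : ℝ :=
  2 * cosh κ * (1 - solitonProfile κ ν ^ 2) / (1 + solitonProfile κ ν ^ 2) ^ 2

theorem solitonProfile_neg (κ ν : ℝ) : solitonProfile κ (-ν) = solitonProfile κ ν := by
  simp [solitonProfile]

theorem solitonOdd_neg (κ ν : ℝ) : solitonOdd κ (-ν) = -solitonOdd κ ν := by
  simp [solitonOdd, neg_div]

theorem solitonEven_neg (κ ν : ℝ) : solitonEven κ (-ν) = solitonEven κ ν := by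
  simp [solitonEven, solitonOdd_neg]

theorem cosh_eq_of_exp {X x : ℝ} (hX : exp x = X) : cosh x = (X ^ 2 + 1) / (2 * X) := by
  subst hX
  rw [cosh_eq, exp_neg]
  field_simp

theorem sinh_eq_of_exp {X x : ℝ} (hX : exp x = X) : sinh x = (X ^ 2 - 1) / (2 * X) := by
  subst hX
  rw [sinh_eq, exp_neg]
  field_simp

theorem solitonProfile_recurrence (κ ν : ℝ) :
    solitonProfile κ (ν + 1) + solitonProfile κ (ν - 1) =
      2 * cosh κ * solitonProfile κ ν / (1 + solitonProfile κ ν ^ 2) := by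
  obtain ⟨X, hX⟩ : ∃ X, exp (κ * ν) = X := ⟨_, rfl⟩
  obtain ⟨E, hE⟩ : ∃ E, exp κ = E := ⟨_, rfl⟩
  have hX0 : 0 < X := hX ▸ exp_pos _
  have hE0 : 0 < E := hE ▸ exp_pos _
  have h1 : exp (κ * (ν + 1)) = X * E := by rw [mul_add, mul_one, exp_add, hX, hE]
  have h2 : exp (κ * (ν - 1)) = X / E := by rw [mul_sub, mul_one, exp_sub, hX, hE]
  have hS : 1 + ((E ^ 2 - 1) / (2 * E) / ((X ^ 2 + 1) / (2 * X))) ^ 2 =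
      (X ^ 2 * E ^ 2 + 1) * (X ^ 2 + E ^ 2) / (E ^ 2 * (X ^ 2 + 1) ^ 2) := by
    field_simp; ring
  simp only [solitonProfile, cosh_eq_of_exp h1, cosh_eq_of_exp h2, cosh_eq_of_exp hX,
    cosh_eq_of_exp hE, sinh_eq_of_exp hE]
  rw [hS]
  field_simp
  ring

theorem solitonOdd_recurrence (κ ν : ℝ) :
    solitonOdd κ (ν + 1) + solitonOdd κ (ν - 1) = solitonPotential κ ν * solitonOdd κ ν := by
  obtain ⟨X, hX⟩ : ∃ X, exp (κ * ν) = X := ⟨_, rfl⟩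
  obtain ⟨E, hE⟩ : ∃ E, exp κ = E := ⟨_, rfl⟩
  have hX0 : 0 < X := hX ▸ exp_pos _
  have hE0 : 0 < E := hE ▸ exp_pos _
  have h1 : exp (κ * (ν + 1)) = X * E := by rw [mul_add, mul_one, exp_add, hX, hE]
  have h2 : exp (κ * (ν - 1)) = X / E := by rw [mul_sub, mul_one, exp_sub, hX, hE]
  have hS : 1 + ((E ^ 2 - 1) / (2 * E) / ((X ^ 2 + 1) / (2 * X))) ^ 2 =
      (X ^ 2 * E ^ 2 + 1) * (X ^ 2 + E ^ 2) / (E ^ 2 * (X ^ 2 + 1) ^ 2) := by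
    field_simp; ring
  simp only [solitonPotential, solitonOdd, solitonProfile, cosh_eq_of_exp h1, cosh_eq_of_exp h2,
    cosh_eq_of_exp hX, cosh_eq_of_exp hE, sinh_eq_of_exp hE, sinh_eq_of_exp h1,
    sinh_eq_of_exp h2, sinh_eq_of_exp hX]
  rw [hS]
  field_simp
  ring

theorem solitonEven_recurrence (κ ν : ℝ) :
    solitonEven κ (ν + 1) + solitonEven κ (ν - 1) = solitonPotential κ ν * solitonEven κ ν := by
  obtain ⟨X, hX⟩ : ∃ X, exp (κ * ν) = X := ⟨_, rfl⟩
  obtain ⟨E, hE⟩ : ∃ E, exp κ = E := ⟨_, rfl⟩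
  have hX0 : 0 < X := hX ▸ exp_pos _
  have hE0 : 0 < E := hE ▸ exp_pos _
  have h1 : exp (κ * (ν + 1)) = X * E := by rw [mul_add, mul_one, exp_add, hX, hE]
  have h2 : exp (κ * (ν - 1)) = X / E := by rw [mul_sub, mul_one, exp_sub, hX, hE]
  have hS : 1 + ((E ^ 2 - 1) / (2 * E) / ((X ^ 2 + 1) / (2 * X))) ^ 2 =
      (X ^ 2 * E ^ 2 + 1) * (X ^ 2 + E ^ 2) / (E ^ 2 * (X ^ 2 + 1) ^ 2) := by
    field_simp; ring
  simp only [solitonPotential, solitonEven, solitonOdd, solitonProfile, cosh_eq_of_exp h1,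
    cosh_eq_of_exp h2, cosh_eq_of_exp hX, cosh_eq_of_exp hE, sinh_eq_of_exp hE,
    sinh_eq_of_exp h1, sinh_eq_of_exp h2, sinh_eq_of_exp hX]
  rw [hS]
  field_simp
  ring

theorem soliton_casoratian (κ ν : ℝ) :
    solitonOdd κ ν * solitonEven κ (ν + 1) - solitonOdd κ (ν + 1) * solitonEven κ ν = sinh κ := by
  obtain ⟨X, hX⟩ : ∃ X, exp (κ * ν) = X := ⟨_, rfl⟩
  obtain ⟨E, hE⟩ : ∃ E, exp κ = E := ⟨_, rfl⟩
  have hX0 : 0 < X := hX ▸ exp_pos _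
  have hE0 : 0 < E := hE ▸ exp_pos _
  have h1 : exp (κ * (ν + 1)) = X * E := by rw [mul_add, mul_one, exp_add, hX, hE]
  simp only [solitonEven, solitonOdd, cosh_eq_of_exp h1,
    cosh_eq_of_exp hX, cosh_eq_of_exp hE, sinh_eq_of_exp hE,
    sinh_eq_of_exp h1, sinh_eq_of_exp hX]
  field_simp
  ring

section Bounds

variable {κ ν : ℝ}

theorem sinh_le_two_mul (h0 : 0 ≤ κ) (h1 : κ ≤ 1) : sinh κ ≤ 2 * κ := by
  have h2 : |κ| ≤ 1 := by rwa [abs_of_nonneg h0]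
  have h3 := abs_le.1 (Real.abs_exp_sub_one_sub_id_le h2)
  have h4 := abs_le.1 (Real.abs_exp_sub_one_sub_id_le (x := -κ) (by rwa [abs_neg]))
  rw [sinh_eq]
  nlinarith

theorem exp_sub_one_le_two_mul (h0 : 0 ≤ κ) (h1 : κ ≤ 1) : exp κ - 1 ≤ 2 * κ := by
  have h2 : |κ| ≤ 1 := by rwa [abs_of_nonneg h0]
  have h3 := abs_le.1 (Real.abs_exp_sub_one_sub_id_le h2)
  nlinarith

theorem cosh_le_two (h0 : 0 ≤ κ) (h1 : κ ≤ 1) : cosh κ ≤ 2 := by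
  have h3 := exp_sub_one_le_two_mul h0 h1
  have h4 : exp (-κ) ≤ 1 := exp_le_one_iff.2 (by linarith)
  rw [cosh_eq]
  linarith

theorem abs_sinh_le_cosh (x : ℝ) : |sinh x| ≤ cosh x := by
  rw [abs_sinh, ← cosh_abs x]
  exact (sinh_lt_cosh _).le

theorem cosh_le_exp {x : ℝ} (hx : 0 ≤ x) : cosh x ≤ exp x := by
  have : exp (-x) ≤ exp x := exp_le_exp.2 (by linarith)
  rw [cosh_eq]; linarith

theorem inv_cosh_le (x : ℝ) : (cosh x)⁻¹ ≤ 2 * exp (-x) := by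
  rw [exp_neg, ← div_eq_mul_inv, inv_le_comm₀ (cosh_pos _) (by positivity), inv_div, cosh_eq]
  have := exp_pos (-x)
  linarith

theorem abs_cosh_step (h0 : 0 ≤ κ) (x : ℝ) : |cosh (x + κ) - cosh x| ≤ (exp κ - 1) * cosh x := by
  have h1 : cosh (x + κ) - cosh x = (cosh κ - 1) * cosh x + sinh κ * sinh x := by
    rw [cosh_add]; ring
  have hs : 0 ≤ sinh κ := sinh_nonneg_iff.2 h0
  have hc : 0 ≤ cosh κ - 1 := by linarith [one_le_cosh κ]
  rw [h1, show exp κ - 1 = (cosh κ - 1) + sinh κ by rw [← cosh_add_sinh]; ring, add_mul]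
  refine (abs_add_le _ _).trans ?_
  rw [abs_mul, abs_mul, abs_of_nonneg hs, abs_of_nonneg hc, abs_of_pos (cosh_pos x)]
  have := abs_sinh_le_cosh x
  gcongr

theorem abs_sinh_step (h0 : 0 ≤ κ) (x : ℝ) : |sinh (x + κ) - sinh x| ≤ (exp κ - 1) * cosh x := by
  have h1 : sinh (x + κ) - sinh x = (cosh κ - 1) * sinh x + sinh κ * cosh x := by
    rw [sinh_add]; ring
  have hs : 0 ≤ sinh κ := sinh_nonneg_iff.2 h0
  have hc : 0 ≤ cosh κ - 1 := by linarith [one_le_cosh κ]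
  rw [h1, show exp κ - 1 = (cosh κ - 1) + sinh κ by rw [← cosh_add_sinh]; ring, add_mul]
  refine (abs_add_le _ _).trans ?_
  rw [abs_mul, abs_mul, abs_of_nonneg hs, abs_of_nonneg hc, abs_of_pos (cosh_pos x)]
  have := abs_sinh_le_cosh x
  gcongr

theorem cosh_le_cosh_add (h0 : 0 ≤ κ) {x : ℝ} (hx : 0 ≤ x) : cosh x ≤ cosh (x + κ) := by
  rw [cosh_le_cosh, abs_of_nonneg hx, abs_of_nonneg (by linarith)]
  linarith

theorem abs_inv_cosh_step (h0 : 0 ≤ κ) {x : ℝ} (hx : 0 ≤ x) :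
    |(cosh (x + κ))⁻¹ - (cosh x)⁻¹| ≤ (exp κ - 1) * (cosh x)⁻¹ := by
  have h1 := cosh_pos x
  have h2 := cosh_pos (x + κ)
  have h3 : (cosh (x + κ))⁻¹ - (cosh x)⁻¹ =
      -(cosh (x + κ) - cosh x) * ((cosh x)⁻¹ * (cosh (x + κ))⁻¹) := by
    field_simp; ring
  have h4 := cosh_le_cosh_add h0 hx
  rw [h3, abs_mul, abs_neg, abs_of_pos (by positivity : 0 < (cosh x)⁻¹ * (cosh (x + κ))⁻¹)]
  calc _ ≤ (exp κ - 1) * cosh x * ((cosh x)⁻¹ * (cosh x)⁻¹) := by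
        have := abs_cosh_step h0 x
        have : 0 ≤ exp κ - 1 := by linarith [one_le_exp h0]
        gcongr
    _ = _ := by field_simp

theorem abs_solitonOdd_le (κ ν : ℝ) : |solitonOdd κ ν| ≤ (cosh (κ * ν))⁻¹ := by
  have h := cosh_pos (κ * ν)
  rw [solitonOdd, abs_div, abs_of_pos (by positivity : 0 < cosh (κ * ν) ^ 2), inv_eq_one_div,
    div_le_div_iff₀ (by positivity) h]
  have := abs_sinh_le_cosh (κ * ν)
  nlinarith

theorem abs_solitonOdd_step (h0 : 0 ≤ κ) (hν : 0 ≤ ν) :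
    |solitonOdd κ (ν + 1) - solitonOdd κ ν| ≤ 3 * (exp κ - 1) * (cosh (κ * ν))⁻¹ := by
  obtain ⟨x, hx⟩ : ∃ x, x = κ * ν := ⟨_, rfl⟩
  have hx0 : 0 ≤ x := hx ▸ mul_nonneg h0 hν
  have hx1 : κ * (ν + 1) = x + κ := by rw [hx]; ring
  simp only [solitonOdd, hx1, ← hx]
  have hc := cosh_pos x
  have hc' := cosh_pos (x + κ)
  have h4 := cosh_le_cosh_add h0 hx0
  have h4' : (cosh (x + κ))⁻¹ ≤ (cosh x)⁻¹ := by gcongr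
  have e1 : sinh (x + κ) / cosh (x + κ) ^ 2 - sinh x / cosh x ^ 2 =
      (sinh (x + κ) - sinh x) * ((cosh (x + κ))⁻¹ * (cosh (x + κ))⁻¹) +
      sinh x * ((cosh (x + κ))⁻¹ + (cosh x)⁻¹) * ((cosh (x + κ))⁻¹ - (cosh x)⁻¹) := by
    field_simp; ring
  rw [e1]
  refine (abs_add_le _ _).trans ?_
  rw [abs_mul, abs_mul (_ * _) (_ - _), abs_mul (sinh x),
    abs_of_pos (by positivity : 0 < (cosh (x + κ))⁻¹ + (cosh x)⁻¹),
    abs_of_pos (by positivity : 0 < (cosh (x + κ))⁻¹ * (cosh (x + κ))⁻¹)]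
  have h5 := abs_sinh_step h0 x
  have h6 := abs_inv_cosh_step h0 hx0
  have h7 := abs_sinh_le_cosh x
  have hE : 0 ≤ exp κ - 1 := by linarith [one_le_exp h0]
  calc _ ≤ (exp κ - 1) * cosh x * ((cosh x)⁻¹ * (cosh x)⁻¹) +
        cosh x * ((cosh x)⁻¹ + (cosh x)⁻¹) * ((exp κ - 1) * (cosh x)⁻¹) := by gcongr
    _ = _ := by field_simp; ring

theorem abs_solitonEven_le (h0 : 0 ≤ κ) (h1 : κ ≤ 1) (hν : 0 ≤ ν) :
    |solitonEven κ ν| ≤ 11 * exp (κ * ν) := by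
  obtain ⟨x, hx⟩ : ∃ x, x = κ * ν := ⟨_, rfl⟩
  have hx0 : 0 ≤ x := hx ▸ mul_nonneg h0 hν
  have hφ := abs_solitonOdd_le κ ν
  rw [← hx] at hφ
  simp only [solitonEven, ← hx]
  have hc := one_le_cosh x
  have hc0 : (0 : ℝ) < cosh x := by linarith
  have hci : (cosh x)⁻¹ ≤ 1 := inv_le_one_of_one_le₀ hc
  have he := cosh_le_exp hx0
  have hx2 : x ≤ exp x := by linarith [add_one_le_exp x]
  have hs := sinh_le_two_mul h0 h1
  have hs0 : 0 ≤ sinh κ := sinh_nonneg_iff.2 h0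
  have hC := cosh_le_two h0 h1
  have hC1 := one_le_cosh κ
  have t1 : |cosh x / 2| ≤ exp x / 2 := by rw [abs_of_pos (by positivity)]; linarith
  have t2 : |(1 / 2 + cosh κ ^ 2) / cosh x| ≤ 9 / 2 := by
    rw [abs_of_pos (by positivity), div_eq_mul_inv]
    calc _ ≤ (1 / 2 + 2 ^ 2) * (1 : ℝ) := by gcongr
      _ = _ := by norm_num
  have t3 : |3 / 2 * sinh κ * cosh κ * ν * solitonOdd κ ν| ≤ 6 * exp x := by
    rw [abs_mul, abs_of_nonneg (by positivity)]
    calc _ ≤ 3 / 2 * (2 * κ) * 2 * ν * 1 := by gcongr; exact hφ.trans hci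
      _ = 6 * x := by rw [hx]; ring
      _ ≤ _ := by linarith
  have hex : 1 ≤ exp x := one_le_exp hx0
  refine (abs_add_le _ _).trans ((add_le_add (abs_sub _ _) t3).trans ?_)
  linarith

theorem abs_solitonEven_step (h0 : 0 ≤ κ) (h1 : κ ≤ 1) (hν : 0 ≤ ν) :
    |solitonEven κ (ν + 1) - solitonEven κ ν| ≤ 60 * κ * exp (κ * ν) := by
  obtain ⟨x, hx⟩ : ∃ x, x = κ * ν := ⟨_, rfl⟩
  have hx0 : 0 ≤ x := hx ▸ mul_nonneg h0 hν
  have hx1 : κ * (ν + 1) = x + κ := by rw [hx]; ring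
  have hφ := abs_solitonOdd_le κ (ν + 1)
  have hφ' := abs_solitonOdd_step h0 hν
  rw [← hx] at hφ'
  have hc := one_le_cosh x
  have hc0 : (0 : ℝ) < cosh x := by linarith
  have hci : (cosh x)⁻¹ ≤ 1 := inv_le_one_of_one_le₀ hc
  have he := cosh_le_exp hx0
  have hx2 : x ≤ exp x := by linarith [add_one_le_exp x]
  have hs := sinh_le_two_mul h0 h1
  have hs0 : 0 ≤ sinh κ := sinh_nonneg_iff.2 h0
  have hC := cosh_le_two h0 h1
  have hC1 := one_le_cosh κ
  have hE := exp_sub_one_le_two_mul h0 h1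
  have hE0 : 0 ≤ exp κ - 1 := by linarith [one_le_exp h0]
  have hex : 1 ≤ exp x := one_le_exp hx0
  have hφ1 : |solitonOdd κ (ν + 1)| ≤ 1 := hφ.trans (inv_le_one_of_one_le₀ (one_le_cosh _))
  have key : solitonEven κ (ν + 1) - solitonEven κ ν = (cosh (x + κ) - cosh x) / 2 +
      -((1 / 2 + cosh κ ^ 2) * ((cosh (x + κ))⁻¹ - (cosh x)⁻¹)) +
      3 / 2 * sinh κ * cosh κ * (ν * (solitonOdd κ (ν + 1) - solitonOdd κ ν) +
        solitonOdd κ (ν + 1)) := by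
    simp only [solitonEven, hx1, ← hx]; ring
  rw [key, ← hx]
  have t1 : |(cosh (x + κ) - cosh x) / 2| ≤ κ * exp x := by
    rw [abs_div, abs_two]
    calc _ ≤ (exp κ - 1) * cosh x / 2 := by have := abs_cosh_step h0 x; gcongr
      _ ≤ 2 * κ * exp x / 2 := by gcongr
      _ = _ := by ring
  have t2 : |-((1 / 2 + cosh κ ^ 2) * ((cosh (x + κ))⁻¹ - (cosh x)⁻¹))| ≤ 9 * κ * exp x := by
    rw [abs_neg, abs_mul, abs_of_pos (by positivity)]
    calc _ ≤ (1 / 2 + 2 ^ 2) * ((exp κ - 1) * (cosh x)⁻¹) := by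
          have := abs_inv_cosh_step h0 hx0; gcongr
      _ ≤ (1 / 2 + 2 ^ 2) * (2 * κ * exp x) := by gcongr; linarith
      _ = _ := by ring
  have t3 : |3 / 2 * sinh κ * cosh κ * (ν * (solitonOdd κ (ν + 1) - solitonOdd κ ν) +
        solitonOdd κ (ν + 1))| ≤ 42 * κ * exp x := by
    have u1 : |ν * (solitonOdd κ (ν + 1) - solitonOdd κ ν) + solitonOdd κ (ν + 1)| ≤
        6 * x + 1 := by
      refine (abs_add_le _ _).trans (add_le_add ?_ hφ1)
      rw [abs_mul, abs_of_nonneg hν]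
      calc _ ≤ ν * (3 * (2 * κ) * 1) := by gcongr; exact hφ'.trans (by gcongr)
        _ = _ := by rw [hx]; ring
    rw [abs_mul, abs_of_nonneg (by positivity)]
    calc _ ≤ 3 / 2 * (2 * κ) * 2 * (7 * exp x) := by gcongr; linarith
      _ = _ := by ring
  refine (abs_add_le _ _).trans ((add_le_add ((abs_add_le _ _).trans (add_le_add t1 t2)) t3).trans ?_)
  have : 0 ≤ κ * exp x := by positivity
  linarith

end Bounds

end

section

open Real

/-- Position of the `n`-th site of a half-lattice, centred at a site (`c = 0`) or at a bond
(`c = 1`). -/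
noncomputable def halfPos (c n : ℕ) : ℝ := n + c / 2

/-- The left neighbour on the half-lattice, folded back at the centre. -/
def prevIdx (c n : ℕ) : ℕ := if n = 0 then 1 - c else n - 1

theorem halfPos_nonneg (c n : ℕ) : 0 ≤ halfPos c n := by unfold halfPos; positivity

theorem halfPos_succ (c n : ℕ) : halfPos c (n + 1) = halfPos c n + 1 := by
  simp only [halfPos]; push_cast; ring

theorem halfPos_prevIdx {c : ℕ} (hc : c ≤ 1) (n : ℕ) :
    halfPos c (prevIdx c n) = halfPos c n - 1 ∨ halfPos c (prevIdx c n) = -(halfPos c n - 1) := by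
  rcases n with _ | n
  · right
    interval_cases c <;> simp [halfPos, prevIdx]; norm_num
  · left
    simp only [halfPos, prevIdx]; simp; ring

section GreenOperator

variable {κ : ℝ} {φ ψ χ : ℕ → ℝ}

theorem abs_partialSum_le (h0 : 0 < κ) (h1 : κ ≤ 1)
    (hχ : ∀ n, |χ n| ≤ 22 * exp (κ * n)) {f : ℕ → ℝ} {M : ℝ}
    (hf : ∀ n, |f n| ≤ M * exp (-(κ * n / 2))) (n : ℕ) :
    |∑ m ∈ Finset.range (n + 1), χ m * f m| ≤ 88 * M * κ⁻¹ * exp (κ * n / 2) := by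
  have hM : 0 ≤ M := by have := (abs_nonneg _).trans (hf 0); simpa using this
  have hterm : ∀ m : ℕ, |χ m * f m| ≤ 22 * M * exp (κ * m / 2) := by
    intro m
    rw [abs_mul]
    calc _ ≤ 22 * exp (κ * m) * (M * exp (-(κ * m / 2))) := by
          gcongr
          · exact hχ m
          · exact hf m
      _ = 22 * M * (exp (κ * m) * exp (-(κ * m / 2))) := by ring
      _ = _ := by rw [← exp_add]; ring_nf
  have hki : 1 ≤ κ⁻¹ := (one_le_inv₀ h0).2 h1
  have hE : 1 + κ / 2 ≤ exp (κ / 2) := by linarith [add_one_le_exp (κ / 2)]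
  have hE2 : exp (κ / 2) ≤ 2 := by
    have := exp_sub_one_le_two_mul (κ := κ / 2) (by linarith) (by linarith)
    linarith
  induction n with
  | zero =>
    have := hterm 0
    simp only [zero_add, Finset.range_one, Finset.sum_singleton]
    refine this.trans ?_
    simp only [Nat.cast_zero, mul_zero, zero_div, exp_zero, mul_one]
    have := mul_le_mul_of_nonneg_left hki hM
    linarith
  | succ n ih =>
    rw [Finset.sum_range_succ]
    refine (abs_add_le _ _).trans ((add_le_add ih (hterm _)).trans ?_)
    have e1 : exp (κ * ((n + 1 : ℕ) : ℝ) / 2) = exp (κ * n / 2) * exp (κ / 2) := by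
      rw [← exp_add]; congr 1; push_cast; ring
    rw [e1]
    have h2 : 88 * κ⁻¹ * (κ / 2) = 44 := by field_simp; norm_num
    have h3 : 88 * κ⁻¹ + 22 * exp (κ / 2) ≤ 88 * κ⁻¹ * exp (κ / 2) := by
      have : 88 * κ⁻¹ * (1 + κ / 2) ≤ 88 * κ⁻¹ * exp (κ / 2) := by gcongr
      linarith
    calc _ = M * exp (κ * n / 2) * (88 * κ⁻¹ + 22 * exp (κ / 2)) := by ring
      _ ≤ M * exp (κ * n / 2) * (88 * κ⁻¹ * exp (κ / 2)) := by gcongr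
      _ = _ := by ring

theorem hasSum_tail_bound (h0 : 0 < κ) (n : ℕ) (M : ℝ) :
    HasSum (fun m : ℕ => 2 * M * exp (-(3 * κ / 2 * n)) * exp (-(3 * κ / 2)) ^ m)
      (2 * M * exp (-(3 * κ / 2 * n)) * (1 - exp (-(3 * κ / 2)))⁻¹) := by
  refine (hasSum_geometric_of_lt_one (exp_pos _).le ?_).mul_left _
  rw [← exp_zero]
  exact exp_lt_exp.2 (by linarith)

theorem abs_tail_term_le (h0 : 0 < κ) (hφ : ∀ n, |φ n| ≤ 2 * exp (-(κ * n))) {f : ℕ → ℝ} {M : ℝ}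
    (hf : ∀ n, |f n| ≤ M * exp (-(κ * n / 2))) (n m : ℕ) :
    ‖φ (m + (n + 1)) * f (m + (n + 1))‖ ≤
      2 * M * exp (-(3 * κ / 2 * n)) * exp (-(3 * κ / 2)) ^ m := by
  have hM : 0 ≤ M := by have := (abs_nonneg _).trans (hf 0); simpa using this
  rw [norm_mul, Real.norm_eq_abs, Real.norm_eq_abs]
  calc _ ≤ 2 * exp (-(κ * (m + (n + 1) : ℕ))) * (M * exp (-(κ * (m + (n + 1) : ℕ) / 2))) := by
        gcongr
        · exact hφ _
        · exact hf _
    _ = 2 * M * exp (-(3 * κ / 2 * n) + m * -(3 * κ / 2) + -(3 * κ / 2)) := by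
        rw [show ∀ a b : ℝ, 2 * a * (M * b) = 2 * M * (a * b) by intros; ring, ← exp_add]
        congr 2; push_cast; ring
    _ ≤ 2 * M * exp (-(3 * κ / 2 * n) + m * -(3 * κ / 2)) :=
        mul_le_mul_of_nonneg_left (exp_le_exp.2 (by linarith)) (by positivity)
    _ = _ := by rw [exp_add, exp_nat_mul]; ring

theorem summable_tail (h0 : 0 < κ) (hφ : ∀ n, |φ n| ≤ 2 * exp (-(κ * n))) {f : ℕ → ℝ} {M : ℝ}
    (hf : ∀ n, |f n| ≤ M * exp (-(κ * n / 2))) (n : ℕ) :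
    Summable fun m : ℕ => φ (m + (n + 1)) * f (m + (n + 1)) :=
  Summable.of_norm_bounded (hasSum_tail_bound h0 n M).summable
    (abs_tail_term_le h0 hφ hf n)

theorem abs_tail_le (h0 : 0 < κ) (h1 : κ ≤ 1) (hφ : ∀ n, |φ n| ≤ 2 * exp (-(κ * n)))
    {f : ℕ → ℝ} {M : ℝ} (hf : ∀ n, |f n| ≤ M * exp (-(κ * n / 2))) (n : ℕ) :
    |∑' m : ℕ, φ (m + (n + 1)) * f (m + (n + 1))| ≤ 4 * M * κ⁻¹ * exp (-(3 * κ / 2 * n)) := by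
  have hM : 0 ≤ M := by have := (abs_nonneg _).trans (hf 0); simpa using this
  rw [← Real.norm_eq_abs]
  refine (tsum_of_norm_bounded (hasSum_tail_bound h0 n M) (abs_tail_term_le h0 hφ hf n)).trans ?_
  have h2 : exp (-(3 * κ / 2)) ≤ 1 - κ / 2 := by
    have h3 := add_one_le_exp (3 * κ / 2)
    rw [exp_neg, inv_le_comm₀ (exp_pos _) (by linarith)]
    refine le_trans ?_ h3
    rw [inv_le_iff_one_le_mul₀ (by linarith)]
    nlinarith
  have h4 : (1 - exp (-(3 * κ / 2)))⁻¹ ≤ 2 * κ⁻¹ := by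
    rw [show 2 * κ⁻¹ = (κ / 2)⁻¹ by field_simp]
    exact inv_anti₀ (by linarith) (by linarith)
  calc _ ≤ 2 * M * exp (-(3 * κ / 2 * n)) * (2 * κ⁻¹) := by gcongr
    _ = _ := by ring

theorem tail_succ (h0 : 0 < κ) (hφ : ∀ n, |φ n| ≤ 2 * exp (-(κ * n))) {f : ℕ → ℝ} {M : ℝ}
    (hf : ∀ n, |f n| ≤ M * exp (-(κ * n / 2))) (n : ℕ) :
    ∑' m : ℕ, φ (m + (n + 1)) * f (m + (n + 1)) = φ (n + 1) * f (n + 1) +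
      ∑' m : ℕ, φ (m + (n + 1 + 1)) * f (m + (n + 1 + 1)) := by
  rw [(summable_tail h0 hφ hf n).tsum_eq_zero_add, zero_add]
  congr 2; ext m
  rw [add_assoc, add_comm 1 (n + 1)]

/-- The Green operator built from a decaying solution `φ` and a growing solution `ψ` with
Casoratian `s`; `χ` is `ψ` with its first value adapted to the boundary condition. -/
noncomputable def greenOp (s : ℝ) (φ ψ χ f : ℕ → ℝ) (n : ℕ) : ℝ :=
  -s⁻¹ * (φ n * ∑ m ∈ Finset.range (n + 1), χ m * f m +
    ψ n * ∑' m : ℕ, φ (m + (n + 1)) * f (m + (n + 1)))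

theorem greenOp_sub (s : ℝ) (h0 : 0 < κ) (hφ : ∀ n, |φ n| ≤ 2 * exp (-(κ * n)))
    {f g : ℕ → ℝ} {M N : ℝ} (hf : ∀ n, |f n| ≤ M * exp (-(κ * n / 2)))
    (hg : ∀ n, |g n| ≤ N * exp (-(κ * n / 2))) (n : ℕ) :
    greenOp s φ ψ χ (fun n => f n - g n) n = greenOp s φ ψ χ f n - greenOp s φ ψ χ g n := by
  simp only [greenOp, mul_sub, Finset.sum_sub_distrib]
  rw [(summable_tail h0 hφ hf n).tsum_sub (summable_tail h0 hφ hg n)]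
  ring

theorem greenOp_succ (s : ℝ) (h0 : 0 < κ) (hφ : ∀ n, |φ n| ≤ 2 * exp (-(κ * n)))
    (hχ : ∀ n, χ (n + 1) = ψ (n + 1)) {f : ℕ → ℝ} {M : ℝ}
    (hf : ∀ n, |f n| ≤ M * exp (-(κ * n / 2))) (n : ℕ) :
    greenOp s φ ψ χ f (n + 1) =
      -s⁻¹ * (φ (n + 1) * ∑ m ∈ Finset.range (n + 1), χ m * f m +
        ψ (n + 1) * ∑' m : ℕ, φ (m + (n + 1)) * f (m + (n + 1))) := by
  rw [greenOp, Finset.sum_range_succ _ (n + 1), tail_succ h0 hφ hf n, hχ]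
  ring

theorem abs_greenOp_aux (h0 : 0 < κ) (h1 : κ ≤ 1) (hφ : ∀ n, |φ n| ≤ 2 * exp (-(κ * n)))
    (hχ : ∀ n, |χ n| ≤ 22 * exp (κ * n)) {s : ℝ} (hs : κ ≤ s) {f : ℕ → ℝ} {M : ℝ}
    (hf : ∀ n, |f n| ≤ M * exp (-(κ * n / 2))) (n : ℕ) {p q ε : ℝ} (hε : 0 ≤ ε)
    (hp : |p| ≤ ε * exp (-(κ * n))) (hq : |q| ≤ ε * exp (κ * n)) :
    |-s⁻¹ * (p * ∑ m ∈ Finset.range (n + 1), χ m * f m +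
        q * ∑' m : ℕ, φ (m + (n + 1)) * f (m + (n + 1)))| ≤
      92 * ε * κ⁻¹ * κ⁻¹ * M * exp (-(κ * n / 2)) := by
  have hM : 0 ≤ M := by have := (abs_nonneg _).trans (hf 0); simpa using this
  have hP := abs_partialSum_le h0 h1 hχ hf n
  have hT := abs_tail_le h0 h1 hφ hf n
  have hs0 : 0 < s := h0.trans_le hs
  rw [abs_mul, abs_neg, abs_of_pos (inv_pos.2 hs0)]
  have e1 : exp (-(κ * n)) * exp (κ * n / 2) = exp (-(κ * n / 2)) := by
    rw [← exp_add]; congr 1; ring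
  have e2 : exp (κ * n) * exp (-(3 * κ / 2 * n)) = exp (-(κ * n / 2)) := by
    rw [← exp_add]; congr 1; ring
  have b : |p * ∑ m ∈ Finset.range (n + 1), χ m * f m +
        q * ∑' m : ℕ, φ (m + (n + 1)) * f (m + (n + 1))| ≤
      92 * ε * κ⁻¹ * M * exp (-(κ * n / 2)) := by
    refine (abs_add_le _ _).trans ?_
    rw [abs_mul, abs_mul]
    calc _ ≤ ε * exp (-(κ * n)) * (88 * M * κ⁻¹ * exp (κ * n / 2)) +
          ε * exp (κ * n) * (4 * M * κ⁻¹ * exp (-(3 * κ / 2 * n))) := by gcongr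
      _ = 88 * ε * κ⁻¹ * M * (exp (-(κ * n)) * exp (κ * n / 2)) +
          4 * ε * κ⁻¹ * M * (exp (κ * n) * exp (-(3 * κ / 2 * n))) := by ring
      _ = _ := by rw [e1, e2]; ring
  calc _ ≤ κ⁻¹ * (92 * ε * κ⁻¹ * M * exp (-(κ * n / 2))) := by gcongr
    _ = _ := by ring

end GreenOperator

/-- The linearisation at the soliton on a half-lattice has an inverse with uniform weighted
bounds. -/
theorem exists_soliton_inverse : ∃ K > (0 : ℝ), ∀ κ : ℝ, 0 < κ → κ ≤ 1 → ∀ c : ℕ, c ≤ 1 →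
    ∃ G : (ℕ → ℝ) → ℕ → ℝ,
      (∀ (f : ℕ → ℝ) (M : ℝ), (∀ n : ℕ, |f n| ≤ M * exp (-(κ * n / 2))) → ∀ n : ℕ,
        |G f n| ≤ K * κ⁻¹ * κ⁻¹ * M * exp (-(κ * n / 2)) ∧
        |G f (n + 1) - G f n| ≤ K * κ⁻¹ * M * exp (-(κ * n / 2)) ∧
        G f (n + 1) + G f (prevIdx c n) - solitonPotential κ (halfPos c n) * G f n = f n) ∧
      ∀ (f g : ℕ → ℝ) (M N : ℝ), (∀ n : ℕ, |f n| ≤ M * exp (-(κ * n / 2))) →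
        (∀ n : ℕ, |g n| ≤ N * exp (-(κ * n / 2))) → ∀ n : ℕ,
        G (fun n => f n - g n) n = G f n - G g n := by
  refine ⟨92 * 120, by norm_num, fun κ h0 h1 c hc => ?_⟩
  let φ : ℕ → ℝ := fun n => solitonOdd κ (halfPos c n)
  let ψ : ℕ → ℝ := fun n => solitonEven κ (halfPos c n)
  let χ : ℕ → ℝ := fun n => if n = 0 ∧ c = 0 then ψ n / 2 else ψ n
  have hcr : (c : ℝ) ≤ 1 := by exact_mod_cast hc
  have hc0 : (0 : ℝ) ≤ c := Nat.cast_nonneg c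
  have hpos : ∀ n : ℕ, κ * halfPos c n = κ * n + κ * c / 2 := fun n => by
    simp only [halfPos]; ring
  have hem : ∀ n : ℕ, exp (-(κ * halfPos c n)) ≤ exp (-(κ * n)) := fun n => by
    rw [hpos]; apply exp_le_exp.2
    have : 0 ≤ κ * c := by positivity
    linarith
  have hep : ∀ n : ℕ, exp (κ * halfPos c n) ≤ 2 * exp (κ * n) := fun n => by
    rw [hpos, exp_add, mul_comm]
    gcongr
    have : κ * c ≤ 1 := mul_le_one₀ h1 hc0 hcr
    have := exp_sub_one_le_two_mul (κ := κ * c / 2) (by positivity) (by linarith)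
    linarith
  have hν := halfPos_nonneg c
  have hφ : ∀ n, |φ n| ≤ 2 * exp (-(κ * n)) := fun n =>
    (abs_solitonOdd_le _ _).trans ((inv_cosh_le _).trans (by have := hem n; gcongr))
  have hψ : ∀ n, |ψ n| ≤ 22 * exp (κ * n) := fun n =>
    (abs_solitonEven_le h0.le h1 (hν n)).trans (by linarith [hep n])
  have hdφ : ∀ n, |φ (n + 1) - φ n| ≤ 120 * κ * exp (-(κ * n)) := fun n => by
    have t := abs_solitonOdd_step h0.le (hν n)
    rw [← halfPos_succ] at t
    refine t.trans ?_
    have t1 := exp_sub_one_le_two_mul h0.le h1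
    calc _ ≤ 3 * (2 * κ) * (2 * exp (-(κ * n))) := by
          gcongr; exact (inv_cosh_le _).trans (by have := hem n; gcongr)
      _ ≤ _ := by
          have : 0 ≤ κ * exp (-(κ * n)) := by positivity
          linarith
  have hdψ : ∀ n, |ψ (n + 1) - ψ n| ≤ 120 * κ * exp (κ * n) := fun n => by
    have t := abs_solitonEven_step h0.le h1 (hν n)
    rw [← halfPos_succ] at t
    refine t.trans ?_
    calc _ ≤ 60 * κ * (2 * exp (κ * n)) := by have := hep n; gcongr
      _ = _ := by ring
  have hχ : ∀ n, |χ n| ≤ 22 * exp (κ * n) := fun n => by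
    simp only [χ]
    split_ifs
    · rw [abs_div, abs_two]; linarith [hψ n, abs_nonneg (ψ n)]
    · exact hψ n
  have hχs : ∀ n, χ (n + 1) = ψ (n + 1) := fun n => by simp [χ]
  have hs : κ ≤ sinh κ := self_le_sinh_iff.2 h0.le
  have hs0 : 0 < sinh κ := h0.trans_le hs
  have hcas : ∀ n, φ n * ψ (n + 1) - φ (n + 1) * ψ n = sinh κ := fun n => by
    have := soliton_casoratian κ (halfPos c n)
    rwa [← halfPos_succ] at this
  have hφr : ∀ n, φ (n + 2) + φ n = solitonPotential κ (halfPos c (n + 1)) * φ (n + 1) := fun n => by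
    have := solitonOdd_recurrence κ (halfPos c (n + 1))
    rw [← halfPos_succ, show halfPos c (n + 1) - 1 = halfPos c n by rw [halfPos_succ]; ring] at this
    exact this
  have hψr : ∀ n, ψ (n + 2) + ψ n = solitonPotential κ (halfPos c (n + 1)) * ψ (n + 1) := fun n => by
    have := solitonEven_recurrence κ (halfPos c (n + 1))
    rw [← halfPos_succ, show halfPos c (n + 1) - 1 = halfPos c n by rw [halfPos_succ]; ring] at this
    exact this
  refine ⟨greenOp (sinh κ) φ ψ χ, fun f M hf n => ⟨?_, ?_, ?_⟩,
    fun f g M N hf hg n => greenOp_sub _ h0 hφ hf hg n⟩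
  · refine (abs_greenOp_aux h0 h1 hφ hχ hs hf n (by norm_num : (0 : ℝ) ≤ 120)
      ((hφ n).trans ?_) ((hψ n).trans ?_)).trans le_rfl
    · gcongr; norm_num
    · gcongr; norm_num
  · rw [greenOp_succ _ h0 hφ hχs hf, greenOp]
    have := abs_greenOp_aux h0 h1 hφ hχ hs hf n (by positivity : (0 : ℝ) ≤ 120 * κ) (hdφ n) (hdψ n)
    have e : 92 * (120 * κ) * κ⁻¹ * κ⁻¹ * M * exp (-(κ * n / 2)) =
      92 * 120 * κ⁻¹ * M * exp (-(κ * n / 2)) := by field_simp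
    rw [e] at this
    refine le_trans (le_of_eq ?_) this
    congr 1; ring
  · rcases n with _ | n
    · have hφ0 := solitonOdd_recurrence κ (halfPos c 0)
      have hψ0 := solitonEven_recurrence κ (halfPos c 0)
      have hcas0 := soliton_casoratian κ (halfPos c 0 - 1)
      rw [sub_add_cancel] at hcas0
      rw [← halfPos_succ] at hφ0 hψ0
      rw [greenOp_succ _ h0 hφ hχs hf]
      simp only [greenOp, zero_add, Finset.range_one, Finset.sum_singleton] at *
      obtain ⟨T, hT⟩ : ∃ T, T = ∑' m : ℕ, φ (m + 1) * f (m + 1) := ⟨_, rfl⟩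
      have hcase : c = 0 ∨ c = 1 := by omega
      rcases hcase with rfl | rfl
      · have e0 : halfPos 0 0 = 0 := by simp [halfPos]
        have hφz : φ 0 = 0 := by simp [φ, e0, solitonOdd]
        have e1 : solitonEven κ (halfPos 0 0 - 1) = ψ 1 := by
          rw [← solitonEven_neg]; simp [ψ, halfPos]
        rw [e1] at hψ0
        have hψ0' : ψ 1 + ψ 1 = solitonPotential κ (halfPos 0 0) * ψ 0 := hψ0
        have hc0 := hcas 0
        have hg1 := greenOp_succ (sinh κ) h0 hφ hχs hf 0
        simp only [prevIdx, if_true]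
        simp only [greenOp, zero_add, Finset.range_one, Finset.sum_singleton, Nat.sub_zero] at hg1 ⊢
        rw [hg1, ← hT]
        simp only [χ, hφz, zero_mul, zero_sub, zero_add, and_self, if_true] at hc0 ⊢
        field_simp
        linear_combination (2 * f 0) * hc0 - 2 * T * hψ0'
      · have e1 : solitonEven κ (halfPos 1 0 - 1) = ψ 0 := by
          rw [← solitonEven_neg]; simp only [ψ]; congr 1; simp [halfPos]; norm_num
        have e2 : solitonOdd κ (halfPos 1 0 - 1) = -φ 0 := by
          rw [← neg_neg (solitonOdd κ (halfPos 1 0 - 1)), ← solitonOdd_neg]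
          simp only [φ]; congr 2; simp [halfPos]; norm_num
        rw [e1, e2] at hcas0
        rw [e1] at hψ0
        rw [e2] at hφ0
        have hψ0' : ψ 1 + ψ 0 = solitonPotential κ (halfPos 1 0) * ψ 0 := hψ0
        have hφ0' : φ 1 + -φ 0 = solitonPotential κ (halfPos 1 0) * φ 0 := hφ0
        have hcas0' : -φ 0 * ψ 0 - φ 0 * ψ 0 = sinh κ := hcas0
        simp only [prevIdx, if_true]
        simp only [zero_add, Finset.range_one, Finset.sum_singleton, Nat.sub_self]
        rw [← hT]
        simp only [χ, one_ne_zero, and_false, if_false]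
        field_simp
        linear_combination (f 0) * hcas0' - T * hψ0' - ψ 0 * f 0 * hφ0'
    · have e : prevIdx c (n + 1) = n := by simp [prevIdx]
      rw [e, greenOp_succ _ h0 hφ hχs hf (n + 1), greenOp_succ _ h0 hφ hχs hf n, greenOp,
        Finset.sum_range_succ _ (n + 1), tail_succ h0 hφ hf n, hχs]
      have h2 := hφr n
      have h3 := hψr n
      have h4 := hcas n
      have h5 : (sinh κ)⁻¹ * sinh κ = 1 := inv_mul_cancel₀ hs0.ne'
      rw [show n + 1 + 1 = n + 2 from rfl]
      generalize (∑' m : ℕ, φ (m + (n + 2)) * f (m + (n + 2))) = T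
      generalize (∑ m ∈ Finset.range (n + 1), χ m * f m) = P
      linear_combination -(sinh κ)⁻¹ * (P + ψ (n + 1) * f (n + 1)) * h2 - (sinh κ)⁻¹ * T * h3 +
        (sinh κ)⁻¹ * f (n + 1) * h4 + f (n + 1) * h5

/-- The soliton profile sampled on a half-lattice. -/
theorem exists_soliton_bounds : ∃ K > (0 : ℝ), ∀ κ : ℝ, 0 < κ → κ ≤ 1 → ∀ c : ℕ, c ≤ 1 → ∀ n : ℕ,
    solitonProfile κ (halfPos c (n + 1)) + solitonProfile κ (halfPos c (prevIdx c n)) =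
        2 * cosh κ * solitonProfile κ (halfPos c n) / (1 + solitonProfile κ (halfPos c n) ^ 2) ∧
      |solitonProfile κ (halfPos c n)| ≤ K * κ * exp (-(κ * n / 2)) ∧
      |solitonProfile κ (halfPos c (n + 1)) - solitonProfile κ (halfPos c n)| ≤
        K * κ ^ 2 * exp (-(κ * n / 2)) ∧
      κ / 2 ≤ solitonProfile κ (halfPos c 0) := by
  refine ⟨8, by norm_num, fun κ h0 h1 c hc n => ?_⟩
  have hcr : (c : ℝ) ≤ 1 := by exact_mod_cast hc
  have hc0 : (0 : ℝ) ≤ c := Nat.cast_nonneg c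
  have hs : κ ≤ sinh κ := self_le_sinh_iff.2 h0.le
  have hs2 := sinh_le_two_mul h0.le h1
  have hs0 : 0 < sinh κ := h0.trans_le hs
  have hν := halfPos_nonneg c n
  have hE := exp_sub_one_le_two_mul h0.le h1
  have hw : (cosh (κ * halfPos c n))⁻¹ ≤ 2 * exp (-(κ * n / 2)) := by
    refine (inv_cosh_le _).trans ?_
    gcongr
    have : 0 ≤ κ * c := by positivity
    have : 0 ≤ κ * n := by positivity
    have : κ * halfPos c n = κ * n + κ * c / 2 := by simp only [halfPos]; ring
    linarith
  have hci := inv_pos.2 (cosh_pos (κ * halfPos c n))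
  refine ⟨?_, ?_, ?_, ?_⟩
  · rw [← solitonProfile_recurrence, halfPos_succ]
    congr 1
    rcases halfPos_prevIdx hc n with h | h
    · rw [h]
    · rw [h, solitonProfile_neg]
  · rw [solitonProfile, div_eq_mul_inv, abs_mul, abs_of_pos hs0, abs_of_pos hci]
    calc _ ≤ 2 * κ * (2 * exp (-(κ * n / 2))) := by gcongr
      _ ≤ _ := by
        have : 0 ≤ κ * exp (-(κ * n / 2)) := by positivity
        linarith
  · rw [halfPos_succ, solitonProfile, solitonProfile, div_eq_mul_inv, div_eq_mul_inv, ← mul_sub,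
      mul_add κ, mul_one, abs_mul, abs_of_pos hs0]
    have t := abs_inv_cosh_step h0.le (mul_nonneg h0.le hν)
    calc _ ≤ 2 * κ * (2 * κ * (2 * exp (-(κ * n / 2)))) := by
          gcongr
          exact t.trans (by gcongr)
      _ = _ := by ring
  · have hle : κ * halfPos c 0 ≤ 1 := by
      have : κ * c ≤ 1 := mul_le_one₀ h1 hc0 hcr
      have : κ * halfPos c 0 = κ * c / 2 := by simp [halfPos]; ring
      linarith
    have := cosh_le_two (mul_nonneg h0.le (halfPos_nonneg c 0)) hle
    rw [solitonProfile]
    exact div_le_div₀ hs0.le hs (cosh_pos _) this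

end

section

open Real

/-- The defect of the cubic map with respect to its linearisation at the soliton value `a`. -/
noncomputable def cubicDefect (κ a B : ℝ) : ℝ :=
  (2 * cosh κ - 2 * cosh κ * (1 - a ^ 2) / (1 + a ^ 2) ^ 2) * B - 2 * (a + B) ^ 3 +
    2 * cosh κ * a ^ 3 / (1 + a ^ 2)

theorem cosh_sub_one_le_sq {κ : ℝ} (h0 : 0 ≤ κ) (h1 : κ ≤ 1) : cosh κ - 1 ≤ κ ^ 2 := by
  have h2 : |κ| ≤ 1 := by rwa [abs_of_nonneg h0]
  have h3 := abs_le.1 (Real.abs_exp_sub_one_sub_id_le h2)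
  have h4 := abs_le.1 (Real.abs_exp_sub_one_sub_id_le (x := -κ) (by rwa [abs_neg]))
  rw [cosh_eq]
  linarith [h3.2, h4.2, neg_sq κ]

theorem exists_lipschitz_cubicDefect {Ka : ℝ} (hKa : 0 ≤ Ka) : ∃ K > (0 : ℝ), ∀ κ η a B B' : ℝ,
    0 ≤ κ → κ ≤ 1 → 0 ≤ η → η ≤ 1 → |a| ≤ Ka * κ → |B| ≤ η * κ → |B'| ≤ η * κ →
      |cubicDefect κ a B - cubicDefect κ a B'| ≤ K * (κ ^ 2 * (κ + η)) * |B - B'| ∧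
      |cubicDefect κ a 0| ≤ K * κ ^ 4 * |a| := by
  refine ⟨Ka ^ 2 * (6 + 12 * Ka ^ 2 + 6 * Ka ^ 4) + 12 * Ka + 6, by positivity, ?_⟩
  intro κ η a B B' hκ0 hκ1 hη0 hη1 ha hB hB'
  have hq := cosh_sub_one_le_sq hκ0 hκ1
  have hq0 : 0 ≤ cosh κ - 1 := by linarith [one_le_cosh κ]
  have ha2 : a ^ 2 ≤ Ka ^ 2 * κ ^ 2 := by
    rw [← sq_abs, ← mul_pow]; gcongr
  have ha4 : a ^ 4 ≤ Ka ^ 4 * κ ^ 4 := by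
    calc a ^ 4 = (a ^ 2) ^ 2 := by ring
      _ ≤ (Ka ^ 2 * κ ^ 2) ^ 2 := by gcongr
      _ = _ := by ring
  have hden : 1 ≤ 1 + a ^ 2 := by linarith [sq_nonneg a]
  have hden2 : 1 ≤ (1 + a ^ 2) ^ 2 := one_le_pow₀ hden
  have k43 : κ ^ 4 ≤ κ ^ 3 := pow_le_pow_of_le_one hκ0 hκ1 (by norm_num)
  have k42 : κ ^ 4 ≤ κ ^ 2 := pow_le_pow_of_le_one hκ0 hκ1 (by norm_num)
  have k32 : κ ^ 3 ≤ κ ^ 2 := pow_le_pow_of_le_one hκ0 hκ1 (by norm_num)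
  constructor
  · have key : cubicDefect κ a B - cubicDefect κ a B' =
        (a ^ 2 * (6 * (cosh κ - 1) + a ^ 2 * (2 * (cosh κ - 1) - 10) - 6 * a ^ 4) / (1 + a ^ 2) ^ 2 -
          (6 * a * (B + B') + 2 * (B ^ 2 + B * B' + B' ^ 2))) * (B - B') := by
      simp only [cubicDefect]; field_simp; ring
    rw [key, abs_mul]
    refine mul_le_mul_of_nonneg_right ?_ (abs_nonneg _)
    have hBB : |B + B'| ≤ 2 * (η * κ) := (abs_add_le _ _).trans (by linarith)
    have hB2 : |B ^ 2 + B * B' + B' ^ 2| ≤ 3 * (η * κ) ^ 2 := by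
      refine (abs_add_le _ _).trans ((add_le_add_left (abs_add_le _ _) _).trans ?_)
      rw [abs_mul, abs_pow, abs_pow]
      have e1 : |B| ^ 2 ≤ (η * κ) ^ 2 := by gcongr
      have e2 : |B'| ^ 2 ≤ (η * κ) ^ 2 := by gcongr
      have e3 : |B| * |B'| ≤ (η * κ) * (η * κ) := by gcongr
      linarith
    have t2 : |6 * a * (B + B') + 2 * (B ^ 2 + B * B' + B' ^ 2)| ≤ (12 * Ka + 6) * (κ ^ 2 * η) := by
      refine (abs_add_le _ _).trans ?_
      rw [abs_mul, abs_mul, abs_mul, abs_two, abs_of_nonneg (by norm_num : (0 : ℝ) ≤ 6)]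
      have e1 : 6 * |a| * |B + B'| ≤ 6 * (Ka * κ) * (2 * (η * κ)) := by gcongr
      have e2 : η ^ 2 * κ ^ 2 ≤ η * κ ^ 2 := by gcongr; exact pow_le_of_le_one hη0 hη1 two_ne_zero
      linarith
    have t1 : |a ^ 2 * (6 * (cosh κ - 1) + a ^ 2 * (2 * (cosh κ - 1) - 10) - 6 * a ^ 4) /
        (1 + a ^ 2) ^ 2| ≤ Ka ^ 2 * (6 + 12 * Ka ^ 2 + 6 * Ka ^ 4) * κ ^ 3 := by
      rw [abs_div, abs_of_pos (by positivity : 0 < (1 + a ^ 2) ^ 2)]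
      refine (div_le_self (abs_nonneg _) hden2).trans ?_
      rw [abs_mul, abs_of_nonneg (sq_nonneg a)]
      have hk1 : κ ^ 2 ≤ 1 := pow_le_one₀ hκ0 hκ1
      have e1 : |6 * (cosh κ - 1) + a ^ 2 * (2 * (cosh κ - 1) - 10) - 6 * a ^ 4| ≤
          6 * κ ^ 2 + a ^ 2 * 12 + 6 * a ^ 4 := by
        refine (abs_sub _ _).trans (add_le_add ((abs_add_le _ _).trans (add_le_add ?_ ?_)) ?_)
        · rw [abs_of_nonneg (by linarith)]; linarith
        · rw [abs_mul, abs_of_nonneg (sq_nonneg a)]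
          gcongr
          rw [abs_le]; constructor <;> linarith
        · rw [abs_of_nonneg (by positivity)]
      calc _ ≤ (Ka ^ 2 * κ ^ 2) * (6 * κ ^ 2 + (Ka ^ 2 * κ ^ 2) * 12 + 6 * (Ka ^ 4 * κ ^ 4)) := by
            refine mul_le_mul ha2 (e1.trans ?_) (abs_nonneg _) (by positivity)
            linarith
        _ ≤ (Ka ^ 2 * κ ^ 2) * (6 * κ ^ 2 + (Ka ^ 2 * κ ^ 2) * 12 + 6 * (Ka ^ 4 * κ ^ 2)) := by
            gcongr
        _ = Ka ^ 2 * (6 + 12 * Ka ^ 2 + 6 * Ka ^ 4) * κ ^ 4 := by ring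
        _ ≤ _ := by gcongr
    refine (abs_sub _ _).trans ((add_le_add t1 t2).trans ?_)
    have e1 : 0 ≤ Ka ^ 2 * (6 + 12 * Ka ^ 2 + 6 * Ka ^ 4) * (κ ^ 2 * η) := by positivity
    have e2 : 0 ≤ (12 * Ka + 6) * κ ^ 3 := by positivity
    linarith only [e1, e2]
  · have key : cubicDefect κ a 0 = (a ^ 2 * (2 * (cosh κ - 1) - 2 * a ^ 2) / (1 + a ^ 2)) * a := by
      simp only [cubicDefect]; field_simp; ring
    rw [key, abs_mul]
    refine mul_le_mul_of_nonneg_right ?_ (abs_nonneg _)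
    rw [abs_div, abs_of_pos (by positivity : 0 < 1 + a ^ 2)]
    refine (div_le_self (abs_nonneg _) hden).trans ?_
    rw [abs_mul, abs_of_nonneg (sq_nonneg a)]
    have e1 : |2 * (cosh κ - 1) - 2 * a ^ 2| ≤ 2 * κ ^ 2 + 2 * (Ka ^ 2 * κ ^ 2) := by
      refine (abs_sub _ _).trans ?_
      rw [abs_of_nonneg (by linarith), abs_of_nonneg (by positivity)]
      linarith
    calc _ ≤ (Ka ^ 2 * κ ^ 2) * (2 * κ ^ 2 + 2 * (Ka ^ 2 * κ ^ 2)) := by gcongr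
      _ = Ka ^ 2 * (2 + 2 * Ka ^ 2) * κ ^ 4 := by ring
      _ ≤ _ := by
        gcongr
        have : 0 ≤ Ka ^ 2 * (4 + 10 * Ka ^ 2 + 6 * Ka ^ 4) := by positivity
        linarith

/-- The discrete flux whose divergence is the lattice Laplacian of the squared amplitudes. -/
def flux (ρ δ d b b' : ℝ) : ℝ := ρ ^ 2 * ((δ + d) * (b + b'))

theorem exists_lipschitz_flux (ρ : ℝ) {Ka : ℝ} (hKa : 0 ≤ Ka) : ∃ K > (0 : ℝ),
    ∀ κ η w M δ d d' b₁ b₁' b₂ b₂' : ℝ, 0 ≤ κ → 0 ≤ η → η ≤ 1 → 0 ≤ w → 0 ≤ M →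
      |δ| ≤ Ka * κ ^ 2 * w → |d| ≤ η * κ ^ 2 * w → |d'| ≤ η * κ ^ 2 * w →
      |d - d'| ≤ M * (η * κ ^ 2 * w) → |b₁| ≤ (Ka + 1) * κ → |b₁'| ≤ (Ka + 1) * κ →
      |b₂| ≤ (Ka + 1) * κ → |b₂'| ≤ (Ka + 1) * κ → |b₁ - b₁'| ≤ M * (η * κ) →
      |b₂ - b₂'| ≤ M * (η * κ) →
      |flux ρ δ d b₁ b₂ - flux ρ δ d' b₁' b₂'| ≤ K * (M * η * κ ^ 3 * w) ∧
      |flux ρ δ d b₁ b₂| ≤ K * (κ ^ 3 * w) := by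
  refine ⟨ρ ^ 2 * (2 * (Ka + 1) * (Ka + 2)) + 1, by positivity, ?_⟩
  intro κ η w M δ d d' b₁ b₁' b₂ b₂' hκ hη hη1 hw hM hδ hd hd' hdd h1 h1' h2 h2' hb1 hb2
  have hE : |δ + d| ≤ (Ka + 1) * κ ^ 2 * w := by
    refine (abs_add_le _ _).trans ((add_le_add hδ hd).trans ?_)
    have : η * (κ ^ 2 * w) ≤ 1 * (κ ^ 2 * w) := by gcongr
    linarith
  have hs : |b₁ + b₂| ≤ 2 * ((Ka + 1) * κ) := (abs_add_le _ _).trans (by linarith)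
  have hs' : |b₁' + b₂'| ≤ 2 * ((Ka + 1) * κ) := (abs_add_le _ _).trans (by linarith)
  constructor
  · rw [flux, flux, ← mul_sub, abs_mul, abs_of_nonneg (sq_nonneg ρ)]
    have e1 : |(δ + d) - (δ + d')| ≤ M * (η * κ ^ 2 * w) := by
      rwa [add_sub_add_left_eq_sub]
    have e2 : |(b₁ + b₂) - (b₁' + b₂')| ≤ 2 * (M * (η * κ)) := by
      rw [add_sub_add_comm]
      exact (abs_add_le _ _).trans (by linarith)
    have := abs_mul_sub_mul_le_of_le hE hs' e1 e2
    have h4 : 0 ≤ M * η * κ ^ 3 * w := by positivity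
    calc _ ≤ ρ ^ 2 * _ := mul_le_mul_of_nonneg_left this (sq_nonneg ρ)
      _ = ρ ^ 2 * (4 * (Ka + 1)) * (M * η * κ ^ 3 * w) := by ring
      _ ≤ _ := by
        gcongr
        have : 0 ≤ ρ ^ 2 * (2 * (Ka + 1) * Ka) := by positivity
        linarith
  · rw [flux, abs_mul, abs_of_nonneg (sq_nonneg ρ), abs_mul]
    calc _ ≤ ρ ^ 2 * ((Ka + 1) * κ ^ 2 * w * (2 * ((Ka + 1) * κ))) := by gcongr
      _ = ρ ^ 2 * (2 * (Ka + 1) * (Ka + 1)) * (κ ^ 3 * w) := by ring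
      _ ≤ _ := by
        gcongr
        have : 0 ≤ ρ ^ 2 * (2 * (Ka + 1)) := by positivity
        linarith

/-- Divergence of a flux on the half-lattice. -/
def fluxDiv (c : ℕ) (Q : ℕ → ℝ) (n : ℕ) : ℝ := if n = 0 then (2 - c) * Q 0 else Q n - Q (n - 1)

theorem fluxDiv_sub (c : ℕ) (Q Q' : ℕ → ℝ) (n : ℕ) :
    fluxDiv c Q n - fluxDiv c Q' n = fluxDiv c (fun n => Q n - Q' n) n := by
  simp only [fluxDiv]; split_ifs <;> ring

theorem abs_fluxDiv_le {c : ℕ} (hc : c ≤ 1) {κ : ℝ} (hκ0 : 0 ≤ κ) (hκ1 : κ ≤ 1) {Q : ℕ → ℝ} {X : ℝ}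
    (hQ : ∀ n : ℕ, |Q n| ≤ X * exp (-(κ * n / 2))) (n : ℕ) :
    |fluxDiv c Q n| ≤ 3 * X * exp (-(κ * n / 2)) := by
  have hX : 0 ≤ X := by have := (abs_nonneg _).trans (hQ 0); simpa using this
  rcases n with _ | n
  · have h0 := hQ 0
    have hc1 : (c : ℝ) ≤ 1 := by exact_mod_cast hc
    have hc0 : (0 : ℝ) ≤ c := Nat.cast_nonneg c
    simp only [fluxDiv, if_true, abs_mul]
    rw [abs_of_nonneg (by linarith)]
    calc _ ≤ 3 * (X * exp (-(κ * (0 : ℕ) / 2))) := by gcongr; linarith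
      _ = _ := by ring
  · simp only [fluxDiv, Nat.add_eq_zero_iff, one_ne_zero, and_false, if_false, Nat.add_sub_cancel]
    have e : exp (-(κ * n / 2)) ≤ 2 * exp (-(κ * (n + 1 : ℕ) / 2)) := by
      have e1 : exp (-(κ * n / 2)) = exp (κ / 2) * exp (-(κ * (n + 1 : ℕ) / 2)) := by
        rw [← exp_add]; congr 1; push_cast; ring
      rw [e1]
      gcongr
      have := exp_sub_one_le_two_mul (κ := κ / 2) (by linarith) (by linarith)
      linarith
    refine (abs_sub _ _).trans ((add_le_add (hQ _) (hQ _)).trans ?_)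
    have := mul_le_mul_of_nonneg_left e hX
    linarith

theorem fluxDiv_eq {c : ℕ} (hc : c ≤ 1) (q : ℕ → ℝ) (n : ℕ) :
    fluxDiv c (fun n => q (n + 1) - q n) n = q (n + 1) + q (prevIdx c n) - 2 * q n := by
  rcases n with _ | n
  · interval_cases c <;> simp [fluxDiv, prevIdx] <;> ring
  · simp [fluxDiv, prevIdx]; ring

theorem exp_prevIdx_le {c : ℕ} {κ : ℝ} (hκ0 : 0 ≤ κ) (n : ℕ) :
    exp (-(κ * (prevIdx c n : ℕ) / 2)) ≤ exp (κ / 2) * exp (-(κ * n / 2)) := by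
  rw [← exp_add]
  apply exp_le_exp.2
  have : (n : ℝ) ≤ prevIdx c n + 1 := by
    have : n ≤ prevIdx c n + 1 := by unfold prevIdx; split_ifs <;> omega
    exact_mod_cast this
  have := mul_le_mul_of_nonneg_left this hκ0
  linarith

end

section

open Real

/-- Lipschitz bounds for the cosine coefficients of the nonlinear remainders, as functions of the
amplitude and of the coefficients of the correction. -/
structure RemainderBounds (Fc : ℝ → (ℕ → ℝ) → ℕ → ℝ) (Rc : ℝ → (ℕ → ℝ) → ℝ) (K e₀ S : ℝ) :
    Prop where
  lipschitz : ∀ (e ζ Z A A' : ℝ) (z z' : ℕ → ℝ), e ≤ e₀ → S * ζ ≤ e ^ 2 → |A| ≤ e → |A'| ≤ e →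
    (∀ j : ℕ, |z j| ≤ ζ / (1 + (j : ℝ) ^ 2)) → (∀ j : ℕ, |z' j| ≤ ζ / (1 + (j : ℝ) ^ 2)) →
    (∀ j : ℕ, |z j - z' j| ≤ Z / (1 + (j : ℝ) ^ 2)) →
    (∀ j : ℕ, |Fc A z j - Fc A' z' j| ≤ K * (e ^ 2 * |A - A'| + e * Z)) ∧
      |Rc A z - Rc A' z'| ≤ K * ((e ^ 3 + ζ) * |A - A'| + e * Z)
  zero_left : ∀ j, Fc 0 0 j = 0
  zero_right : Rc 0 0 = 0

theorem RemainderBounds.exists_local_bounds {Fc : ℝ → (ℕ → ℝ) → ℕ → ℝ} {Rc : ℝ → (ℕ → ℝ) → ℝ}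
    {K e₀ S : ℝ} (hb : RemainderBounds Fc Rc K e₀ S) (hK : 0 < K) {ρ O Ka : ℝ}
    (hρ : 0 < ρ) (hO : 0 < O) (hKa : 0 ≤ Ka) : ∃ K₁ > (0 : ℝ), ∀ (κ η w M a B B' : ℝ) (z z' : ℕ → ℝ),
      0 ≤ κ → κ ≤ 1 → 0 ≤ η → η ≤ 1 → 0 ≤ w → w ≤ 1 → 0 ≤ M → ρ * (Ka + 1) * κ ≤ e₀ →
      S * η ^ 2 ≤ (ρ * (Ka + 1)) ^ 2 → |a| ≤ Ka * κ * w → |B| ≤ η * κ * w → |B'| ≤ η * κ * w →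
      |B - B'| ≤ M * (η * κ * w) → (∀ j : ℕ, |z j| ≤ η ^ 2 * κ ^ 2 * w / (1 + (j : ℝ) ^ 2)) →
      (∀ j : ℕ, |z' j| ≤ η ^ 2 * κ ^ 2 * w / (1 + (j : ℝ) ^ 2)) →
      (∀ j : ℕ, |z j - z' j| ≤ M * (η ^ 2 * κ ^ 2 * w / (1 + (j : ℝ) ^ 2))) →
      |(cubicDefect κ a B - O / ρ * Rc (ρ * (a + B)) z) -
          (cubicDefect κ a B' - O / ρ * Rc (ρ * (a + B')) z')| ≤
        K₁ * (M * η * κ ^ 3 * (κ + η) * w) ∧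
      |cubicDefect κ a 0 - O / ρ * Rc (ρ * (a + 0)) 0| ≤ K₁ * (κ ^ 4 * w) ∧
      (∀ j, |Fc (ρ * (a + B)) z j - Fc (ρ * (a + B')) z' j| ≤ K₁ * (M * η * κ ^ 3 * w)) ∧
      (∀ j, |Fc (ρ * (a + 0)) 0 j| ≤ K₁ * (κ ^ 3 * w)) ∧
      |(ρ * (a + B)) ^ 2 - (ρ * (a + B')) ^ 2| ≤ K₁ * (M * η * κ ^ 2 * w) ∧
      |(ρ * (a + 0)) ^ 2| ≤ K₁ * (κ ^ 2 * w) := by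
  obtain ⟨Kc, hKc, hcub⟩ := exists_lipschitz_cubicDefect hKa
  obtain ⟨L, hL⟩ : ∃ L, L = ρ * (Ka + 1) := ⟨_, rfl⟩
  have hL0 : 0 < L := by rw [hL]; positivity
  obtain ⟨k₁, hk₁⟩ : ∃ k, k = Kc + O / ρ * (K * (ρ * (L ^ 3 + 1) + L)) := ⟨_, rfl⟩
  obtain ⟨k₂, hk₂⟩ : ∃ k, k = Kc * Ka + O / ρ * (K * (L ^ 3 * ρ * Ka)) := ⟨_, rfl⟩
  obtain ⟨k₃, hk₃⟩ : ∃ k, k = K * (L ^ 2 * ρ + L) := ⟨_, rfl⟩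
  obtain ⟨k₄, hk₄⟩ : ∃ k, k = K * (L ^ 2 * ρ * Ka) := ⟨_, rfl⟩
  obtain ⟨k₅, hk₅⟩ : ∃ k, k = ρ ^ 2 * (2 * (Ka + 1)) := ⟨_, rfl⟩
  obtain ⟨k₆, hk₆⟩ : ∃ k, k = ρ ^ 2 * Ka ^ 2 := ⟨_, rfl⟩
  have p₁ : 0 < k₁ := by rw [hk₁]; positivity
  have p₂ : 0 ≤ k₂ := by rw [hk₂]; positivity
  have p₃ : 0 < k₃ := by rw [hk₃]; positivity
  have p₄ : 0 ≤ k₄ := by rw [hk₄]; positivity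
  have p₅ : 0 < k₅ := by rw [hk₅]; positivity
  have p₆ : 0 ≤ k₆ := by rw [hk₆]; positivity
  refine ⟨k₁ + k₂ + k₃ + k₄ + k₅ + k₆, by positivity, ?_⟩
  intro κ η w M a B B' z z' hκ0 hκ1 hη0 hη1 hw0 hw1 hM he hSη ha hB hB' hBB hz hz' hzz
  rw [← hL] at he hSη
  have hup : ∀ {k x y : ℝ}, 0 ≤ y → x ≤ k * y → k ≤ k₁ + k₂ + k₃ + k₄ + k₅ + k₆ →
      x ≤ (k₁ + k₂ + k₃ + k₄ + k₅ + k₆) * y := fun hy hx hk =>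
    hx.trans (mul_le_mul_of_nonneg_right hk hy)
  have hη2 : η ^ 2 ≤ η := pow_le_of_le_one hη0 hη1 two_ne_zero
  have hκw : κ * w ≤ κ := mul_le_of_le_one_right hκ0 hw1
  have haκ : |a| ≤ Ka * κ := ha.trans (by rw [mul_assoc]; gcongr)
  have hBκ : ∀ {B : ℝ}, |B| ≤ η * κ * w → |B| ≤ η * κ := fun h =>
    h.trans (by rw [mul_assoc]; gcongr)
  have hηκ : η * κ ≤ κ := mul_le_of_le_one_left hκ0 hη1
  have hA : ∀ {B : ℝ}, |B| ≤ η * κ * w → |ρ * (a + B)| ≤ L * κ := by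
    intro B h
    rw [abs_mul, abs_of_pos hρ, hL, mul_assoc]
    gcongr
    refine (abs_add_le _ _).trans ?_
    linarith [hBκ h]
  have hdA : |ρ * (a + B) - ρ * (a + B')| ≤ ρ * (M * (η * κ * w)) := by
    rw [← mul_sub, add_sub_add_left_eq_sub, abs_mul, abs_of_pos hρ]
    gcongr
  have hζ : S * (η ^ 2 * κ ^ 2 * w) ≤ (L * κ) ^ 2 := by
    calc S * (η ^ 2 * κ ^ 2 * w) = S * η ^ 2 * κ ^ 2 * w := by ring
      _ ≤ L ^ 2 * κ ^ 2 * 1 := by gcongr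
      _ = _ := by ring
  have hzz' : ∀ j : ℕ, |z j - z' j| ≤ M * (η ^ 2 * κ ^ 2 * w) / (1 + (j : ℝ) ^ 2) := fun j =>
    (hzz j).trans_eq (by ring)
  obtain ⟨hF, hR⟩ := hb.lipschitz (L * κ) (η ^ 2 * κ ^ 2 * w) (M * (η ^ 2 * κ ^ 2 * w)) _ _ z z'
    he hζ (hA hB) (hA hB') hz hz' hzz'
  have hz0 : ∀ j : ℕ, |(0 : ℕ → ℝ) j| ≤ 0 / (1 + (j : ℝ) ^ 2) := by simp
  have hA0 : |ρ * (a + 0)| ≤ L * κ := hA (by rw [abs_zero]; positivity)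
  obtain ⟨hF0, hR0⟩ := hb.lipschitz (L * κ) 0 0 (ρ * (a + 0)) 0 0 0 he
    (by rw [mul_zero]; positivity) hA0 (by rw [abs_zero]; positivity) hz0 hz0 (by simp)
  obtain ⟨hc1, hc2⟩ := hcub κ η a B B' hκ0 hκ1 hη0 hη1 haκ (hBκ hB) (hBκ hB')
  have hρa : |ρ * (a + 0) - 0| ≤ ρ * (Ka * κ * w) := by
    rw [sub_zero, add_zero, abs_mul, abs_of_pos hρ]; gcongr
  refine ⟨?_, ?_, fun j => ?_, fun j => ?_, ?_, ?_⟩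
  · refine hup (k := k₁) (by positivity) ?_ (by linarith)
    rw [sub_sub_sub_comm, ← mul_sub]
    refine (abs_sub _ _).trans ?_
    rw [abs_mul, abs_of_pos (by positivity : 0 < O / ρ), hk₁, add_mul]
    refine add_le_add ?_ ?_
    · calc _ ≤ Kc * (κ ^ 2 * (κ + η)) * (M * (η * κ * w)) := hc1.trans (by gcongr)
        _ = _ := by ring
    · rw [mul_assoc (O / ρ)]
      gcongr
      refine hR.trans ?_
      rw [mul_assoc K]
      gcongr
      calc _ ≤ ((L * κ) ^ 3 + η ^ 2 * κ ^ 2 * w) * (ρ * (M * (η * κ * w))) +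
            L * κ * (M * (η ^ 2 * κ ^ 2 * w)) := by gcongr
        _ ≤ ((L * κ) ^ 3 + η * κ ^ 2 * 1) * (ρ * (M * (η * κ * w))) +
            L * κ * (M * (η ^ 2 * κ ^ 2 * w)) := by gcongr
        _ = (ρ * (L ^ 3 * κ + η) + L * η) * (M * η * κ ^ 3 * w) := by ring
        _ ≤ ((ρ * (L ^ 3 + 1) + L) * (κ + η)) * (M * η * κ ^ 3 * w) := by
            gcongr
            have : 0 ≤ ρ * κ + ρ * (L ^ 3 * η) + L * κ := by positivity
            linarith
        _ = _ := by ring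
  · refine hup (k := k₂) (by positivity) ?_ (by linarith)
    refine (abs_sub _ _).trans ?_
    rw [abs_mul, abs_of_pos (by positivity : 0 < O / ρ), hk₂, add_mul]
    rw [hb.zero_right, sub_zero] at hR0
    refine add_le_add ?_ ?_
    · calc _ ≤ Kc * κ ^ 4 * (Ka * κ * w) := hc2.trans (by gcongr)
        _ = Kc * Ka * (κ ^ 4 * w) * κ := by ring
        _ ≤ Kc * Ka * (κ ^ 4 * w) * 1 := by gcongr
        _ = _ := by ring
    · rw [mul_assoc (O / ρ)]
      gcongr
      refine hR0.trans ?_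
      rw [mul_assoc K]
      gcongr
      calc _ ≤ ((L * κ) ^ 3 + 0) * (ρ * (Ka * κ * w)) + L * κ * 0 := by gcongr
        _ = _ := by ring
  · refine hup (k := k₃) (by positivity) ?_ (by linarith)
    refine (hF j).trans ?_
    rw [hk₃, mul_assoc K]
    gcongr
    calc _ ≤ (L * κ) ^ 2 * (ρ * (M * (η * κ * w))) + L * κ * (M * (η ^ 2 * κ ^ 2 * w)) := by gcongr
      _ ≤ (L * κ) ^ 2 * (ρ * (M * (η * κ * w))) + L * κ * (M * (η * κ ^ 2 * w)) := by gcongr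
      _ = _ := by ring
  · refine hup (k := k₄) (by positivity) ?_ (by linarith)
    have := hF0 j
    rw [hb.zero_left, sub_zero] at this
    refine this.trans ?_
    rw [hk₄, mul_assoc K]
    gcongr
    calc _ ≤ (L * κ) ^ 2 * (ρ * (Ka * κ * w)) + L * κ * 0 := by gcongr
      _ = _ := by ring
  · refine hup (k := k₅) (by positivity) ?_ (by linarith)
    have e : (ρ * (a + B)) ^ 2 - (ρ * (a + B')) ^ 2 = ρ ^ 2 * ((B - B') * (a + B + (a + B'))) := by
      ring
    rw [e, abs_mul, abs_of_pos (by positivity : 0 < ρ ^ 2), abs_mul, hk₅]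
    have e2 : |a + B + (a + B')| ≤ 2 * (Ka + 1) * κ := by
      refine (abs_add_le _ _).trans ((add_le_add (abs_add_le _ _) (abs_add_le _ _)).trans ?_)
      linarith [hBκ hB, hBκ hB']
    calc _ ≤ ρ ^ 2 * ((M * (η * κ * w)) * (2 * (Ka + 1) * κ)) := by gcongr
      _ = _ := by ring
  · refine hup (k := k₆) (by positivity) ?_ (by linarith)
    rw [add_zero, mul_pow, abs_mul, abs_of_pos (by positivity : 0 < ρ ^ 2), abs_pow, hk₆]
    calc _ ≤ ρ ^ 2 * (Ka * κ * w) ^ 2 := by gcongr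
      _ = ρ ^ 2 * Ka ^ 2 * (κ ^ 2 * w) * w := by ring
      _ ≤ ρ ^ 2 * Ka ^ 2 * (κ ^ 2 * w) * 1 := by gcongr
      _ = _ := by ring

end

section

open Real

/-- The diagonal symbol of the linearised equation in the `j`-th Fourier mode. -/
noncomputable def modeSymbol (O μ : ℝ) (j : ℕ) : ℝ := -((O + 4 + μ) * (j : ℝ) ^ 2) + O + 2

theorem le_abs_modeSymbol {O μ : ℝ} (hO : 0 < O) (hμ : 0 ≤ μ) {j : ℕ} (hj : j ≠ 1) :
    O + 2 ≤ |modeSymbol O μ j| ∧ 1 + (j : ℝ) ^ 2 ≤ |modeSymbol O μ j| := by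
  rcases Nat.eq_zero_or_pos j with rfl | hpos
  · simp only [modeSymbol, Nat.cast_zero]
    rw [abs_of_pos (by nlinarith)]
    constructor <;> nlinarith
  · have h2 : (2 : ℝ) ≤ j := by exact_mod_cast (by omega : 2 ≤ j)
    have h4 : (4 : ℝ) ≤ (j : ℝ) ^ 2 := by nlinarith
    have hX := mul_le_mul_of_nonneg_left h4 hO.le
    have hY := mul_nonneg hμ (sq_nonneg (j : ℝ))
    rw [modeSymbol, abs_of_neg (by nlinarith)]
    constructor <;> nlinarith

theorem abs_modeSymbol_inv_mul_le {O μ X Y x y θ : ℝ} (hO : 0 < O) (hμ : 0 ≤ μ) {j : ℕ} (hj : j ≠ 1)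
    (hθ : θ = (2 + O / 2) / (2 + O))
    (hX : |X| ≤ (2 + O / 2) * (x / (1 + (j : ℝ) ^ 2))) (hY : |Y| ≤ y) :
    |(modeSymbol O μ j)⁻¹ * (X + Y)| ≤ (θ * x + y) / (1 + (j : ℝ) ^ 2) := by
  obtain ⟨h1, h2⟩ := le_abs_modeSymbol hO hμ hj
  have hj1 : (0 : ℝ) < 1 + (j : ℝ) ^ 2 := by positivity
  have hy : 0 ≤ y := (abs_nonneg _).trans hY
  rw [abs_mul, abs_inv, add_div]
  have e1 : |modeSymbol O μ j|⁻¹ ≤ (2 + O)⁻¹ := inv_anti₀ (by linarith) (by linarith)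
  have e2 : |modeSymbol O μ j|⁻¹ ≤ (1 + (j : ℝ) ^ 2)⁻¹ := inv_anti₀ hj1 h2
  calc |modeSymbol O μ j|⁻¹ * |X + Y| ≤ |modeSymbol O μ j|⁻¹ * (|X| + |Y|) := by
        gcongr; exact abs_add_le _ _
    _ = |modeSymbol O μ j|⁻¹ * |X| + |modeSymbol O μ j|⁻¹ * |Y| := by ring
    _ ≤ (2 + O)⁻¹ * ((2 + O / 2) * (x / (1 + (j : ℝ) ^ 2))) + (1 + (j : ℝ) ^ 2)⁻¹ * y := by gcongr
    _ = θ * x / (1 + (j : ℝ) ^ 2) + y / (1 + (j : ℝ) ^ 2) := by rw [hθ]; ring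

/-- Index set of the unknowns: amplitude corrections, their increments, and slaved modes. -/
abbrev BreatherIdx := ℕ ⊕ ℕ ⊕ (ℕ × ℕ)

noncomputable def breatherWeight (κ η : ℝ) : BreatherIdx → ℝ
  | .inl n => η * κ * exp (-(κ * n / 2))
  | .inr (.inl n) => η * κ ^ 2 * exp (-(κ * n / 2))
  | .inr (.inr (n, j)) => η ^ 2 * κ ^ 2 * exp (-(κ * n / 2)) / (1 + (j : ℝ) ^ 2)

/-- The modes `j` of the family `u` at site `n`. -/
def slavedModes (u : BreatherIdx → ℝ) (n j : ℕ) : ℝ := u (.inr (.inr (n, j)))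

noncomputable def amplitude (ρ : ℝ) (a : ℕ → ℝ) (u : BreatherIdx → ℝ) (n : ℕ) : ℝ :=
  ρ * (a n + u (.inl n))

noncomputable def resonantForce (O ρ κ : ℝ) (Rc : ℝ → (ℕ → ℝ) → ℝ) (a : ℕ → ℝ)
    (u : BreatherIdx → ℝ) (n : ℕ) : ℝ :=
  cubicDefect κ (a n) (u (.inl n)) - O / ρ * Rc (amplitude ρ a u n) (slavedModes u n)

noncomputable def amplitudeFlux (ρ : ℝ) (a : ℕ → ℝ) (u : BreatherIdx → ℝ) (n : ℕ) : ℝ :=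
  flux ρ (a (n + 1) - a n) (u (.inr (.inl n))) (a (n + 1) + u (.inl (n + 1))) (a n + u (.inl n))

noncomputable def neighbourSum (c : ℕ) (u : BreatherIdx → ℝ) (n j : ℕ) : ℝ :=
  (-1) ^ j * (slavedModes u (n + 1) j + slavedModes u (prevIdx c n) j)

noncomputable def quadraticCoeff (p₀ p₂ : ℝ) (j : ℕ) : ℝ := if j = 0 then p₀ else if j = 2 then p₂ else 0

noncomputable def slavedForce (O ρ μ p₀ p₂ : ℝ) (Fc : ℝ → (ℕ → ℝ) → ℕ → ℝ) (c : ℕ) (a : ℕ → ℝ)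
    (u : BreatherIdx → ℝ) (n j : ℕ) : ℝ :=
  quadraticCoeff p₀ p₂ j * fluxDiv c (amplitudeFlux ρ a u) n +
    (if j = 2 then 4 * μ * p₂ * amplitude ρ a u n ^ 2 else 0) -
    O * Fc (amplitude ρ a u n) (slavedModes u n) j

/-- The map whose fixed points are the breather amplitudes. -/
noncomputable def breatherMap (O ρ κ p₀ p₂ : ℝ) (Fc : ℝ → (ℕ → ℝ) → ℕ → ℝ)
    (Rc : ℝ → (ℕ → ℝ) → ℝ) (c : ℕ) (a : ℕ → ℝ) (G : (ℕ → ℝ) → ℕ → ℝ) (u : BreatherIdx → ℝ) :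
    BreatherIdx → ℝ
  | .inl n => G (resonantForce O ρ κ Rc a u) n
  | .inr (.inl n) => G (resonantForce O ρ κ Rc a u) (n + 1) - G (resonantForce O ρ κ Rc a u) n
  | .inr (.inr (n, j)) => if j = 1 then 0 else (modeSymbol O (2 * cosh κ - 2) j)⁻¹ *
      (neighbourSum c u n j + slavedForce O ρ (2 * cosh κ - 2) p₀ p₂ Fc c a u n j)

theorem abs_slavedForce_term_le {q X Y Z P a b c μ O x : ℝ} (hq : |q| ≤ P) (hX : |X| ≤ 3 * (a * x))
    (hY : |Y| ≤ 4 * μ * P * (b * x)) (hO : 0 < O) (hZ : |Z| ≤ c * x)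
    (hP : 0 ≤ P) :
    |q * X + Y - O * Z| ≤ (P * (3 * a) + 4 * μ * P * b + O * c) * x := by
  have h1 : |q * X| ≤ P * (3 * (a * x)) := by rw [abs_mul]; gcongr
  have h2 : |O * Z| ≤ O * (c * x) := by rw [abs_mul, abs_of_pos hO]; gcongr
  have h3 := abs_sub (q * X + Y) (O * Z)
  have h4 := abs_add_le (q * X) Y
  linarith

theorem abs_quadraticCoeff_le (p₀ p₂ : ℝ) (j : ℕ) : |quadraticCoeff p₀ p₂ j| ≤ |p₀| + |p₂| := by
  have := abs_nonneg p₀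
  have := abs_nonneg p₂
  unfold quadraticCoeff
  split_ifs
  · linarith
  · linarith
  · simp; linarith

/-- Pointwise Lipschitz bounds for the three nonlinear ingredients of `breatherMap`. -/
theorem RemainderBounds.exists_breatherMap_bounds {Fc : ℝ → (ℕ → ℝ) → ℕ → ℝ} {Rc : ℝ → (ℕ → ℝ) → ℝ}
    {K e₀ S : ℝ} (hb : RemainderBounds Fc Rc K e₀ S) (hK : 0 < K) {ρ O Ka : ℝ}
    (hρ : 0 < ρ) (hO : 0 < O) (hKa : 0 ≤ Ka) (p₀ p₂ : ℝ) : ∃ K₁ > (0 : ℝ),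
    ∀ (κ η : ℝ) (c : ℕ) (a : ℕ → ℝ), 0 < κ → κ ≤ 1 → 0 < η → η ≤ 1 → c ≤ 1 →
      ρ * (Ka + 1) * κ ≤ e₀ → S * η ^ 2 ≤ (ρ * (Ka + 1)) ^ 2 →
      (∀ n, |a n| ≤ Ka * κ * exp (-(κ * n / 2))) →
      (∀ n, |a (n + 1) - a n| ≤ Ka * κ ^ 2 * exp (-(κ * n / 2))) →
      (∀ (u v : BreatherIdx → ℝ) (M : ℝ), 0 ≤ M → (∀ i, |u i| ≤ breatherWeight κ η i) →
        (∀ i, |v i| ≤ breatherWeight κ η i) → (∀ i, |u i - v i| ≤ M * breatherWeight κ η i) →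
        ∀ n : ℕ, |resonantForce O ρ κ Rc a u n - resonantForce O ρ κ Rc a v n| ≤
            K₁ * M * η * κ ^ 3 * (κ + η) * exp (-(κ * n / 2)) ∧
          ∀ j : ℕ, |slavedForce O ρ (2 * cosh κ - 2) p₀ p₂ Fc c a u n j -
              slavedForce O ρ (2 * cosh κ - 2) p₀ p₂ Fc c a v n j| ≤
            K₁ * M * η * κ ^ 3 * exp (-(κ * n / 2))) ∧
      ∀ n : ℕ, |resonantForce O ρ κ Rc a 0 n| ≤ K₁ * κ ^ 4 * exp (-(κ * n / 2)) ∧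
        ∀ j : ℕ, |slavedForce O ρ (2 * cosh κ - 2) p₀ p₂ Fc c a 0 n j| ≤
            K₁ * κ ^ 3 * exp (-(κ * n / 2)) := by
  obtain ⟨K₁, hK₁, hloc⟩ := hb.exists_local_bounds hK hρ hO hKa
  obtain ⟨K₂, hK₂, hfl⟩ := exists_lipschitz_flux ρ hKa
  obtain ⟨P, hP⟩ : ∃ P, P = |p₀| + |p₂| := ⟨_, rfl⟩
  have hP0 : 0 ≤ P := hP ▸ by positivity
  have hp₂ : |p₂| ≤ P := by rw [hP]; linarith [abs_nonneg p₀]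
  refine ⟨K₁ + (P * (3 * K₂) + 4 * 2 * P * K₁ + O * K₁), by positivity, ?_⟩
  intro κ η c a hκ0 hκ1 hη0 hη1 hc he hSη ha hda
  have hμ0 : 0 ≤ 2 * cosh κ - 2 := by linarith only [one_le_cosh κ]
  have hμ : 2 * cosh κ - 2 ≤ 2 * κ ^ 2 := by linarith only [cosh_sub_one_le_sq hκ0.le hκ1]
  have hw1 : ∀ n : ℕ, exp (-(κ * n / 2)) ≤ 1 := fun n => exp_le_one_iff.2 (by
    have : 0 ≤ κ * n / 2 := by positivity
    linarith)
  have hbn : ∀ u : BreatherIdx → ℝ, (∀ i, |u i| ≤ breatherWeight κ η i) → ∀ n,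
      |a n + u (.inl n)| ≤ (Ka + 1) * κ := by
    intro u hu n
    have h1 := hu (.inl n)
    have h2 := ha n
    simp only [breatherWeight] at h1
    have h3 := abs_add_le (a n) (u (.inl n))
    have h4 : Ka * κ * exp (-(κ * n / 2)) ≤ Ka * κ := mul_le_of_le_one_right (by positivity) (hw1 n)
    have h5 : η * κ * exp (-(κ * n / 2)) ≤ η * κ := mul_le_of_le_one_right (by positivity) (hw1 n)
    have h6 : η * κ ≤ κ := mul_le_of_le_one_left hκ0.le hη1
    linarith only [h1, h2, h3, h4, h5, h6]
  have h0 : ∀ i, |(0 : BreatherIdx → ℝ) i| ≤ breatherWeight κ η i := by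
    rintro (n | n | ⟨n, j⟩) <;> simp only [Pi.zero_apply, abs_zero, breatherWeight] <;> positivity
  have hμX : ∀ X : ℝ, 0 ≤ X → 4 * (2 * cosh κ - 2) * P * (K₁ * (X * κ ^ 2)) ≤
      4 * 2 * P * K₁ * (X * κ ^ 3) := by
    intro X hX
    have h1 : (2 * cosh κ - 2) * κ ^ 2 ≤ 2 * κ ^ 3 := by
      calc (2 * cosh κ - 2) * κ ^ 2 ≤ 2 * κ ^ 2 * κ ^ 2 := by gcongr
        _ = 2 * κ ^ 3 * κ := by ring
        _ ≤ 2 * κ ^ 3 := mul_le_of_le_one_right (by positivity) hκ1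
    calc _ = 4 * P * K₁ * X * ((2 * cosh κ - 2) * κ ^ 2) := by ring
      _ ≤ 4 * P * K₁ * X * (2 * κ ^ 3) := by gcongr
      _ = _ := by ring
  constructor
  · intro u v M hM hu hv huv n
    obtain ⟨w, hw⟩ : ∃ w, w = exp (-(κ * n / 2)) := ⟨_, rfl⟩
    have hwpos : 0 < w := hw ▸ exp_pos _
    obtain ⟨l1, -, l3, -, l5, -⟩ := hloc κ η w M (a n) (u (.inl n)) (v (.inl n)) (slavedModes u n)
      (slavedModes v n) hκ0.le hκ1 hη0.le hη1 hwpos.le (hw ▸ hw1 n) hM he hSη (hw ▸ ha n)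
      (hw ▸ hu (.inl n)) (hw ▸ hv (.inl n)) (hw ▸ huv (.inl n)) (fun j => hw ▸ hu (.inr (.inr (n, j))))
      (fun j => hw ▸ hv (.inr (.inr (n, j)))) (fun j => hw ▸ huv (.inr (.inr (n, j))))
    rw [← hw]
    constructor
    · refine (le_of_eq ?_).trans (l1.trans ?_)
      · rfl
      · have hE : 0 ≤ M * η * κ ^ 3 * (κ + η) * w := by positivity
        have hR : 0 ≤ P * (3 * K₂) + 4 * 2 * P * K₁ + O * K₁ := by positivity
        linarith only [mul_nonneg hR hE]
    · intro j
      have hQ : |fluxDiv c (amplitudeFlux ρ a u) n - fluxDiv c (amplitudeFlux ρ a v) n| ≤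
          3 * (K₂ * (M * η * κ ^ 3) * w) := by
        rw [fluxDiv_sub, ← mul_assoc, hw]
        refine abs_fluxDiv_le hc hκ0.le hκ1 (fun i => ?_) n
        have hd : ∀ i : ℕ, |(a i + u (.inl i)) - (a i + v (.inl i))| ≤ M * (η * κ) := fun i => by
          have := huv (.inl i)
          simp only [breatherWeight] at this
          rw [add_sub_add_left_eq_sub]
          exact this.trans
            (mul_le_mul_of_nonneg_left (mul_le_of_le_one_right (by positivity) (hw1 i)) hM)
        have := (hfl κ η (exp (-(κ * i / 2))) M _ _ _ _ _ _ _ hκ0.le hη0.le hη1 (exp_pos _).le hM (hda i)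
          (hu (.inr (.inl i))) (hv (.inr (.inl i))) (huv (.inr (.inl i))) (hbn u hu (i + 1))
          (hbn v hv (i + 1)) (hbn u hu i) (hbn v hv i) (hd (i + 1)) (hd i)).1
        refine this.trans (le_of_eq ?_)
        ring
      have key := abs_slavedForce_term_le (q := quadraticCoeff p₀ p₂ j) (P := P)
        (X := fluxDiv c (amplitudeFlux ρ a u) n - fluxDiv c (amplitudeFlux ρ a v) n)
        (Y := if j = 2 then 4 * (2 * cosh κ - 2) * p₂ *
          (amplitude ρ a u n ^ 2 - amplitude ρ a v n ^ 2) else 0)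
        (Z := Fc (amplitude ρ a u n) (slavedModes u n) j - Fc (amplitude ρ a v n) (slavedModes v n) j)
        (a := K₂ * (M * η * κ ^ 3)) (b := K₁ * (M * η * κ ^ 2)) (c := K₁ * (M * η * κ ^ 3))
        (μ := 2 * cosh κ - 2) (O := O) (x := w) (hP ▸ abs_quadraticCoeff_le p₀ p₂ j) hQ ?_ hO ?_ hP0
      · refine (le_of_eq ?_).trans (key.trans ?_)
        · congr 1
          simp only [slavedForce]
          split_ifs <;> ring
        · have := mul_le_mul_of_nonneg_right (hμX (M * η) (by positivity)) hwpos.le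
          have hE : 0 ≤ K₁ * (M * η * κ ^ 3 * w) := by positivity
          linarith only [this, hE]
      · split_ifs
        · rw [abs_mul, abs_mul, abs_of_nonneg (by linarith : 0 ≤ 4 * (2 * cosh κ - 2))]
          refine mul_le_mul (mul_le_mul_of_nonneg_left hp₂ (by linarith)) (l5.trans (le_of_eq ?_))
            (abs_nonneg _) (by positivity)
          ring
        · rw [abs_zero]; positivity
      · refine (l3 j).trans (le_of_eq ?_)
        ring
  · intro n
    obtain ⟨w, hw⟩ : ∃ w, w = exp (-(κ * n / 2)) := ⟨_, rfl⟩
    have hwpos : 0 < w := hw ▸ exp_pos _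
    have hz : ∀ j : ℕ, |(0 : ℕ → ℝ) j| ≤ η ^ 2 * κ ^ 2 * w / (1 + (j : ℝ) ^ 2) := fun j => by
      rw [Pi.zero_apply, abs_zero]; positivity
    have h00 : |(0 : ℝ)| ≤ η * κ * w := by rw [abs_zero]; positivity
    obtain ⟨-, l2, -, l4, -, l6⟩ := hloc κ η w 0 (a n) 0 0 0 0 hκ0.le hκ1 hη0.le hη1 hwpos.le
      (hw ▸ hw1 n) le_rfl he hSη (hw ▸ ha n) h00 h00 (by simp) hz hz (by simp)
    rw [← hw]
    constructor
    · refine (le_of_eq ?_).trans (l2.trans ?_)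
      · rfl
      · have hE : 0 ≤ κ ^ 4 * w := by positivity
        have hR : 0 ≤ P * (3 * K₂) + 4 * 2 * P * K₁ + O * K₁ := by positivity
        linarith only [mul_nonneg hR hE]
    · intro j
      have hQ : |fluxDiv c (amplitudeFlux ρ a 0) n| ≤ 3 * (K₂ * κ ^ 3 * w) := by
        rw [← mul_assoc, hw]
        refine abs_fluxDiv_le hc hκ0.le hκ1 (fun i => ?_) n
        have := (hfl κ η (exp (-(κ * i / 2))) 0 _ _ _ _ _ _ _ hκ0.le hη0.le hη1 (exp_pos _).le le_rfl
          (hda i) (h0 (.inr (.inl i))) (h0 (.inr (.inl i))) (by simp) (hbn 0 h0 (i + 1))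
          (hbn 0 h0 (i + 1)) (hbn 0 h0 i) (hbn 0 h0 i) (by simp) (by simp)).2
        refine this.trans (le_of_eq ?_)
        ring
      have key := abs_slavedForce_term_le (q := quadraticCoeff p₀ p₂ j) (P := P)
        (X := fluxDiv c (amplitudeFlux ρ a 0) n)
        (Y := if j = 2 then 4 * (2 * cosh κ - 2) * p₂ * amplitude ρ a 0 n ^ 2 else 0)
        (Z := Fc (amplitude ρ a 0 n) (slavedModes 0 n) j)
        (a := K₂ * κ ^ 3) (b := K₁ * (1 * κ ^ 2)) (c := K₁ * κ ^ 3)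
        (μ := 2 * cosh κ - 2) (O := O) (x := w) (hP ▸ abs_quadraticCoeff_le p₀ p₂ j) hQ ?_ hO ?_ hP0
      · refine (le_of_eq ?_).trans (key.trans ?_)
        · rfl
        · have := mul_le_mul_of_nonneg_right (hμX 1 zero_le_one) hwpos.le
          have hE : 0 ≤ K₁ * (κ ^ 3 * w) := by positivity
          linarith only [this, hE]
      · split_ifs
        · rw [abs_mul, abs_mul, abs_of_nonneg (by linarith : 0 ≤ 4 * (2 * cosh κ - 2))]
          refine mul_le_mul (mul_le_mul_of_nonneg_left hp₂ (by linarith)) (l6.trans (le_of_eq ?_))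
            (abs_nonneg _) (by positivity)
          ring
        · rw [abs_zero]; positivity
      · refine (le_of_eq ?_).trans ((l4 j).trans (le_of_eq ?_))
        · rfl
        · ring

end

section

open Real Filter Topology

theorem exists_forall_small {p : ℝ → Prop} (h : ∀ᶠ κ in 𝓝[>] (0 : ℝ), p κ) :
    ∃ κ₀ > (0 : ℝ), ∀ κ, 0 < κ → κ ≤ κ₀ → p κ := by
  obtain ⟨u, hu, hsub⟩ := mem_nhdsGT_iff_exists_Ioc_subset.1 h
  exact ⟨u, hu, fun κ h0 h1 => hsub ⟨h0, h1⟩⟩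

theorem eventually_mul_le_nhdsGT (X : ℝ) {b : ℝ} (hb : 0 < b) :
    ∀ᶠ κ in 𝓝[>] (0 : ℝ), X * κ ≤ b := by
  have : Tendsto (fun κ : ℝ => X * κ) (𝓝[>] 0) (𝓝 (X * 0)) :=
    (tendsto_id.const_mul X).mono_left nhdsWithin_le_nhds
  rw [mul_zero] at this
  exact (this.eventually (gt_mem_nhds hb)).mono fun _ h => h.le

theorem abs_neighbourSum_le {c : ℕ} {κ X b : ℝ} (hκ : 0 ≤ κ) (hb : exp (κ / 2) ≤ 1 + b) {j : ℕ}
    {u : BreatherIdx → ℝ} (hX : 0 ≤ X)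
    (hu : ∀ n : ℕ, |slavedModes u n j| ≤ X * exp (-(κ * n / 2)) / (1 + (j : ℝ) ^ 2)) (n : ℕ) :
    |neighbourSum c u n j| ≤ (2 + b) * (X * exp (-(κ * n / 2)) / (1 + (j : ℝ) ^ 2)) := by
  have hj : (0 : ℝ) < 1 + (j : ℝ) ^ 2 := by positivity
  rw [neighbourSum, abs_mul, abs_pow, abs_neg, abs_one, one_pow, one_mul]
  have h1 : |slavedModes u (n + 1) j| ≤ X * exp (-(κ * n / 2)) / (1 + (j : ℝ) ^ 2) := by
    refine (hu (n + 1)).trans (div_le_div_of_nonneg_right (mul_le_mul_of_nonneg_left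
      (exp_le_exp.2 ?_) hX) hj.le)
    push_cast
    linarith only [hκ]
  have h2 : |slavedModes u (prevIdx c n) j| ≤
      (1 + b) * (X * exp (-(κ * n / 2)) / (1 + (j : ℝ) ^ 2)) := by
    refine (hu _).trans ?_
    rw [mul_div_assoc', mul_left_comm]
    refine div_le_div_of_nonneg_right (mul_le_mul_of_nonneg_left ?_ hX) hj.le
    exact (exp_prevIdx_le hκ n).trans (mul_le_mul_of_nonneg_right hb (exp_pos _).le)
  have h3 := abs_add_le (slavedModes u (n + 1) j) (slavedModes u (prevIdx c n) j)
  linarith only [h1, h2, h3]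

theorem neighbourSum_sub (c : ℕ) (u v : BreatherIdx → ℝ) (n j : ℕ) :
    neighbourSum c u n j - neighbourSum c v n j = neighbourSum c (u - v) n j := by
  simp only [neighbourSum, slavedModes, Pi.sub_apply]
  ring

/-- Solution of the amplitude equations of small even time-periodic localised oscillations. -/
theorem RemainderBounds.exists_amplitudes {Fc : ℝ → (ℕ → ℝ) → ℕ → ℝ} {Rc : ℝ → (ℕ → ℝ) → ℝ}
    {K e₀ S : ℝ} (hb : RemainderBounds Fc Rc K e₀ S) (hK : 0 < K) (he₀ : 0 < e₀) (hS : 0 < S)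
    {ρ O : ℝ} (hρ : 0 < ρ) (hO : 0 < O) (p₀ p₂ : ℝ) : ∃ L > (0 : ℝ), ∃ η > (0 : ℝ), ∃ κ₀ > (0 : ℝ),
    S * η ^ 2 ≤ L ^ 2 ∧ ∀ κ, 0 < κ → κ ≤ κ₀ → κ ≤ 1 ∧ L * κ ≤ e₀ ∧ ∀ c : ℕ, c ≤ 1 →
      ∃ (A : ℕ → ℝ) (z : ℕ → ℕ → ℝ),
        (∀ n : ℕ, |A n| ≤ L * κ * exp (-(κ * n / 2))) ∧
        (∀ n j : ℕ, |z n j| ≤ η ^ 2 * κ ^ 2 * exp (-(κ * n / 2)) / (1 + (j : ℝ) ^ 2)) ∧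
        A 0 ≠ 0 ∧ (∀ n, z n 1 = 0) ∧
        (∀ n, A (n + 1) + A (prevIdx c n) =
          2 * cosh κ * A n - 2 / ρ ^ 2 * A n ^ 3 - O * Rc (A n) (z n)) ∧
        ∀ n j, j ≠ 1 → modeSymbol O (2 * cosh κ - 2) j * z n j =
          (-1) ^ j * (z (n + 1) j + z (prevIdx c n) j) +
          (quadraticCoeff p₀ p₂ j * (A (n + 1) ^ 2 + A (prevIdx c n) ^ 2 - 2 * A n ^ 2) +
            (if j = 2 then 4 * (2 * cosh κ - 2) * p₂ * A n ^ 2 else 0) - O * Fc (A n) (z n) j) := by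
  obtain ⟨Ka, hKa, hsol⟩ := exists_soliton_bounds
  obtain ⟨Kg, hKg, hinv⟩ := exists_soliton_inverse
  obtain ⟨K₁, hK₁, hbd⟩ := hb.exists_breatherMap_bounds hK hρ hO hKa.le p₀ p₂
  obtain ⟨θ, hθ⟩ : ∃ θ, θ = (2 + O / 2) / (2 + O) := ⟨_, rfl⟩
  have hθ0 : 0 < θ := hθ ▸ by positivity
  have hθ1 : θ < 1 := by rw [hθ, div_lt_one (by positivity)]; linarith
  obtain ⟨q, hq⟩ : ∃ q, q = (1 + θ) / 2 := ⟨_, rfl⟩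
  have hq0 : 0 < q := by linarith
  have hq1 : q < 1 := by linarith
  have hqθ : θ < q := by linarith
  obtain ⟨L, hL⟩ : ∃ L, L = ρ * (Ka + 1) := ⟨_, rfl⟩
  have hL0 : 0 < L := hL ▸ by positivity
  obtain ⟨η, hη0, hη⟩ := exists_forall_small
    (((eventually_mul_le_nhdsGT 4 one_pos).and (eventually_mul_le_nhdsGT (Kg * K₁) (half_pos hq0))).and
      (eventually_mul_le_nhdsGT S (pow_pos hL0 2)))
  obtain ⟨⟨hη1, hη2⟩, hη3⟩ := hη η hη0 le_rfl
  have hSη : S * η ^ 2 ≤ L ^ 2 := by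
    calc S * η ^ 2 = S * η * η := by ring
      _ ≤ S * η * 1 := by gcongr; linarith
      _ ≤ L ^ 2 := by linarith
  obtain ⟨κ₀, hκ₀, hsmall⟩ := exists_forall_small
    (((eventually_mul_le_nhdsGT 1 one_pos).and (eventually_mul_le_nhdsGT L he₀)).and
      (((eventually_mul_le_nhdsGT 1 (half_pos hO)).and
        (eventually_mul_le_nhdsGT (Kg * K₁) (half_pos hq0))).and
      (((eventually_mul_le_nhdsGT (Kg * K₁) (mul_pos (sub_pos.2 hq1) hη0)).and
        (eventually_mul_le_nhdsGT K₁ (mul_pos (sub_pos.2 hqθ) hη0))).and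
        (eventually_mul_le_nhdsGT K₁ (mul_pos (sub_pos.2 hq1) (pow_pos hη0 2))))))
  refine ⟨L, hL0, η, hη0, κ₀, hκ₀, hSη, fun κ hκ0 hκ => ?_⟩
  obtain ⟨⟨hκ1, hκe⟩, ⟨hκO, hκq⟩, ⟨hκη, hκθ⟩, hκη2⟩ := hsmall κ hκ0 hκ
  clear hsmall
  rw [one_mul] at hκ1 hκO
  refine ⟨hκ1, hκe, fun c hc => ?_⟩
  obtain ⟨G, hG, hGsub⟩ := hinv κ hκ0 hκ1 c hc
  obtain ⟨a, ha⟩ : ∃ a : ℕ → ℝ, a = fun n => solitonProfile κ (halfPos c n) := ⟨_, rfl⟩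
  have hrec := fun n => (hsol κ hκ0 hκ1 c hc n).1
  have hab : ∀ n, |a n| ≤ Ka * κ * exp (-(κ * n / 2)) := fun n => ha ▸ (hsol κ hκ0 hκ1 c hc n).2.1
  have hda : ∀ n, |a (n + 1) - a n| ≤ Ka * κ ^ 2 * exp (-(κ * n / 2)) :=
    fun n => ha ▸ (hsol κ hκ0 hκ1 c hc n).2.2.1
  have ha0 : κ / 2 ≤ a 0 := ha ▸ (hsol κ hκ0 hκ1 c hc 0).2.2.2
  obtain ⟨hLip, hzero⟩ := hbd κ η c a hκ0 hκ1 hη0 (by linarith) hc (hL ▸ hκe) (hL ▸ hSη) hab hda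
  have hexp : exp (κ / 2) ≤ 1 + O / 2 := by
    have := exp_sub_one_le_two_mul (κ := κ / 2) (by linarith) (by linarith)
    linarith
  have hμ0 : 0 ≤ 2 * cosh κ - 2 := by linarith only [one_le_cosh κ]
  have hκi : κ⁻¹ * κ = 1 := inv_mul_cancel₀ hκ0.ne'
  have hwt : ∀ i, 0 ≤ breatherWeight κ η i := by
    rintro (n | n | ⟨n, j⟩) <;> simp only [breatherWeight] <;> positivity
  have hzw : ∀ i, |(0 : BreatherIdx → ℝ) i| ≤ breatherWeight κ η i := fun i => by
    simpa using hwt i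
  have hbdd : ∀ u : BreatherIdx → ℝ, (∀ i, |u i| ≤ breatherWeight κ η i) → ∀ n : ℕ,
      |resonantForce O ρ κ Rc a u n| ≤
        (K₁ * 1 * η * κ ^ 3 * (κ + η) + K₁ * κ ^ 4) * exp (-(κ * n / 2)) := by
    intro u hu n
    have h1 := (hLip u 0 1 zero_le_one hu hzw (by simpa using hu) n).1
    have h2 := (hzero n).1
    have h3 := abs_sub_abs_le_abs_sub (resonantForce O ρ κ Rc a u n) (resonantForce O ρ κ Rc a 0 n)
    linarith only [h1, h2, h3]
  obtain ⟨u, hu, hfix⟩ := exists_fixedPoint_of_weighted_contraction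
    (breatherMap O ρ κ p₀ p₂ Fc Rc c a G) (breatherWeight κ η) hwt q hq0.le hq1 (by
      intro u v M hM hu hv huv
      have hf : ∀ n : ℕ, |resonantForce O ρ κ Rc a u n - resonantForce O ρ κ Rc a v n| ≤
          K₁ * M * η * κ ^ 3 * (κ + η) * exp (-(κ * n / 2)) := fun n => (hLip u v M hM hu hv huv n).1
      have hGs := hGsub _ _ _ _ (hbdd u hu) (hbdd v hv)
      have hkey : Kg * K₁ * (κ + η) ≤ q := by linarith
      rintro (n | n | ⟨n, j⟩)
      · simp only [breatherMap, breatherWeight]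
        rw [← hGs n]
        refine (hG _ _ hf n).1.trans ?_
        calc _ = (Kg * K₁ * (κ + η)) * (M * η * κ * exp (-(κ * n / 2))) *
              ((κ⁻¹ * κ) * (κ⁻¹ * κ)) := by ring
          _ ≤ q * (M * η * κ * exp (-(κ * n / 2))) * ((κ⁻¹ * κ) * (κ⁻¹ * κ)) := by
            rw [hκi, mul_one, mul_one, mul_one]
            exact mul_le_mul_of_nonneg_right hkey (by positivity)
          _ = _ := by rw [hκi]; ring
      · simp only [breatherMap, breatherWeight]
        rw [sub_sub_sub_comm, ← hGs n, ← hGs (n + 1)]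
        refine (hG _ _ hf n).2.1.trans ?_
        calc _ = (Kg * K₁ * (κ + η)) * (M * η * κ ^ 2 * exp (-(κ * n / 2))) * (κ⁻¹ * κ) := by ring
          _ ≤ q * (M * η * κ ^ 2 * exp (-(κ * n / 2))) * (κ⁻¹ * κ) := by
            rw [hκi, mul_one, mul_one]
            exact mul_le_mul_of_nonneg_right hkey (by positivity)
          _ = _ := by rw [hκi]; ring
      · simp only [breatherMap, breatherWeight]
        split_ifs with hj
        · rw [sub_zero, abs_zero]; positivity
        · rw [← mul_sub, add_sub_add_comm, neighbourSum_sub]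
          have hN := abs_neighbourSum_le (c := c) (j := j) (u := u - v) (X := M * η ^ 2 * κ ^ 2) hκ0.le
            hexp (by positivity) (fun n => (huv (.inr (.inr (n, j)))).trans (le_of_eq (by
              simp only [breatherWeight]; ring))) n
          refine (abs_modeSymbol_inv_mul_le hO hμ0 hj hθ hN ((hLip u v M hM hu hv huv n).2 j)).trans ?_
          rw [mul_div_assoc']
          refine div_le_div_of_nonneg_right ?_ (by positivity)
          have h1 := mul_le_mul_of_nonneg_right hκθ
            (by positivity : 0 ≤ M * η * κ ^ 2 * exp (-(κ * n / 2)))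
          linarith only [h1])
    (by
      have hf := fun n => (hzero n).1
      rintro (n | n | ⟨n, j⟩)
      · simp only [breatherMap, breatherWeight]
        refine (hG _ _ hf n).1.trans ?_
        calc _ = (Kg * K₁ * κ) * (κ * exp (-(κ * n / 2))) * ((κ⁻¹ * κ) * (κ⁻¹ * κ)) := by ring
          _ ≤ ((1 - q) * η) * (κ * exp (-(κ * n / 2))) * ((κ⁻¹ * κ) * (κ⁻¹ * κ)) := by
            rw [hκi, mul_one, mul_one, mul_one]
            exact mul_le_mul_of_nonneg_right hκη (by positivity)
          _ = _ := by rw [hκi]; ring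
      · simp only [breatherMap, breatherWeight]
        refine (hG _ _ hf n).2.1.trans ?_
        calc _ = (Kg * K₁ * κ) * (κ ^ 2 * exp (-(κ * n / 2))) * (κ⁻¹ * κ) := by ring
          _ ≤ ((1 - q) * η) * (κ ^ 2 * exp (-(κ * n / 2))) * (κ⁻¹ * κ) := by
            rw [hκi, mul_one, mul_one]
            exact mul_le_mul_of_nonneg_right hκη (by positivity)
          _ = _ := by rw [hκi]; ring
      · simp only [breatherMap, breatherWeight]
        split_ifs with hj
        · rw [abs_zero]
          have := sub_pos.2 hq1
          positivity
        · have hN : |neighbourSum c 0 n j| ≤ (2 + O / 2) * (0 / (1 + (j : ℝ) ^ 2)) := by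
            simp [neighbourSum, slavedModes]
          refine (abs_modeSymbol_inv_mul_le hO hμ0 hj hθ hN ((hzero n).2 j)).trans ?_
          rw [mul_div_assoc']
          refine div_le_div_of_nonneg_right ?_ (by positivity)
          have h1 := mul_le_mul_of_nonneg_right hκη2
            (by positivity : 0 ≤ κ ^ 2 * exp (-(κ * n / 2)))
          linarith only [h1])
  have hfix1 : ∀ n, G (resonantForce O ρ κ Rc a u) n = u (.inl n) := fun n => congrFun hfix (.inl n)
  have hfix2 : ∀ n, u (.inr (.inl n)) = u (.inl (n + 1)) - u (.inl n) := fun n => by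
    rw [← hfix1, ← hfix1]; exact (congrFun hfix (.inr (.inl n))).symm
  have hfix3 : ∀ n j, (if j = 1 then 0 else (modeSymbol O (2 * cosh κ - 2) j)⁻¹ *
      (neighbourSum c u n j + slavedForce O ρ (2 * cosh κ - 2) p₀ p₂ Fc c a u n j)) =
      slavedModes u n j := fun n j => congrFun hfix (.inr (.inr (n, j)))
  have hflux : amplitudeFlux ρ a u = fun n => amplitude ρ a u (n + 1) ^ 2 - amplitude ρ a u n ^ 2 := by
    funext n
    simp only [amplitudeFlux, flux, amplitude, hfix2]
    ring
  refine ⟨amplitude ρ a u, slavedModes u, fun n => ?_, fun n j => hu (.inr (.inr (n, j))), ?_,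
    fun n => by rw [← hfix3 n 1, if_pos rfl], fun n => ?_, fun n j hj => ?_⟩
  · rw [amplitude, abs_mul, abs_of_pos hρ, hL]
    have h1 := hu (.inl n)
    simp only [breatherWeight] at h1
    have h2 : η * κ * exp (-(κ * n / 2)) ≤ 1 * κ * exp (-(κ * n / 2)) := by
      have : η ≤ 1 := by linarith
      exact mul_le_mul_of_nonneg_right (mul_le_mul_of_nonneg_right this hκ0.le) (exp_pos _).le
    have h3 := abs_add_le (a n) (u (.inl n))
    have h4 : |a n + u (.inl n)| ≤ (Ka + 1) * κ * exp (-(κ * n / 2)) := by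
      linarith only [h1, h2, h3, hab n]
    calc _ ≤ ρ * ((Ka + 1) * κ * exp (-(κ * n / 2))) := mul_le_mul_of_nonneg_left h4 hρ.le
      _ = _ := by ring
  · have h1 := hu (.inl 0)
    simp only [breatherWeight, Nat.cast_zero, mul_zero, zero_div, neg_zero, exp_zero, mul_one] at h1
    have h2 : η * κ ≤ 1 / 4 * κ := mul_le_mul_of_nonneg_right (by linarith) hκ0.le
    have h3 := (abs_le.1 h1).1
    exact (mul_pos hρ (by linarith only [ha0, h2, h3, hκ0])).ne'
  · have h1 := (hG _ _ (hbdd u hu) n).2.2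
    have h2 := hrec n
    rw [hfix1, hfix1, hfix1] at h1
    have ha' : ∀ n, solitonProfile κ (halfPos c n) = a n := fun n => by rw [ha]
    rw [solitonPotential] at h1
    simp only [ha'] at h1 h2
    rw [resonantForce, cubicDefect] at h1
    have hpos : (1 : ℝ) + a n ^ 2 ≠ 0 := by positivity
    have e : 2 * cosh κ * a n ^ 3 / (1 + a n ^ 2) = 2 * cosh κ * a n - 2 * cosh κ * a n / (1 + a n ^ 2) := by
      field_simp
      ring
    have h4 : amplitude ρ a u (n + 1) + amplitude ρ a u (prevIdx c n) =
        ρ * ((a (n + 1) + a (prevIdx c n)) + (u (.inl (n + 1)) + u (.inl (prevIdx c n)))) := by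
      simp only [amplitude]; ring
    have h5 : u (.inl (n + 1)) + u (.inl (prevIdx c n)) = 2 * cosh κ * u (.inl n) -
        2 * (a n + u (.inl n)) ^ 3 + (2 * cosh κ * a n - 2 * cosh κ * a n / (1 + a n ^ 2)) -
        O / ρ * Rc (amplitude ρ a u n) (slavedModes u n) := by
      rw [e] at h1
      linear_combination h1
    rw [h4, h2, h5]
    have h6 : ρ * (O / ρ * Rc (amplitude ρ a u n) (slavedModes u n)) =
        O * Rc (amplitude ρ a u n) (slavedModes u n) := by
      field_simp
    have h7 : 2 / ρ ^ 2 * amplitude ρ a u n ^ 3 = ρ * (2 * (a n + u (.inl n)) ^ 3) := by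
      rw [amplitude]
      field_simp
    rw [h7, ← h6, show amplitude ρ a u n = ρ * (a n + u (.inl n)) from rfl]
    ring
  · have h1 := hfix3 n j
    rw [if_neg hj] at h1
    have hD : modeSymbol O (2 * cosh κ - 2) j ≠ 0 := by
      have := (le_abs_modeSymbol hO hμ0 hj).1
      exact abs_pos.1 (by linarith)
    rw [← h1, mul_inv_cancel_left₀ hD, slavedForce, hflux,
      fluxDiv_eq hc (fun n => amplitude ρ a u n ^ 2), neighbourSum]

end

section

open Filter Topology Set MeasureTheory Real

theorem summable_one_div_one_add_sq : Summable fun j : ℕ => 1 / (1 + (j : ℝ) ^ 2) := by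
  refine Summable.of_norm_bounded_eventually_nat
    (Real.summable_one_div_nat_pow.2 one_lt_two) (eventually_atTop.2 ⟨1, fun j hj => ?_⟩)
  have hj' : (0 : ℝ) < j := by exact_mod_cast hj
  rw [Real.norm_of_nonneg (by positivity)]
  exact one_div_le_one_div_of_le (by positivity) (by linarith)

theorem summable_and_abs_cosSeries_le {z : ℕ → ℝ} {ζ : ℝ}
    (hz : ∀ j : ℕ, |z j| ≤ ζ / (1 + (j : ℝ) ^ 2)) :
    (Summable fun j => |z j|) ∧
      ∀ τ, |cosSeries z τ| ≤ (∑' j : ℕ, 1 / (1 + (j : ℝ) ^ 2)) * ζ := by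
  have hs : Summable fun j : ℕ => ζ / (1 + (j : ℝ) ^ 2) := by
    simpa [div_eq_mul_inv] using summable_one_div_one_add_sq.mul_left ζ
  have hz' : Summable fun j => |z j| := Summable.of_nonneg_of_le (fun j => abs_nonneg _) hz hs
  refine ⟨hz', fun τ => (abs_cosSeries_le hz' τ).trans ((hz'.tsum_le_tsum hz hs).trans (le_of_eq ?_))⟩
  rw [mul_comm, ← tsum_mul_left]
  simp [div_eq_mul_inv]

/-- The time profile with resonant amplitude `A` and slaved modes `z`. -/
noncomputable def breatherProfile (p₀ p₂ A : ℝ) (z : ℕ → ℝ) (τ : ℝ) : ℝ :=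
  breatherAnsatz p₀ p₂ A (cosSeries z τ) (cos τ)

noncomputable def remainderMode (W : ℝ → ℝ) (α p₀ p₂ A : ℝ) (z : ℕ → ℝ) (j : ℕ) : ℝ :=
  cosCoeff j fun τ => forceRemainder W α p₀ p₂ A (cosSeries z τ) (cos τ)

noncomputable def resonantRemainder (W : ℝ → ℝ) (α β p₀ p₂ A : ℝ) (z : ℕ → ℝ) : ℝ :=
  cosCoeff 1 fun τ => forceRemainderCubic W α β p₀ p₂ A (cosSeries z τ) (cos τ)

theorem continuous_forceRemainder {W : ℝ → ℝ} (hWc : Continuous W) (α p₀ p₂ A : ℝ) {s : ℝ → ℝ}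
    (hs : Continuous s) : Continuous fun τ => forceRemainder W α p₀ p₂ A (s τ) (cos τ) := by
  unfold forceRemainder breatherAnsatz
  fun_prop

theorem continuous_forceRemainderCubic {W : ℝ → ℝ} (hWc : Continuous W) (α β p₀ p₂ A : ℝ)
    {s : ℝ → ℝ} (hs : Continuous s) :
    Continuous fun τ => forceRemainderCubic W α β p₀ p₂ A (s τ) (cos τ) := by
  have := continuous_forceRemainder hWc α p₀ p₂ A hs
  unfold forceRemainderCubic
  fun_prop

@[simp] theorem cosSeries_zero (τ : ℝ) : cosSeries 0 τ = 0 := by simp [cosSeries]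

@[simp] theorem cosCoeff_zero (j : ℕ) : cosCoeff j (fun _ => 0) = 0 := by simp [cosCoeff]

theorem exists_remainderBounds (W : ℝ → ℝ) (hWc : Continuous W) (hW0 : W 0 = 0) (α β p₀ p₂ : ℝ)
    {r C : ℝ} (hr : 0 < r) (hC : 0 < C)
    (hW : ∀ e ≤ r, ∀ y y' : ℝ, |y| ≤ e → |y'| ≤ e →
      |(W y - y - α / 2 * y ^ 2 - β / 6 * y ^ 3) - (W y' - y' - α / 2 * y' ^ 2 - β / 6 * y' ^ 3)|
        ≤ C * e ^ 3 * |y - y'|) :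
    ∃ K > (0 : ℝ), ∃ e₀ > (0 : ℝ), ∃ S > (0 : ℝ),
      RemainderBounds (remainderMode W α p₀ p₂) (resonantRemainder W α β p₀ p₂) K e₀ S ∧
      ∀ (e ζ A : ℝ) (z : ℕ → ℝ), e ≤ e₀ → S * ζ ≤ e ^ 2 → |A| ≤ e →
        (∀ j : ℕ, |z j| ≤ ζ / (1 + (j : ℝ) ^ 2)) →
        (Summable fun j => |z j|) ∧ ∀ τ, |breatherProfile p₀ p₂ A z τ| ≤ r ∧
          |cosSeries z τ| ≤ S * ζ := by
  obtain ⟨K, hK, e₀, he₀, hF⟩ := exists_lipschitz_forceRemainderCubic W α β p₀ p₂ hr hC hW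
  obtain ⟨S, hS⟩ : ∃ S, S = ∑' j : ℕ, 1 / (1 + (j : ℝ) ^ 2) := ⟨_, rfl⟩
  have hS0 : 0 < S := by
    rw [hS]
    exact summable_one_div_one_add_sq.tsum_pos (fun j => by positivity) 0 (by norm_num)
  refine ⟨2 * K * (1 + S), by positivity, e₀, he₀, S, hS0, ⟨?_, fun j => ?_, ?_⟩, ?_⟩
  · intro e ζ Z A A' z z' he hζ hA hA' hz hz' hzz
    obtain ⟨hs, hb⟩ := summable_and_abs_cosSeries_le hz
    obtain ⟨hs', hb'⟩ := summable_and_abs_cosSeries_le hz'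
    obtain ⟨-, hbb⟩ := summable_and_abs_cosSeries_le hzz
    rw [← hS] at hb hb' hbb
    have hc := continuous_cosSeries hs
    have hc' := continuous_cosSeries hs'
    have he0 : 0 ≤ e := (abs_nonneg _).trans hA
    have hZ0 : 0 ≤ Z := by
      have := (abs_nonneg _).trans (hzz 0)
      simpa using this
    have hζ0 : 0 ≤ ζ := by
      have := (abs_nonneg _).trans (hz 0)
      simpa using this
    have hd : ∀ τ, |cosSeries z τ - cosSeries z' τ| ≤ S * Z := fun τ => by
      rw [cosSeries_sub hs hs']; exact hbb τ
    have hp : ∀ τ, _ := fun τ => hF e (S * ζ) (cos τ) A A' (cosSeries z τ) (cosSeries z' τ) he hζ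
      (abs_cos_le_one τ) hA hA' (hb τ) (hb' τ)
    have hx : 0 ≤ |A - A'| := abs_nonneg _
    constructor
    · intro j
      rw [remainderMode, remainderMode, ← cosCoeff_sub (continuous_forceRemainder hWc α p₀ p₂ A hc)
        (continuous_forceRemainder hWc α p₀ p₂ A' hc')]
      have hpt : ∀ τ, |forceRemainder W α p₀ p₂ A (cosSeries z τ) (cos τ) -
          forceRemainder W α p₀ p₂ A' (cosSeries z' τ) (cos τ)| ≤
          K * (e ^ 2 * |A - A'| + e * (S * Z)) := fun τ =>
        (hp τ).2.1.trans (by gcongr; exact hd τ)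
      refine (abs_cosCoeff_le hpt j).trans ?_
      have h1 : 0 ≤ K * (S * (e ^ 2 * |A - A'|)) := by positivity
      have h2 : 0 ≤ K * (e * Z) := by positivity
      linarith only [h1, h2]
    · rw [resonantRemainder, resonantRemainder,
        ← cosCoeff_sub (continuous_forceRemainderCubic hWc α β p₀ p₂ A hc)
        (continuous_forceRemainderCubic hWc α β p₀ p₂ A' hc')]
      have hpt : ∀ τ, |forceRemainderCubic W α β p₀ p₂ A (cosSeries z τ) (cos τ) -
          forceRemainderCubic W α β p₀ p₂ A' (cosSeries z' τ) (cos τ)| ≤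
          K * ((e ^ 3 + S * ζ) * |A - A'| + e * (S * Z)) := fun τ =>
        (hp τ).1.trans (by gcongr; exact hd τ)
      refine (abs_cosCoeff_le hpt 1).trans ?_
      have h1 : 0 ≤ K * (S * (e ^ 3 * |A - A'|)) := by positivity
      have h2 : 0 ≤ K * (e * Z) := by positivity
      have h3 : 0 ≤ K * (ζ * |A - A'|) := by positivity
      linarith only [h1, h2, h3]
  · simp [remainderMode, forceRemainder_zero hW0]
  · simp [resonantRemainder, forceRemainderCubic_zero hW0]
  · intro e ζ A z he hζ hA hz
    obtain ⟨hs, hb⟩ := summable_and_abs_cosSeries_le hz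
    rw [← hS] at hb
    exact ⟨hs, fun τ => ⟨(hF e (S * ζ) (cos τ) A A (cosSeries z τ) (cosSeries z τ) he hζ
      (abs_cos_le_one τ) hA hA (hb τ) (hb τ)).2.2, hb τ⟩⟩

/-- The cosine coefficients of `breatherProfile`. -/
noncomputable def profileCoeff (p₀ p₂ A : ℝ) (z : ℕ → ℝ) (j : ℕ) : ℝ :=
  z j + ((if j = 1 then A else 0) + A ^ 2 * quadraticCoeff p₀ p₂ j)

theorem summable_abs_and_cosSeries_of_support {c : ℕ → ℝ} (h : ∀ j, 3 ≤ j → c j = 0) :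
    (Summable fun j => |c j|) ∧ ∀ τ, cosSeries c τ = c 0 + c 1 * cos τ + c 2 * cos (2 * τ) := by
  have hz : ∀ j ∉ Finset.range 3, c j = 0 := fun j hj => h j (by simpa using hj)
  refine ⟨summable_of_ne_finset_zero (s := Finset.range 3) fun j hj => by rw [hz j hj, abs_zero],
    fun τ => ?_⟩
  rw [cosSeries, tsum_eq_sum (s := Finset.range 3) fun j hj => by rw [hz j hj, zero_mul]]
  simp [Finset.sum_range_succ]

theorem breatherProfile_eq_cosSeries (p₀ p₂ A : ℝ) {z : ℕ → ℝ} (hz : Summable fun j => |z j|) :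
    (Summable fun j => |profileCoeff p₀ p₂ A z j|) ∧
      breatherProfile p₀ p₂ A z = cosSeries (profileCoeff p₀ p₂ A z) := by
  obtain ⟨hs, he⟩ := summable_abs_and_cosSeries_of_support
    (c := fun j => (if j = 1 then A else 0) + A ^ 2 * quadraticCoeff p₀ p₂ j) (fun j hj => by
      simp [quadraticCoeff, show j ≠ 0 by omega, show j ≠ 1 by omega, show j ≠ 2 by omega])
  refine ⟨Summable.of_nonneg_of_le (fun j => abs_nonneg _) (fun j => abs_add_le _ _) (hz.add hs), ?_⟩
  funext τ
  refine Eq.trans ?_ (cosSeries_add hz hs τ)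
  rw [he, cos_two_mul]
  simp [breatherProfile, breatherAnsatz, quadraticCoeff]
  ring

theorem cosCoeff_force {W : ℝ → ℝ} (hWc : Continuous W) (α p₀ p₂ A : ℝ) {z : ℕ → ℝ}
    (hz : Summable fun j => |z j|) (j : ℕ) :
    cosCoeff j (fun τ => W (breatherProfile p₀ p₂ A z τ)) = remainderMode W α p₀ p₂ A z j +
      profileCoeff p₀ p₂ A z j + α / 4 * A ^ 2 * quadraticCoeff 1 1 j := by
  obtain ⟨hs, he⟩ := summable_abs_and_cosSeries_of_support (c := quadraticCoeff 1 1) (fun j hj => by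
      simp [quadraticCoeff, show j ≠ 0 by omega, show j ≠ 2 by omega])
  obtain ⟨hp, hpe⟩ := breatherProfile_eq_cosSeries p₀ p₂ A hz
  have h1 := continuous_forceRemainder hWc α p₀ p₂ A (continuous_cosSeries hz)
  have h2 := continuous_cosSeries hp
  have h3 := continuous_cosSeries hs
  have hfun : (fun τ => W (breatherProfile p₀ p₂ A z τ)) = fun τ =>
      (forceRemainder W α p₀ p₂ A (cosSeries z τ) (cos τ) + cosSeries (profileCoeff p₀ p₂ A z) τ) +
        α / 4 * A ^ 2 * cosSeries (quadraticCoeff 1 1) τ := by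
    funext τ
    rw [← hpe, he, cos_two_mul]
    simp [forceRemainder, breatherProfile, quadraticCoeff]
    ring
  rw [hfun, cosCoeff_add (by fun_prop) (by fun_prop), cosCoeff_add h1 h2, cosCoeff_const_mul,
    cosCoeff_cosSeries hp, cosCoeff_cosSeries hs, remainderMode]

theorem remainderMode_one {W : ℝ → ℝ} (hWc : Continuous W) (α β p₀ p₂ A : ℝ) {z : ℕ → ℝ}
    (hz : Summable fun j => |z j|) :
    remainderMode W α p₀ p₂ A z 1 = resonantRemainder W α β p₀ p₂ A z +
      A ^ 3 * (α * (p₀ + p₂ / 2) + β / 8) := by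
  have h1 := continuous_forceRemainderCubic hWc α β p₀ p₂ A (continuous_cosSeries hz)
  have hfun : (fun τ => forceRemainder W α p₀ p₂ A (cosSeries z τ) (cos τ)) = fun τ =>
      forceRemainderCubic W α β p₀ p₂ A (cosSeries z τ) (cos τ) +
        (A ^ 3 * (α * (p₀ + p₂ / 2) + β / 8) * cos ((1 : ℕ) * τ) +
          A ^ 3 * (α * p₂ / 2 + β / 24) * cos ((3 : ℕ) * τ)) := by
    funext τ
    push_cast
    rw [cos_three_mul, one_mul, forceRemainderCubic]
    ring
  rw [remainderMode, hfun, cosCoeff_add h1 (by fun_prop), cosCoeff_add (by fun_prop) (by fun_prop),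
    cosCoeff_const_mul, cosCoeff_const_mul, cosCoeff_cos, cosCoeff_cos, resonantRemainder]
  simp

/-- The amplitude equations imply the equation of motion in rescaled time. -/
theorem breatherProfile_equation {W : ℝ → ℝ} (hWc : Continuous W) {α β p₀ p₂ O μ γ : ℝ} (hO : 0 < O)
    (hμ : 0 ≤ μ) (hp₀ : p₀ = -α / 4) (hp₂ : p₂ = O * α / (4 * (3 * O + 16)))
    (hγ : γ = O * (α * (p₀ + p₂ / 2) + β / 8)) {A A₁ A₂ : ℝ} {z z₁ z₂ : ℕ → ℝ}
    (hz : Summable fun j => |z j|) (hz₁ : Summable fun j => |z₁ j|) (hz₂ : Summable fun j => |z₂ j|)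
    (h0 : z 1 = 0) (h0₁ : z₁ 1 = 0) (h0₂ : z₂ 1 = 0)
    (hres : A₁ + A₂ = (2 + μ) * A - γ * A ^ 3 - O * resonantRemainder W α β p₀ p₂ A z)
    (hmode : ∀ j, j ≠ 1 → modeSymbol O μ j * z j = (-1) ^ j * (z₁ j + z₂ j) +
      (quadraticCoeff p₀ p₂ j * (A₁ ^ 2 + A₂ ^ 2 - 2 * A ^ 2) +
        (if j = 2 then 4 * μ * p₂ * A ^ 2 else 0) - O * remainderMode W α p₀ p₂ A z j)) :
    ContDiff ℝ 2 (breatherProfile p₀ p₂ A z) ∧ ∀ τ,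
      (O + 4 + μ) * deriv (deriv (breatherProfile p₀ p₂ A z)) τ =
        breatherProfile p₀ p₂ A₁ z₁ (τ + π) + breatherProfile p₀ p₂ A₂ z₂ (τ + π) -
          2 * breatherProfile p₀ p₂ A z τ - O * W (breatherProfile p₀ p₂ A z τ) := by
  obtain ⟨hs, he⟩ := breatherProfile_eq_cosSeries p₀ p₂ A hz
  obtain ⟨hs₁, he₁⟩ := breatherProfile_eq_cosSeries p₀ p₂ A₁ hz₁
  obtain ⟨hs₂, he₂⟩ := breatherProfile_eq_cosSeries p₀ p₂ A₂ hz₂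
  have hforce := cosCoeff_force hWc α p₀ p₂ A hz
  have hO2 : O + 4 + μ ≠ 0 := by positivity
  have hsg : ∀ c : ℕ → ℝ, (Summable fun j => |c j|) → Summable fun j => |(-1) ^ j * c j| := by
    intro c hc
    simpa [abs_mul] using hc
  have hc := continuous_cosSeries hs
  have hc₁ := continuous_cosSeries (hsg _ hs₁)
  have hc₂ := continuous_cosSeries (hsg _ hs₂)
  rw [he] at hforce ⊢
  rw [he₁, he₂]
  have hWy : Continuous fun τ => W (cosSeries (profileCoeff p₀ p₂ A z) τ) := hWc.comp hc
  have hcd := contDiff_cosSeries_of_cosCoeff_eq hs (h := fun τ => (O + 4 + μ)⁻¹ *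
    ((cosSeries (fun j => (-1) ^ j * profileCoeff p₀ p₂ A₁ z₁ j) τ +
      cosSeries (fun j => (-1) ^ j * profileCoeff p₀ p₂ A₂ z₂ j) τ) -
      (2 * cosSeries (profileCoeff p₀ p₂ A z) τ + O * W (cosSeries (profileCoeff p₀ p₂ A z) τ))))
    (by fun_prop) (fun τ => by simp only [cosSeries_neg])
    (fun τ => by simp only [cosSeries_add_two_pi]) ?_
  · refine ⟨hcd.1, fun τ => ?_⟩
    rw [hcd.2, mul_inv_cancel_left₀ hO2, cosSeries_add_pi, cosSeries_add_pi]
    ring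
  · intro j
    rw [cosCoeff_const_mul, cosCoeff_sub (by fun_prop) (by fun_prop),
      cosCoeff_add hc₁ hc₂, cosCoeff_add (by fun_prop) (by fun_prop), cosCoeff_const_mul,
      cosCoeff_const_mul, cosCoeff_cosSeries hs, cosCoeff_cosSeries (hsg _ hs₁),
      cosCoeff_cosSeries (hsg _ hs₂), hforce, eq_inv_mul_iff_mul_eq₀ hO2]
    rcases eq_or_ne j 1 with rfl | hj
    · rw [remainderMode_one hWc α β p₀ p₂ A hz]
      simp only [profileCoeff, quadraticCoeff, h0, h0₁, h0₂]
      norm_num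
      linear_combination hres - A ^ 3 * hγ
    · have h := hmode j hj
      have hp2 : (4 * (3 * O + 16)) * p₂ = O * α := by rw [hp₂]; field_simp
      simp only [profileCoeff, if_neg hj, modeSymbol] at h ⊢
      rcases eq_or_ne j 0 with rfl | hj0
      · simp only [quadraticCoeff, if_true] at h ⊢
        norm_num at h ⊢
        linear_combination h + O * A ^ 2 * hp₀
      · rcases eq_or_ne j 2 with rfl | hj2
        · simp only [quadraticCoeff] at h ⊢
          norm_num at h ⊢
          linear_combination h - A ^ 2 / 4 * hp2
        · simp only [quadraticCoeff, if_neg hj0, if_neg hj2] at h ⊢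
          linear_combination h

end

section

open Set Real

/-- Time profiles of a breather on the half lattice, as functions of the rescaled time. -/
structure IsHalfLatticeBreather (F : ℝ → ℝ) (O κ L : ℝ) (c : ℕ) (y : ℕ → ℝ → ℝ) : Prop where
  contDiff : ∀ n, ContDiff ℝ 2 (y n)
  equation : ∀ n τ, (O + 2 + 2 * cosh κ) * deriv (deriv (y n)) τ =
    y (n + 1) (τ + π) + y (prevIdx c n) (τ + π) - 2 * y n τ - O * F (y n τ)
  even : ∀ n τ, y n (-τ) = y n τ
  periodic : ∀ n, Function.Periodic (y n) (2 * π)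
  abs_le : ∀ (n : ℕ) τ, |y n τ| ≤ L * κ * exp (-(κ * n / 2))
  ne_zero : ∃ τ, y 0 τ ≠ 0

theorem exists_isHalfLatticeBreather (V : ℝ → ℝ)
    (hV : ∃ r > (0 : ℝ), ContDiffOn ℝ 6 V (Metric.ball 0 r)) (hV1 : deriv V 0 = 0)
    (hV2 : iteratedDeriv 2 V 0 = 1) {O : ℝ} (hO : 0 < O)
    (hγ : 0 < 3 * O * (iteratedDeriv 4 V 0 - 5 / 3 * iteratedDeriv 3 V 0 ^ 2) +
      16 * (iteratedDeriv 4 V 0 - 2 * iteratedDeriv 3 V 0 ^ 2)) :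
    ∃ L > (0 : ℝ), ∃ κ₀ > (0 : ℝ), ∀ κ, 0 < κ → κ ≤ κ₀ → κ ≤ 1 ∧ ∀ c : ℕ, c ≤ 1 →
      ∃ y, IsHalfLatticeBreather (deriv V) O κ L c y := by
  obtain ⟨r, hr, C, hC, hcont, hT⟩ := exists_lipschitz_taylor_deriv V hV hV2
  obtain ⟨α, hα⟩ : ∃ α, α = iteratedDeriv 3 V 0 := ⟨_, rfl⟩
  obtain ⟨β, hβ⟩ : ∃ β, β = iteratedDeriv 4 V 0 := ⟨_, rfl⟩
  rw [← hα, ← hβ] at hγ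
  simp only [← hα, ← hβ] at hT
  obtain ⟨W, hWdef⟩ : ∃ W : ℝ → ℝ, W = fun y => deriv V (max (-r) (min y r)) := ⟨_, rfl⟩
  have hWc : Continuous W := hWdef ▸ hcont.comp_continuous (by fun_prop) fun y =>
    ⟨le_max_left _ _, max_le (by linarith) (min_le_right _ _)⟩
  have hWeq : ∀ y, |y| ≤ r → W y = deriv V y := fun y hy => by
    rw [hWdef]
    simp only [min_eq_left (abs_le.1 hy).2, max_eq_right (abs_le.1 hy).1]
  have hW0 : W 0 = 0 := by rw [hWeq 0 (by simpa using hr.le), hV1]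
  have hW : ∀ e ≤ r, ∀ y y' : ℝ, |y| ≤ e → |y'| ≤ e →
      |(W y - y - α / 2 * y ^ 2 - β / 6 * y ^ 3) - (W y' - y' - α / 2 * y' ^ 2 - β / 6 * y' ^ 3)|
        ≤ C * e ^ 3 * |y - y'| := fun e he y y' hy hy' => by
    rw [hWeq y (hy.trans he), hWeq y' (hy'.trans he)]
    exact hT e he y y' hy hy'
  obtain ⟨p₀, hp₀⟩ : ∃ p₀, p₀ = -α / 4 := ⟨_, rfl⟩
  obtain ⟨p₂, hp₂⟩ : ∃ p₂, p₂ = O * α / (4 * (3 * O + 16)) := ⟨_, rfl⟩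
  obtain ⟨γ, hγd⟩ : ∃ γ, γ = O * (α * (p₀ + p₂ / 2) + β / 8) := ⟨_, rfl⟩
  have hγ0 : 0 < γ := by
    have : γ = O / 8 * (3 * O * (β - 5 / 3 * α ^ 2) + 16 * (β - 2 * α ^ 2)) / (3 * O + 16) := by
      rw [hγd, hp₀, hp₂]; field_simp; ring
    rw [this]; positivity
  obtain ⟨ρ, hρ⟩ : ∃ ρ, ρ = √(2 / γ) := ⟨_, rfl⟩
  have hρ0 : 0 < ρ := hρ ▸ sqrt_pos.2 (by positivity)
  have hργ : 2 / ρ ^ 2 = γ := by rw [hρ, sq_sqrt (by positivity)]; field_simp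
  obtain ⟨K, hK, e₀, he₀, S, hS, hb, hprof⟩ :=
    exists_remainderBounds W hWc hW0 α β p₀ p₂ hr hC hW
  obtain ⟨L, hL, η, hη, κ₀, hκ₀, hSη, hex⟩ := hb.exists_amplitudes hK he₀ hS hρ0 hO p₀ p₂
  refine ⟨L + L ^ 2 * (|p₀| + |p₂|) + L ^ 2, by positivity, κ₀, hκ₀, fun κ hκ0 hκ => ?_⟩
  obtain ⟨hκ1, hκe, hex⟩ := hex κ hκ0 hκ
  refine ⟨hκ1, fun c hc => ?_⟩
  obtain ⟨A, z, hA, hz, hA0, hz1, hres, hmode⟩ := hex c hc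
  have hw1 : ∀ n : ℕ, exp (-(κ * n / 2)) ≤ 1 := fun n => exp_le_one_iff.2 (by
    have : 0 ≤ κ * n / 2 := by positivity
    linarith)
  have hA' : ∀ n, |A n| ≤ L * κ := fun n =>
    (hA n).trans (mul_le_of_le_one_right (by positivity) (hw1 n))
  have hSz : ∀ n : ℕ, S * (η ^ 2 * κ ^ 2 * exp (-(κ * n / 2))) ≤
      L ^ 2 * κ ^ 2 * exp (-(κ * n / 2)) := fun n => by
    have := mul_le_mul_of_nonneg_right hSη (by positivity : 0 ≤ κ ^ 2 * exp (-(κ * n / 2)))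
    linarith only [this]
  have hpr := fun n => hprof (L * κ) _ (A n) (z n) hκe ((hSz n).trans (by
    rw [mul_pow]; exact mul_le_of_le_one_right (by positivity) (hw1 n))) (hA' n) (hz n)
  have hμ0 : 0 ≤ 2 * cosh κ - 2 := by linarith only [one_le_cosh κ]
  have heq := fun n => breatherProfile_equation hWc hO hμ0 hp₀ hp₂ hγd (hpr n).1 (hpr (n + 1)).1
    (hpr (prevIdx c n)).1 (hz1 n) (hz1 _) (hz1 _) (by rw [hres, hργ]; ring) (hmode n)
  refine ⟨fun n => breatherProfile p₀ p₂ (A n) (z n), fun n => (heq n).1, fun n τ => ?_,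
    fun n τ => ?_, fun n τ => ?_, fun n τ => ?_, ?_⟩
  · rw [← hWeq _ ((hpr n).2 τ).1, ← (heq n).2 τ]
    ring
  · simp only [breatherProfile, cosSeries_neg, cos_neg]
  · simp only [breatherProfile, cosSeries_add_two_pi, cos_add_two_pi]
  · have hw := hw1 n
    have hAn := hA n
    have hAn' := hA' n
    have hs := ((hpr n).2 τ).2.trans (hSz n)
    obtain ⟨w, hwd⟩ : ∃ w, w = exp (-(κ * n / 2)) := ⟨_, rfl⟩
    have hw0 : 0 < w := hwd ▸ exp_pos _
    rw [← hwd] at hw hAn hs ⊢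
    have h1 : |A n * cos τ| ≤ L * κ * w := by
      rw [abs_mul]
      exact (mul_le_of_le_one_right (abs_nonneg _) (abs_cos_le_one τ)).trans hAn
    have h2 : |p₀ + p₂ * (2 * cos τ ^ 2 - 1)| ≤ |p₀| + |p₂| := by
      refine (abs_add_le _ _).trans (add_le_add_right ?_ _)
      rw [abs_mul, ← cos_two_mul]
      exact mul_le_of_le_one_right (abs_nonneg _) (abs_cos_le_one _)
    have h3 : A n ^ 2 ≤ L ^ 2 * κ * w := by
      rw [← sq_abs, pow_two]
      calc |A n| * |A n| ≤ (L * κ * w) * (L * κ) := by gcongr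
        _ = L ^ 2 * κ * w * κ := by ring
        _ ≤ L ^ 2 * κ * w := mul_le_of_le_one_right (by positivity) hκ1
    have h4 : |A n ^ 2 * (p₀ + p₂ * (2 * cos τ ^ 2 - 1))| ≤ L ^ 2 * κ * w * (|p₀| + |p₂|) := by
      rw [abs_mul, abs_of_nonneg (sq_nonneg _)]
      gcongr
    have h5 : L ^ 2 * κ ^ 2 * w ≤ L ^ 2 * κ * w := by
      calc L ^ 2 * κ ^ 2 * w = L ^ 2 * κ * w * κ := by ring
        _ ≤ _ := mul_le_of_le_one_right (by positivity) hκ1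
    rw [breatherProfile, breatherAnsatz]
    refine (abs_add_three _ _ _).trans ?_
    linarith only [h1, h4, h5, hs]
  · by_contra! hcon
    obtain ⟨hs, he⟩ := breatherProfile_eq_cosSeries p₀ p₂ (A 0) (hpr 0).1
    have h1 := cosCoeff_cosSeries hs 1
    rw [← he, show breatherProfile p₀ p₂ (A 0) (z 0) = fun _ => 0 from funext hcon] at h1
    simp [profileCoeff, hz1, quadraticCoeff] at h1
    exact hA0 h1.symm

/-- Distance to the centre of a site-centred (`c = 0`) or bond-centred (`c = 1`) breather. -/
def siteIdx (c : ℕ) (N : ℤ) : ℕ := if 1 ≤ N then (N - c).toNat else (-N).toNat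

theorem siteIdx_neighbours {c : ℕ} (hc : c ≤ 1) (f : ℕ → ℝ) (N : ℤ) :
    f (siteIdx c (N + 1)) + f (siteIdx c (N - 1)) =
      f (siteIdx c N + 1) + f (prevIdx c (siteIdx c N)) := by
  rcases lt_or_ge N 1 with hN | hN
  · have h1 : siteIdx c (N - 1) = siteIdx c N + 1 := by
      simp only [siteIdx]; split_ifs <;> omega
    have h2 : siteIdx c (N + 1) = prevIdx c (siteIdx c N) := by
      simp only [siteIdx, prevIdx]; split_ifs <;> omega
    rw [h1, h2, add_comm]
  · have h1 : siteIdx c (N + 1) = siteIdx c N + 1 := by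
      simp only [siteIdx]; split_ifs <;> omega
    have h2 : siteIdx c (N - 1) = prevIdx c (siteIdx c N) := by
      simp only [siteIdx, prevIdx]; split_ifs <;> omega
    rw [h1, h2]

theorem siteIdx_reflect {c : ℕ} (hc : c ≤ 1) (N : ℤ) : siteIdx c (-N + c) = siteIdx c N := by
  simp only [siteIdx]; split_ifs <;> omega

theorem abs_le_siteIdx_add_one {c : ℕ} (hc : c ≤ 1) (N : ℤ) : |N| ≤ siteIdx c N + 1 := by
  rcases abs_cases N with h | h <;> simp only [siteIdx] <;> split_ifs <;> omega

/-- The displacement field on the whole lattice in the original time. -/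
noncomputable def latticeField (a ω : ℝ) (c : ℕ) (y : ℕ → ℝ → ℝ) (N : ℤ) (t : ℝ) : ℝ :=
  a⁻¹ * y (siteIdx c N) (ω * t + N * π)

namespace IsHalfLatticeBreather

variable {F : ℝ → ℝ} {O κ L a ω : ℝ} {c : ℕ} {y : ℕ → ℝ → ℝ}

theorem add_int_mul_two_pi (hy : IsHalfLatticeBreather F O κ L c y) (n : ℕ) (τ : ℝ) (k : ℤ) :
    y n (τ + k * (2 * π)) = y n τ := (hy.periodic n).int_mul k τ

theorem latticeField_contDiff (hy : IsHalfLatticeBreather F O κ L c y) (N : ℤ) :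
    ContDiff ℝ 2 (latticeField a ω c y N) :=
  contDiff_const.mul ((hy.contDiff _).comp (by fun_prop))

theorem deriv_deriv_latticeField (hy : IsHalfLatticeBreather F O κ L c y) (N : ℤ) (t : ℝ) :
    deriv (deriv (latticeField a ω c y N)) t =
      a⁻¹ * ω ^ 2 * deriv (deriv (y (siteIdx c N))) (ω * t + N * π) := by
  have hd : ∀ t : ℝ, HasDerivAt (fun t : ℝ => ω * t + N * π) ω t := fun t => by
    simpa using ((hasDerivAt_id t).const_mul ω).add_const (N * π)
  have hcd := hy.contDiff (siteIdx c N)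
  have h1 : ∀ t, HasDerivAt (latticeField a ω c y N)
      (a⁻¹ * (deriv (y (siteIdx c N)) (ω * t + N * π) * ω)) t := fun t =>
    (((hcd.differentiable (by norm_num)) _).hasDerivAt.comp t (hd t)).const_mul a⁻¹
  have hcd1 : ContDiff ℝ 1 (deriv (y (siteIdx c N))) := hcd.deriv'
  have h2 : HasDerivAt (deriv (latticeField a ω c y N))
      (a⁻¹ * (deriv (deriv (y (siteIdx c N))) (ω * t + N * π) * ω * ω)) t := by
    rw [funext fun t => (h1 t).deriv]
    exact ((((hcd1.differentiable (by norm_num)) _).hasDerivAt.comp t (hd t)).mul_const ω).const_mul a⁻¹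
  rw [h2.deriv]
  ring

theorem latticeField_equation (hy : IsHalfLatticeBreather F O κ L c y) (hc : c ≤ 1) {m d k : ℝ}
    (ha : 0 < a) (hk : 0 < k) (hO : O = a ^ 2 * d / k)
    (hω : m * ω ^ 2 = k * (O + 2 + 2 * cosh κ)) (N : ℤ) (t : ℝ) :
    m * deriv (deriv (latticeField a ω c y N)) t + d * a * F (a * latticeField a ω c y N t) =
      k * (latticeField a ω c y (N + 1) t - 2 * latticeField a ω c y N t +
        latticeField a ω c y (N - 1) t) := by
  have h1 := hy.equation (siteIdx c N) (ω * t + N * π)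
  rw [← siteIdx_neighbours hc (fun n => y n (ω * t + N * π + π))] at h1
  have e1 : latticeField a ω c y (N + 1) t = a⁻¹ * y (siteIdx c (N + 1)) (ω * t + N * π + π) := by
    rw [latticeField]; push_cast; ring_nf
  have e2 : latticeField a ω c y (N - 1) t = a⁻¹ * y (siteIdx c (N - 1)) (ω * t + N * π + π) := by
    rw [latticeField, ← hy.add_int_mul_two_pi _ _ 1]; push_cast; ring_nf
  have e3 : a * latticeField a ω c y N t = y (siteIdx c N) (ω * t + N * π) := by
    rw [latticeField, mul_inv_cancel_left₀ ha.ne']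
  have e4 : d * a = k * a⁻¹ * O := by rw [hO]; field_simp
  rw [e3, e1, e2, hy.deriv_deriv_latticeField, e4, latticeField]
  linear_combination k * a⁻¹ * h1 +
    a⁻¹ * deriv (deriv (y (siteIdx c N))) (ω * t + N * π) * hω

theorem latticeField_periodic (hy : IsHalfLatticeBreather F O κ L c y) (hω : ω ≠ 0) (N : ℤ) :
    Function.Periodic (latticeField a ω c y N) (2 * π / ω) := fun t => by
  rw [latticeField, latticeField, ← hy.periodic _ (ω * t + N * π)]
  congr 2
  field_simp
  ring

theorem latticeField_even (hy : IsHalfLatticeBreather F O κ L c y) (N : ℤ) (t : ℝ) :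
    latticeField a ω c y N (-t) = latticeField a ω c y N t := by
  rw [latticeField, latticeField, ← hy.even, ← hy.add_int_mul_two_pi _ _ N]
  congr 2
  ring

theorem latticeField_reflect (hy : IsHalfLatticeBreather F O κ L c y) (hc : c ≤ 1) (N : ℤ) (t : ℝ) :
    latticeField a ω c y (-N + c) t = a⁻¹ * y (siteIdx c N) (ω * t + N * π + c * π) := by
  rw [latticeField, siteIdx_reflect hc, ← hy.add_int_mul_two_pi _ _ N]
  congr 2
  push_cast
  ring

theorem abs_latticeField_le (hy : IsHalfLatticeBreather F O κ L c y) (hc : c ≤ 1) (ha : 0 < a)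
    (hκ : 0 ≤ κ) (hL : 0 ≤ L) (N : ℤ) (t : ℝ) :
    |latticeField a ω c y N t| ≤ a⁻¹ * L * κ * exp (κ / 2) * exp (κ / 2) ^ (-|N|) := by
  have h1 : exp (-(κ * (siteIdx c N : ℕ) / 2)) ≤ exp (κ / 2) * exp (κ / 2) ^ (-|N|) := by
    rw [← rpow_intCast, ← exp_mul, ← exp_add]
    refine exp_le_exp.2 ?_
    have h : (|N| : ℤ) ≤ ((siteIdx c N : ℤ) + 1 : ℤ) := abs_le_siteIdx_add_one hc N
    have h' : ((|N| : ℤ) : ℝ) ≤ (siteIdx c N : ℝ) + 1 := by exact_mod_cast h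
    push_cast at h' ⊢
    have := mul_le_mul_of_nonneg_left h' hκ
    linarith only [this]
  rw [latticeField, abs_mul, abs_of_pos (inv_pos.2 ha)]
  calc _ ≤ a⁻¹ * (L * κ * exp (-(κ * (siteIdx c N : ℕ) / 2))) :=
        mul_le_mul_of_nonneg_left (hy.abs_le _ _) (inv_pos.2 ha).le
    _ ≤ a⁻¹ * (L * κ * (exp (κ / 2) * exp (κ / 2) ^ (-|N|))) :=
        mul_le_mul_of_nonneg_left (mul_le_mul_of_nonneg_left h1 (by positivity)) (inv_pos.2 ha).le
    _ = _ := by ring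

theorem latticeField_ne_zero (hy : IsHalfLatticeBreather F O κ L c y) (ha : 0 < a) (hω : ω ≠ 0) :
    ∃ N t, latticeField a ω c y N t ≠ 0 := by
  obtain ⟨τ, hτ⟩ := hy.ne_zero
  refine ⟨0, τ / ω, mul_ne_zero (inv_pos.2 ha).ne' ?_⟩
  simpa [siteIdx, mul_div_cancel₀ τ hω] using hτ

end IsHalfLatticeBreather

end

section

open Real

theorem exists_two_mul_cosh_eq {μ : ℝ} (hμ : 0 < μ) :
    ∃ κ : ℝ, 0 < κ ∧ κ ≤ √μ ∧ 2 + μ = 2 * cosh κ := by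
  have hs := sqrt_pos.2 hμ
  have hpos : 0 < arsinh (√μ / 2) := arsinh_pos_iff.2 (by positivity)
  refine ⟨2 * arsinh (√μ / 2), by positivity, ?_, ?_⟩
  · have := self_le_sinh_iff.2 hpos.le
    rw [sinh_arsinh] at this
    linarith
  · rw [cosh_two_mul, cosh_sq, sinh_arsinh, div_pow, sq_sqrt hμ.le]
    ring

/-- The relation between frequency and decay rate near the upper band edge. -/
theorem exists_decay_rate {m k O ωm κ₀ : ℝ} (hm : 0 < m) (hk : 0 < k) (hωm : 0 < ωm) (hκ₀ : 0 < κ₀)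
    (hO : m * ωm ^ 2 = k * (O + 4)) : ∃ δ > (0 : ℝ), ∃ C ≥ (1 : ℝ), ∀ ω, ωm < ω → ω < ωm + δ →
      ∃ κ, 0 < κ ∧ κ ≤ κ₀ ∧ m * ω ^ 2 = k * (O + 2 + 2 * cosh κ) ∧ κ ≤ C * √(ω - ωm) ∧
        (κ ≤ 1 → √(ω - ωm) ≤ C * κ) := by
  obtain ⟨b, hb⟩ : ∃ b, b = m / k * (2 * ωm + 1) := ⟨_, rfl⟩
  have hb0 : 0 < b := hb ▸ by positivity
  obtain ⟨b', hb'⟩ : ∃ b', b' = 2 * k / (m * ωm) := ⟨_, rfl⟩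
  have hb0' : 0 < b' := hb' ▸ by positivity
  refine ⟨min 1 (κ₀ ^ 2 / b), by positivity, 1 + √b + √b', by
    linarith [sqrt_nonneg b, sqrt_nonneg b'], fun ω h1 h2 => ?_⟩
  obtain ⟨ε, hε⟩ : ∃ ε, ε = ω - ωm := ⟨_, rfl⟩
  have hε0 : 0 < ε := by linarith
  have hε1 : ε ≤ 1 := by linarith [min_le_left 1 (κ₀ ^ 2 / b)]
  have hε2 : b * ε ≤ κ₀ ^ 2 := by
    rw [mul_comm, ← le_div_iff₀ hb0]; linarith [min_le_right 1 (κ₀ ^ 2 / b)]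
  obtain ⟨μ, hμ⟩ : ∃ μ, μ = m / k * (ε * (2 * ωm + ε)) := ⟨_, rfl⟩
  obtain ⟨κ, hκ0, hκμ, hκ⟩ := exists_two_mul_cosh_eq (μ := μ) (hμ ▸ by positivity)
  have hμb : μ ≤ b * ε := by
    rw [hμ, hb]
    calc _ ≤ m / k * (ε * (2 * ωm + 1)) := by gcongr
      _ = _ := by ring
  have hκε : κ ≤ √b * √ε := by
    rw [← sqrt_mul hb0.le]; exact hκμ.trans (sqrt_le_sqrt hμb)
  rw [← hε]
  refine ⟨κ, hκ0, ?_, ?_, ?_, fun hκ1 => ?_⟩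
  · refine hκμ.trans ?_
    rw [← sqrt_sq hκ₀.le]
    exact sqrt_le_sqrt (hμb.trans hε2)
  · rw [add_assoc, ← hκ, ← sub_eq_zero, hμ, hε]
    have : k * (m / k) = m := by field_simp
    linear_combination hO - ((ω - ωm) * (2 * ωm + (ω - ωm))) * this
  · have h3 : 0 ≤ (1 + √b') * √ε := by positivity
    linarith
  · have h4 : μ ≤ 2 * κ ^ 2 := by linarith [cosh_sub_one_le_sq hκ0.le hκ1]
    have h5 : m * ωm / k * ε ≤ μ := by
      rw [hμ]
      calc m * ωm / k * ε = m / k * (ε * ωm) := by ring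
        _ ≤ _ := by gcongr; linarith
    have h6 : ε ≤ b' * κ ^ 2 := by
      calc ε = (m * ωm / k * ε) * (b' / 2) := by rw [hb']; field_simp
        _ ≤ (2 * κ ^ 2) * (b' / 2) :=
            mul_le_mul_of_nonneg_right (h5.trans h4) (by positivity)
        _ = _ := by ring
    have h7 : √ε ≤ √b' * κ := by
      have h := sqrt_le_sqrt h6
      rwa [sqrt_mul hb0'.le, sqrt_sq hκ0.le] at h
    have h8 : 0 ≤ (1 + √b) * κ := by positivity
    linarith

end

/-- Existence of two families of small-amplitude discrete breathers with
frequencies just above the upper phonon band edge ω_max = √((a²d+4k)/m) for the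
homogeneous Klein-Gordon lattice with hard potential (h > 0), under the condition
Ω² = a²d/k > −16H/(3h). -/
theorem stmt_17 (V : ℝ → ℝ) (hV : ∃ r > (0 : ℝ), ContDiffOn ℝ 6 V (Metric.ball 0 r))
    (hV1 : deriv V 0 = 0) (hV2 : iteratedDeriv 2 V 0 = 1)
    (m d a k : ℝ) (hm : 0 < m) (hd : 0 < d) (ha : 0 < a) (hk : 0 < k)
    (hh : 0 < iteratedDeriv 4 V 0 - 5 / 3 * (iteratedDeriv 3 V 0) ^ 2)
    (hΩ : -(16 * (iteratedDeriv 4 V 0 - 2 * (iteratedDeriv 3 V 0) ^ 2)) /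
        (3 * (iteratedDeriv 4 V 0 - 5 / 3 * (iteratedDeriv 3 V 0) ^ 2)) <
      a ^ 2 * d / k) :
    let ωmax : ℝ := Real.sqrt ((a ^ 2 * d + 4 * k) / m)
    ∃ δ > (0 : ℝ), ∃ C ≥ (1 : ℝ), ∀ ω : ℝ, ωmax < ω → ω < ωmax + δ →
      ∃ x₁ x₂ : ℤ → ℝ → ℝ,
        (∃ n t, x₁ n t ≠ 0) ∧ (∃ n t, x₂ n t ≠ 0) ∧
        (∀ x : ℤ → ℝ → ℝ, x = x₁ ∨ x = x₂ →
          (∀ n : ℤ, ContDiff ℝ 2 (x n)) ∧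
          (∀ n : ℤ, ∀ t : ℝ,
            m * deriv (deriv (x n)) t + d * a * deriv V (a * x n t) =
              k * (x (n + 1) t - 2 * x n t + x (n - 1) t)) ∧
          (∀ n : ℤ, Function.Periodic (x n) (2 * Real.pi / ω)) ∧
          (∀ n : ℤ, ∀ t : ℝ, x n (-t) = x n t)) ∧
        (∀ n : ℤ, ∀ t : ℝ, x₁ (-n + 1) t = x₁ n (t + Real.pi / ω)) ∧
        (∀ n : ℤ, x₂ (-n) = x₂ n) ∧
        ∃ σ : ℝ, 1 < σ ∧
          (∀ x : ℤ → ℝ → ℝ, x = x₁ ∨ x = x₂ → ∀ n : ℤ, ∀ t : ℝ,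
            |x n t| ≤ C * Real.sqrt (ω - ωmax) * σ ^ (-|n|)) ∧
          C⁻¹ * Real.sqrt (ω - ωmax) ≤ σ - 1 ∧
          σ - 1 ≤ C * Real.sqrt (ω - ωmax) := by
  intro ωmax
  obtain ⟨O, hO⟩ : ∃ O, O = a ^ 2 * d / k := ⟨_, rfl⟩
  have hO0 : 0 < O := hO ▸ by positivity
  have hγ : 0 < 3 * O * (iteratedDeriv 4 V 0 - 5 / 3 * iteratedDeriv 3 V 0 ^ 2) +
      16 * (iteratedDeriv 4 V 0 - 2 * iteratedDeriv 3 V 0 ^ 2) := by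
    rw [← hO, div_lt_iff₀ (by linarith)] at hΩ
    linarith
  obtain ⟨L, hL, κ₀, hκ₀, hex⟩ := exists_isHalfLatticeBreather V hV hV1 hV2 hO0 hγ
  have hωm : 0 < ωmax := Real.sqrt_pos.2 (by positivity)
  have hωO : m * ωmax ^ 2 = k * (O + 4) := by
    rw [Real.sq_sqrt (by positivity), hO]
    field_simp
  obtain ⟨δ, hδ, C, hC, hrate⟩ := exists_decay_rate hm hk hωm hκ₀ hωO
  have hD : 0 ≤ 2 * a⁻¹ * L * C := by positivity
  refine ⟨δ, hδ, 2 * C + 2 * a⁻¹ * L * C, by linarith, fun ω h1 h2 => ?_⟩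
  obtain ⟨κ, hκ0, hκ, hω, hup, hlow⟩ := hrate ω h1 h2
  obtain ⟨hκ1, hy⟩ := hex κ hκ0 hκ
  obtain ⟨y₁, hy₁⟩ := hy 1 le_rfl
  obtain ⟨y₂, hy₂⟩ := hy 0 zero_le_one
  have hω0 : ω ≠ 0 := by linarith
  have hs : 0 ≤ Real.sqrt (ω - ωmax) := Real.sqrt_nonneg _
  have hσ := exp_sub_one_le_two_mul (κ := κ / 2) (by linarith) (by linarith)
  have hσ' := Real.add_one_le_exp (κ / 2)
  have hprop : ∀ (c : ℕ) (y : ℕ → ℝ → ℝ), c ≤ 1 → IsHalfLatticeBreather (deriv V) O κ L c y →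
      (∀ n : ℤ, ContDiff ℝ 2 (latticeField a ω c y n)) ∧
      (∀ n : ℤ, ∀ t : ℝ,
        m * deriv (deriv (latticeField a ω c y n)) t + d * a * deriv V (a * latticeField a ω c y n t) =
          k * (latticeField a ω c y (n + 1) t - 2 * latticeField a ω c y n t +
            latticeField a ω c y (n - 1) t)) ∧
      (∀ n : ℤ, Function.Periodic (latticeField a ω c y n) (2 * Real.pi / ω)) ∧
      (∀ n : ℤ, ∀ t : ℝ, latticeField a ω c y n (-t) = latticeField a ω c y n t) :=
    fun c y hc h => ⟨h.latticeField_contDiff, h.latticeField_equation hc ha hk hO hω,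
      h.latticeField_periodic hω0, h.latticeField_even⟩
  have hbound : ∀ (c : ℕ) (y : ℕ → ℝ → ℝ), c ≤ 1 → IsHalfLatticeBreather (deriv V) O κ L c y →
      ∀ (n : ℤ) (t : ℝ), |latticeField a ω c y n t| ≤
        (2 * C + 2 * a⁻¹ * L * C) * Real.sqrt (ω - ωmax) * Real.exp (κ / 2) ^ (-|n|) := by
    intro c y hc h n t
    refine (h.abs_latticeField_le hc ha hκ0.le hL.le n t).trans
      (mul_le_mul_of_nonneg_right ?_ (zpow_nonneg (Real.exp_pos _).le _))
    calc a⁻¹ * L * κ * Real.exp (κ / 2) ≤ a⁻¹ * L * (C * Real.sqrt (ω - ωmax)) * 2 := by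
          gcongr; linarith
      _ ≤ (2 * C + 2 * a⁻¹ * L * C) * Real.sqrt (ω - ωmax) := by
          have : 0 ≤ 2 * C * Real.sqrt (ω - ωmax) := by positivity
          linarith
  refine ⟨latticeField a ω 1 y₁, latticeField a ω 0 y₂, hy₁.latticeField_ne_zero ha hω0,
    hy₂.latticeField_ne_zero ha hω0, ?_, fun n t => ?_, fun n => ?_, Real.exp (κ / 2),
    Real.one_lt_exp_iff.2 (by linarith), ?_, ?_, ?_⟩
  · rintro x (rfl | rfl)
    exacts [hprop 1 y₁ le_rfl hy₁, hprop 0 y₂ zero_le_one hy₂]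
  · have h := hy₁.latticeField_reflect (a := a) (ω := ω) le_rfl n t
    rw [Nat.cast_one] at h
    rw [h, latticeField]
    congr 2
    field_simp
    push_cast
    ring
  · funext t
    have h := hy₂.latticeField_reflect (a := a) (ω := ω) zero_le_one n t
    simpa [latticeField] using h
  · rintro x (rfl | rfl)
    exacts [hbound 1 y₁ le_rfl hy₁, hbound 0 y₂ zero_le_one hy₂]
  · rw [inv_mul_le_iff₀ (by positivity)]
    calc Real.sqrt (ω - ωmax) ≤ 2 * C * (κ / 2) := by linarith [hlow hκ1]
      _ ≤ (2 * C + 2 * a⁻¹ * L * C) * (Real.exp (κ / 2) - 1) := by gcongr <;> linarith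
  · have : 0 ≤ (C + 2 * a⁻¹ * L * C) * Real.sqrt (ω - ωmax) := by positivity
    linarith
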